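/- If the equation x² − p₁p₂·y² = −1 has a solution in integers and ε₂·ε_{p₁p₂}·ε_{2p₁p₂} is a square in K₃⁺, then the order of Cl₂(K₃) equals 2·h₂(p₁p₂)·h₂(−p₁p₂). -/

import Mathlib

open NumberField IntermediateField

/-- `ε` is the fundamental unit of the real quadratic field `ℚ(√D)` (for `D > 1` squarefree):
elements of the ring of integers of `ℚ(√D)` are exactly the numbers `(x + y√D)/2` with
`x ≡ y·D (mod 2)`, and units are those with `x² - Dy² = ±4`.  The fundamental unit is the
least unit `> 1`; equivalently, every unit is of the form `±ε^k` with `k ∈ ℤ`. -/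
def IsFundUnit (D : ℕ) (ε : ℝ) : Prop :=
  1 < ε ∧
  (∃ x y : ℤ, ε = ((x : ℝ) + (y : ℝ) * Real.sqrt D) / 2 ∧
    (x ^ 2 - (D : ℤ) * y ^ 2 = 4 ∨ x ^ 2 - (D : ℤ) * y ^ 2 = -4)) ∧
  ∀ x y : ℤ, (x ^ 2 - (D : ℤ) * y ^ 2 = 4 ∨ x ^ 2 - (D : ℤ) * y ^ 2 = -4) →
    1 < ((x : ℝ) + (y : ℝ) * Real.sqrt D) / 2 →
    ε ≤ ((x : ℝ) + (y : ℝ) * Real.sqrt D) / 2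

/-- The Dirichlet series `∑ f n n^{-s}` converges absolutely for real `s > 1` and
`(s - 1) ∑ f n n^{-s}` tends to `r` as `s → 1⁺`. -/
def HasLResidue (f : ArithmeticFunction ℂ) (r : ℂ) : Prop :=
  (∀ s : ℝ, 1 < s → LSeriesSummable (fun n ↦ f n) s) ∧
    Filter.Tendsto (fun s : ℝ ↦ ((s : ℂ) - 1) * LSeries (fun n ↦ f n) s)
      (nhdsWithin 1 (Set.Ioi 1)) (nhds r)

/-- The number of integral ideals of norm `n`, as an arithmetic function. -/
noncomputable def idealCount (K : Type*) [Field K] [NumberField K] : ArithmeticFunction ℂ where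
  toFun n := if n = 0 then 0 else (Nat.card {I : Ideal (𝓞 K) // I.absNorm = n} : ℂ)
  map_zero' := by simp

theorem idealCount_apply {K : Type*} [Field K] [NumberField K] {n : ℕ} (hn : n ≠ 0) :
    idealCount K n = (Nat.card {I : Ideal (𝓞 K) // I.absNorm = n} : ℂ) := by
  simp [idealCount, hn]

theorem idealCount_sum_isBigO (K : Type*) [Field K] [NumberField K] :
    (fun n : ℕ ↦ ∑ k ∈ Finset.Icc 1 n, (Nat.card {I : Ideal (𝓞 K) // I.absNorm = k} : ℝ))
      =O[Filter.atTop] fun n ↦ (n : ℝ) ^ (1 : ℝ) := by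
  have h1 : Filter.Tendsto (fun n : ℕ ↦
      (Nat.card {I : Ideal (𝓞 K) // Ideal.absNorm I ≤ (n : ℝ)} : ℝ) / n) Filter.atTop (nhds _) :=
    (Ideal.tendsto_norm_le_div_atTop K).comp tendsto_natCast_atTop_atTop
  have h2 := h1.isBigO_one ℝ
  have h3 : (fun n : ℕ ↦ (Nat.card {I : Ideal (𝓞 K) // Ideal.absNorm I ≤ (n : ℝ)} : ℝ))
      =O[Filter.atTop] fun n ↦ (n : ℝ) ^ (1 : ℝ) := by
    have h4 := h2.mul (Asymptotics.isBigO_refl (fun n : ℕ ↦ (n : ℝ)) Filter.atTop)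
    refine (h4.congr' ?_ ?_)
    · filter_upwards [Filter.eventually_ne_atTop 0] with n hn
      have : (n : ℝ) ≠ 0 := by exact_mod_cast hn
      field_simp
    · filter_upwards with n
      simp
  refine (Asymptotics.IsBigO.of_bound 1 ?_).trans h3
  filter_upwards with n
  rw [one_mul, Real.norm_of_nonneg (by positivity), Real.norm_of_nonneg (by positivity)]
  have hfin : Finite {I : Ideal (𝓞 K) // Ideal.absNorm I ≤ (n : ℝ)} := by
    have := Ideal.finite_setOfPred_absNorm_le (S := 𝓞 K) n
    exact_mod_cast this.to_subtype
  have hfin' (k : ℕ) : Finite {I : Ideal (𝓞 K) // Ideal.absNorm I = k} :=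
    (Ideal.finite_setOfPred_absNorm_eq (S := 𝓞 K) k).to_subtype
  norm_cast
  have : ∑ k ∈ Finset.Icc 1 n, Nat.card {I : Ideal (𝓞 K) // I.absNorm = k} =
      Nat.card (Σ k : Finset.Icc 1 n, {I : Ideal (𝓞 K) // I.absNorm = k}) := by
    rw [Nat.card_sigma, Finset.sum_coe_sort (Finset.Icc 1 n)
      (fun k ↦ Nat.card {I : Ideal (𝓞 K) // I.absNorm = k})]
  rw [this]
  have hfin2 : Finite {I : Ideal (𝓞 K) // Ideal.absNorm I ≤ n} := by exact_mod_cast hfin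
  refine Nat.card_le_card_of_injective
    (fun x : (Σ k : Finset.Icc 1 n, {I : Ideal (𝓞 K) // I.absNorm = k}) ↦
      (⟨x.2.1, by rw [x.2.2]; exact (Finset.mem_Icc.1 x.1.2).2⟩ :
        {I : Ideal (𝓞 K) // Ideal.absNorm I ≤ n})) ?_
  rintro ⟨⟨k, hk⟩, ⟨I, hI⟩⟩ ⟨⟨k', hk'⟩, ⟨I', hI'⟩⟩ h
  simp only [Subtype.mk.injEq] at h hI hI'
  subst h hI hI'
  rfl

theorem hasLResidue_idealCount (K : Type*) [Field K] [NumberField K] :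
    HasLResidue (idealCount K) (dedekindZeta_residue K) := by
  have hc {n : ℕ} (hn : n ≠ 0) :
      (fun n ↦ ((Nat.card {I : Ideal (𝓞 K) // I.absNorm = n} : ℝ) : ℂ)) n = idealCount K n := by
    rw [idealCount_apply hn]; simp
  constructor
  · intro s hs
    refine (LSeriesSummable_congr _ hc).1 ?_
    exact LSeriesSummable_of_sum_norm_bigO_and_nonneg (idealCount_sum_isBigO K)
      (fun _ ↦ Nat.cast_nonneg _) zero_le_one (by simpa using hs)
  · refine (tendsto_sub_one_mul_dedekindZeta_nhdsGT K).congr fun s ↦ ?_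
    rw [dedekindZeta]
    congr 1
    refine LSeries_congr (fun {n} hn ↦ ?_) _
    rw [idealCount_apply hn]

theorem hasLResidue_zeta : HasLResidue (ArithmeticFunction.zeta : ArithmeticFunction ℂ) 1 := by
  have key (s : ℝ) (hs : 1 < s) :
      LSeries (fun n ↦ (ArithmeticFunction.zeta : ArithmeticFunction ℂ) n) s = riemannZeta s := by
    exact ArithmeticFunction.LSeries_zeta_eq_riemannZeta (s := (s : ℂ)) (by simpa using hs)
  constructor
  · intro s hs
    exact ArithmeticFunction.LSeriesSummable_zeta_iff.2 (by simpa using hs)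
  · have h := riemannZeta_residue_one
    have h2 : Filter.Tendsto (fun s : ℝ ↦ (s : ℂ)) (nhdsWithin 1 (Set.Ioi 1))
        (nhdsWithin 1 {1}ᶜ) := by
      refine tendsto_nhdsWithin_iff.2 ⟨?_, ?_⟩
      · exact (Complex.continuous_ofReal.tendsto' 1 1 (by simp)).mono_left nhdsWithin_le_nhds
      · filter_upwards [self_mem_nhdsWithin] with s hs
        simp only [Set.mem_compl_iff, Set.mem_singleton_iff]
        norm_cast
        exact (ne_of_gt hs)
    refine (h.comp h2).congr' ?_
    filter_upwards [self_mem_nhdsWithin] with s hs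
    rw [key s hs, Function.comp_apply]

theorem LSeries_finset_prod {ι : Type*} (t : Finset ι) (g : ι → ArithmeticFunction ℂ) {s : ℝ}
    (hs : 1 < s)    (h : ∀ i ∈ t, LSeriesSummable (fun n ↦ g i n) s) :
    LSeriesSummable (fun n ↦ (∏ i ∈ t, g i) n) s ∧
      LSeries (fun n ↦ (∏ i ∈ t, g i) n) s = ∏ i ∈ t, LSeries (fun n ↦ g i n) s := by
  classical
  induction t using Finset.induction_on with
  | empty =>
    simp only [Finset.prod_empty]
    rw [ArithmeticFunction.one_eq_delta]
    refine ⟨LSeriesSummable_of_bounded_of_one_lt_real (m := 1) (fun n _ ↦ ?_) hs, ?_⟩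
    · by_cases h1 : n = 1 <;> simp [LSeries.delta, h1]
    · simp [LSeries_delta]
  | insert a t ha ih =>
    obtain ⟨h1, h2⟩ := ih fun i hi ↦ h i (Finset.mem_insert_of_mem hi)
    have h3 := h a (Finset.mem_insert_self a t)
    rw [Finset.prod_insert ha, Finset.prod_insert ha, ← h2]
    exact ⟨ArithmeticFunction.LSeriesSummable_mul h3 h1, ArithmeticFunction.LSeries_mul' h3 h1⟩

theorem residue_eq_prod {ι : Type*} (t : Finset ι) (f : ArithmeticFunction ℂ)
    (g : ι → ArithmeticFunction ℂ) (r : ℂ) (r' : ι → ℂ) (hf : HasLResidue f r)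
    (hg : ∀ i ∈ t, HasLResidue (g i) (r' i))
    (h : f * ∏ _i ∈ t, (ArithmeticFunction.zeta : ArithmeticFunction ℂ) =
      (ArithmeticFunction.zeta : ArithmeticFunction ℂ) * ∏ i ∈ t, g i) :
    r = ∏ i ∈ t, r' i := by
  have hz := hasLResidue_zeta
  have lim1 := hf.2.mul (tendsto_finsetProd t fun _ _ ↦ hz.2)
  have lim2 := hz.2.mul (tendsto_finsetProd t fun i hi ↦ (hg i hi).2)
  simp only [Finset.prod_const_one, mul_one, one_mul] at lim1 lim2
  refine tendsto_nhds_unique (lim1.congr' ?_) lim2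
  filter_upwards [self_mem_nhdsWithin] with s hs
  have e1 := LSeries_finset_prod t (fun _ ↦ (ArithmeticFunction.zeta : ArithmeticFunction ℂ)) hs
    fun _ _ ↦ hz.1 s hs
  have e2 := LSeries_finset_prod t g hs fun i hi ↦ (hg i hi).1 s hs
  have e3 := congrArg (fun F : ArithmeticFunction ℂ ↦ LSeries (fun n ↦ F n) s) h
  rw [ArithmeticFunction.LSeries_mul' (hf.1 s hs) e1.1,
    ArithmeticFunction.LSeries_mul' (hz.1 s hs) e2.1, e1.2, e2.2] at e3
  rw [Finset.prod_mul_distrib, Finset.prod_mul_distrib]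
  linear_combination ((s : ℂ) - 1) * (∏ i ∈ t, ((s : ℂ) - 1)) * e3

/-- The Euler factor at `p` of an arithmetic function, as a power series in `p^{-s}`. -/
noncomputable def eulerSeries (p : ℕ) (f : ArithmeticFunction ℂ) : PowerSeries ℂ :=
  PowerSeries.mk fun k ↦ f (p ^ k)

theorem eulerSeries_mul {p : ℕ} (hp : p.Prime) (f g : ArithmeticFunction ℂ) :
    eulerSeries p (f * g) = eulerSeries p f * eulerSeries p g := by
  ext k
  rw [PowerSeries.coeff_mul, eulerSeries, PowerSeries.coeff_mk, ArithmeticFunction.mul_apply,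
    Nat.sum_divisorsAntidiagonal (fun x y ↦ f x * g y), Nat.sum_divisors_prime_pow hp,
    Finset.Nat.sum_antidiagonal_eq_sum_range_succ_mk]
  refine Finset.sum_congr rfl fun i hi ↦ ?_
  simp only [eulerSeries, PowerSeries.coeff_mk]
  rw [Nat.pow_div (Nat.lt_succ_iff.1 (Finset.mem_range.1 hi)) hp.pos]

theorem eulerSeries_one {p : ℕ} (hp : p.Prime) : eulerSeries p 1 = 1 := by
  ext k
  simp only [eulerSeries, PowerSeries.coeff_mk, PowerSeries.coeff_one,
    ArithmeticFunction.one_apply, Nat.pow_eq_one, hp.one_lt.ne', false_or]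

theorem eulerSeries_prod {p : ℕ} (hp : p.Prime) {ι : Type*} (t : Finset ι)
    (g : ι → ArithmeticFunction ℂ) :
    eulerSeries p (∏ i ∈ t, g i) = ∏ i ∈ t, eulerSeries p (g i) := by
  classical
  induction t using Finset.induction_on with
  | empty => simpa using eulerSeries_one hp
  | insert a t ha ih => rw [Finset.prod_insert ha, Finset.prod_insert ha, eulerSeries_mul hp, ih]

theorem eulerSeries_zeta {p : ℕ} (hp : p.Prime) :
    eulerSeries p (ArithmeticFunction.zeta : ArithmeticFunction ℂ) * (1 - PowerSeries.X) = 1 := by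
  have : eulerSeries p (ArithmeticFunction.zeta : ArithmeticFunction ℂ) =
      PowerSeries.mk 1 := by
    ext k
    simp [eulerSeries, hp.ne_zero]
  rw [this, PowerSeries.mk_one_mul_one_sub_eq_one]

section

variable {K : Type*} [Field K] [NumberField K]

/-- Ideals of norm `p ^ k` all of whose prime divisors lie in `S`. -/
def idealsSupported (S : Set (Ideal (𝓞 K))) (p k : ℕ) : Set (Ideal (𝓞 K)) :=
  {I | I.absNorm = p ^ k ∧ ∀ Q : Ideal (𝓞 K), Q.IsPrime → I ≤ Q → Q ∈ S}

theorem finite_idealsSupported (S : Set (Ideal (𝓞 K))) (p k : ℕ) :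
    (idealsSupported S p k).Finite :=
  (Ideal.finite_setOfPred_absNorm_eq (S := 𝓞 K) (p ^ k)).subset fun _ h ↦ h.1

theorem ncard_idealsSupported_insert {S : Set (Ideal (𝓞 K))} {p f : ℕ} (hp : p.Prime)
    {P : Ideal (𝓞 K)} [P.IsMaximal] (hP : P.absNorm = p ^ f) (hPS : P ∉ S) (k : ℕ) :
    (idealsSupported (insert P S) p k).ncard =
      (if f ≤ k then (idealsSupported (insert P S) p (k - f)).ncard else 0) +
        (idealsSupported S p k).ncard := by
  have hP0 : P ≠ ⊥ := by
    rintro rfl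
    simp only [Ideal.absNorm_bot] at hP
    exact (pow_pos hp.pos f).ne hP
  have hdis : Disjoint {I | I ∈ idealsSupported (insert P S) p k ∧ I ≤ P}
      (idealsSupported S p k) := by
    rw [Set.disjoint_left]
    rintro I ⟨-, h1⟩ h2
    exact hPS (h2.2 P inferInstance h1)
  have hun : idealsSupported (insert P S) p k =
      {I | I ∈ idealsSupported (insert P S) p k ∧ I ≤ P} ∪ idealsSupported S p k := by
    ext I
    constructor
    · intro h
      by_cases hI : I ≤ P
      · exact Or.inl ⟨h, hI⟩
      · refine Or.inr ⟨h.1, fun Q hQ hIQ ↦ ?_⟩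
        rcases h.2 Q hQ hIQ with rfl | h3
        · exact absurd hIQ hI
        · exact h3
    · rintro (h | h)
      · exact h.1
      · exact ⟨h.1, fun Q hQ hIQ ↦ Or.inr (h.2 Q hQ hIQ)⟩
  have hdiv {I : Ideal (𝓞 K)} (h : I ∈ idealsSupported (insert P S) p k) (hI : I ≤ P) :
      f ≤ k ∧ ∃ J ∈ idealsSupported (insert P S) p (k - f), P * J = I := by
    obtain ⟨J, rfl⟩ := Ideal.dvd_iff_le.2 hI
    have h1 := h.1
    rw [map_mul, hP] at h1
    have hfk : f ≤ k := (Nat.pow_dvd_pow_iff_le_right hp.one_lt).1 ⟨_, h1.symm⟩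
    refine ⟨hfk, J, ⟨?_, fun Q hQ hJQ ↦ h.2 Q hQ (Ideal.mul_le_right.trans hJQ)⟩, rfl⟩
    refine Nat.eq_of_mul_eq_mul_left (pow_pos hp.pos f) ?_
    rw [h1, ← pow_add, Nat.add_sub_cancel' hfk]
  refine (congrArg Set.ncard hun).trans ?_
  rw [Set.ncard_union_eq hdis ((finite_idealsSupported _ p k).subset fun _ h ↦ h.1)
    (finite_idealsSupported _ p k)]
  congr 1
  split_ifs with hfk
  · have : {I | I ∈ idealsSupported (insert P S) p k ∧ I ≤ P} =
        (P * ·) '' idealsSupported (insert P S) p (k - f) := by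
      ext I
      constructor
      · rintro ⟨h, hI⟩
        exact (hdiv h hI).2
      · rintro ⟨J, hJ, rfl⟩
        refine ⟨⟨?_, fun Q hQ hJQ ↦ ?_⟩, Ideal.mul_le_left⟩
        · rw [map_mul, hP, hJ.1, ← pow_add, Nat.add_sub_cancel' hfk]
        · rcases hQ.mul_le.1 hJQ with h | h
          · exact Or.inl (Ideal.IsMaximal.eq_of_le inferInstance hQ.ne_top h).symm
          · exact hJ.2 Q hQ h
    rw [this, Set.ncard_image_of_injective _ (mul_right_injective₀ hP0)]
  · rw [Set.ncard_eq_zero ((finite_idealsSupported _ p k).subset fun _ h ↦ h.1)]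
    ext I
    simp only [Set.mem_ofPred_eq, Set.mem_empty_iff_false, iff_false]
    rintro ⟨h, hI⟩
    exact hfk (hdiv h hI).1

theorem mk_ncard_idealsSupported {p : ℕ} (hp : p.Prime) (S : Finset (Ideal (𝓞 K)))
    (f : Ideal (𝓞 K) → ℕ) (hS : ∀ P ∈ S, P.IsMaximal ∧ P.absNorm = p ^ f P) :
    (PowerSeries.mk fun k ↦ ((idealsSupported (S : Set (Ideal (𝓞 K))) p k).ncard : ℂ)) *
      ∏ P ∈ S, (1 - PowerSeries.X ^ f P) = 1 := by
  classical
  induction S using Finset.induction_on with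
  | empty =>
    rw [Finset.prod_empty, mul_one]
    ext k
    rw [PowerSeries.coeff_mk, PowerSeries.coeff_one]
    have : idealsSupported ((∅ : Finset (Ideal (𝓞 K))) : Set (Ideal (𝓞 K))) p k =
        if k = 0 then {⊤} else ∅ := by
      ext I
      constructor
      · rintro ⟨h1, h2⟩
        have : I = ⊤ := by
          by_contra hI
          obtain ⟨M, hM, hIM⟩ := Ideal.exists_le_maximal I hI
          simpa using h2 M hM.isPrime hIM
        subst this
        rw [Ideal.absNorm_top, eq_comm, Nat.pow_eq_one] at h1
        rw [if_pos (h1.resolve_left hp.one_lt.ne')]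
        rfl
      · split_ifs with hk
        · rintro rfl
          exact ⟨by simp [hk], fun Q hQ h ↦ absurd (top_le_iff.1 h) hQ.ne_top⟩
        · simp
    rw [this]
    split_ifs <;> simp
  | insert P S hPS ih =>
    rw [Finset.prod_insert hPS, ← mul_assoc]
    refine Eq.trans (congrArg (· * _) ?_) (ih fun P hP ↦ hS P (Finset.mem_insert_of_mem hP))
    obtain ⟨h1, h2⟩ := hS P (Finset.mem_insert_self P S)
    ext k
    rw [mul_sub, mul_one, map_sub, PowerSeries.coeff_mul_X_pow', PowerSeries.coeff_mk,
      PowerSeries.coeff_mk, PowerSeries.coeff_mk, Finset.coe_insert,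
      ncard_idealsSupported_insert hp h2 (by simpa using hPS) k]
    push_cast
    split_ifs <;> ring

theorem eulerSeries_idealCount {p : ℕ} (hp : p.Prime) (S : Finset (Ideal (𝓞 K)))
    (hS : (S : Set (Ideal (𝓞 K))) = Ideal.primesOver (Ideal.span {(p : ℤ)}) (𝓞 K)) :
    eulerSeries p (idealCount K) *
      ∏ P ∈ S, (1 - PowerSeries.X ^ P.inertiaDeg ℤ) = 1 := by
  have hspan : Ideal.span {(p : ℤ)} ≠ ⊥ := by simpa using hp.ne_zero
  have : (Ideal.span {(p : ℤ)}).IsPrime :=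
    (Ideal.span_singleton_prime (by simpa using hp.ne_zero)).2 (Nat.prime_iff_prime_int.1 hp)
  have : (Ideal.span {(p : ℤ)}).IsMaximal := Ideal.IsPrime.isMaximal inferInstance hspan
  refine Eq.trans (congrArg (· * _) ?_)
    (mk_ncard_idealsSupported hp S (fun P ↦ P.inertiaDeg ℤ) fun P hP ↦ ?_)
  · ext k
    rw [eulerSeries, PowerSeries.coeff_mk, PowerSeries.coeff_mk,
      idealCount_apply (pow_ne_zero k hp.ne_zero), ← Nat.card_coe_set_eq]
    congr 2
    refine congrArg _ (Set.ext fun I ↦ ⟨fun h ↦ ⟨h, fun Q hQ hIQ ↦ ?_⟩, fun h ↦ h.1⟩)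
    rw [hS]
    refine ⟨hQ, ⟨?_⟩⟩
    have h1 : (Ideal.span {(p : ℤ)}) ≤ Q.under ℤ := by
      rw [Ideal.span_singleton_le_iff_mem, Ideal.mem_comap]
      refine hQ.mem_of_pow_mem k ?_
      rw [← map_pow]
      have := hIQ (Ideal.absNorm_mem I)
      rw [show I.absNorm = p ^ k from h] at this
      simpa using this
    exact Ideal.IsMaximal.eq_of_le inferInstance (Ideal.IsPrime.ne_top inferInstance) h1
  · have hP' : P ∈ Ideal.primesOver (Ideal.span {(p : ℤ)}) (𝓞 K) := hS ▸ hP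
    have := hP'.1
    have := hP'.2
    refine ⟨Ideal.primesOver.isMaximal ⟨P, hP'⟩, ?_⟩
    have := Ideal.absNorm_pow_inertiaDeg (Ideal.span {(p : ℤ)}) P
    simpa using this.symm

omit [NumberField K] in
theorem Ideal.eq_mul_sup_span_of_coprime {J L : Ideal (𝓞 K)} {m n : ℕ} (hmn : m.Coprime n)
    (hm : (m : 𝓞 K) ∈ J) (hn : (n : 𝓞 K) ∈ L) : J = J * L ⊔ Ideal.span {(m : 𝓞 K)} := by
  refine le_antisymm ?_ (sup_le Ideal.mul_le_left
    ((Ideal.span_singleton_le_iff_mem _).2 hm))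
  have h1 : L ⊔ Ideal.span {(m : 𝓞 K)} = ⊤ := by
    rw [Ideal.eq_top_iff_one]
    obtain ⟨a, b, hab⟩ := Nat.isCoprime_iff_coprime.2 hmn
    have h2 : (1 : 𝓞 K) = (b : 𝓞 K) * n + (a : 𝓞 K) * m := by
      have := congrArg (fun z : ℤ ↦ (z : 𝓞 K)) hab
      push_cast at this
      rw [← this, add_comm]
    rw [h2]
    exact Ideal.add_mem _ (Ideal.mem_sup_left (Ideal.mul_mem_left _ _ hn))
      (Ideal.mem_sup_right (Ideal.mul_mem_left _ _ (Ideal.mem_span_singleton_self _)))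
  calc J = J * (L ⊔ Ideal.span {(m : 𝓞 K)}) := by rw [h1, Ideal.mul_top]
    _ = J * L ⊔ J * Ideal.span {(m : 𝓞 K)} := Ideal.mul_sup _ _ _
    _ ≤ _ := sup_le_sup_left Ideal.mul_le_right _

theorem Ideal.absNorm_sup_span_dvd {I : Ideal (𝓞 K)} {m n : ℕ} (hmn : m.Coprime n)
    (hI : I.absNorm = m * n) : (I ⊔ Ideal.span {(m : 𝓞 K)}).absNorm ∣ m := by
  have h1 : (I ⊔ Ideal.span {(m : 𝓞 K)}).absNorm ∣ m * n :=
    hI ▸ Ideal.absNorm_dvd_absNorm_of_le le_sup_left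
  have h2 : (I ⊔ Ideal.span {(m : 𝓞 K)}).absNorm ∣ m ^ Module.finrank ℤ (𝓞 K) := by
    have := Ideal.absNorm_dvd_absNorm_of_le (le_sup_right : _ ≤ I ⊔ Ideal.span {(m : 𝓞 K)})
    rwa [Ideal.absNorm_span_natCast] at this
  exact (Nat.Coprime.coprime_dvd_left h2 (hmn.pow_left _)).dvd_of_dvd_mul_right h1

theorem card_absNorm_eq_mul {m n : ℕ} (hm : m ≠ 0) (hn : n ≠ 0) (hmn : m.Coprime n) :
    Nat.card {I : Ideal (𝓞 K) // I.absNorm = m * n} =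
      Nat.card {I : Ideal (𝓞 K) // I.absNorm = m} *
        Nat.card {I : Ideal (𝓞 K) // I.absNorm = n} := by
  have hmem {J : Ideal (𝓞 K)} {k : ℕ} (h : J.absNorm = k) : (k : 𝓞 K) ∈ J :=
    h ▸ Ideal.absNorm_mem J
  rw [← Nat.card_prod]
  symm
  refine Nat.card_eq_of_bijective
    (fun x : {I : Ideal (𝓞 K) // I.absNorm = m} × {I : Ideal (𝓞 K) // I.absNorm = n} ↦
      (⟨x.1.1 * x.2.1, by rw [map_mul, x.1.2, x.2.2]⟩ :
        {I : Ideal (𝓞 K) // I.absNorm = m * n})) ⟨?_, ?_⟩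
  · rintro ⟨⟨J, hJ⟩, ⟨L, hL⟩⟩ ⟨⟨J', hJ'⟩, ⟨L', hL'⟩⟩ h
    simp only [Subtype.mk.injEq] at h
    have e1 : J = J' := by
      rw [Ideal.eq_mul_sup_span_of_coprime hmn (hmem hJ) (hmem hL), h,
        ← Ideal.eq_mul_sup_span_of_coprime hmn (hmem hJ') (hmem hL')]
    have e2 : L = L' := by
      rw [Ideal.eq_mul_sup_span_of_coprime hmn.symm (hmem hL) (hmem hJ), mul_comm, h,
        mul_comm, ← Ideal.eq_mul_sup_span_of_coprime hmn.symm (hmem hL') (hmem hJ')]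
    subst e1 e2
    rfl
  · rintro ⟨I, hI⟩
    have d1 := Ideal.absNorm_sup_span_dvd hmn hI
    have d2 := Ideal.absNorm_sup_span_dvd hmn.symm (hI.trans (mul_comm m n))
    set J := I ⊔ Ideal.span {(m : 𝓞 K)}
    set L := I ⊔ Ideal.span {(n : 𝓞 K)}
    have hle : J * L ≤ I := by
      rw [Ideal.sup_mul, Ideal.mul_sup, Ideal.mul_sup, Ideal.span_singleton_mul_span_singleton]
      refine sup_le (sup_le Ideal.mul_le_left Ideal.mul_le_left) (sup_le Ideal.mul_le_right ?_)
      rw [Ideal.span_singleton_le_iff_mem]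
      exact_mod_cast hmem hI
    have hd : m * n ∣ J.absNorm * L.absNorm := by
      rw [← hI, ← map_mul]
      exact Ideal.absNorm_dvd_absNorm_of_le hle
    have eJ : J.absNorm = m := by
      refine Nat.dvd_antisymm d1 ((hmn.coprime_dvd_right d2).dvd_of_dvd_mul_right
        ((Dvd.intro n rfl).trans hd))
    have eL : L.absNorm = n := by
      refine Nat.dvd_antisymm d2 ((hmn.symm.coprime_dvd_right d1).dvd_of_dvd_mul_left
        ((Dvd.intro_left m rfl).trans hd))
    refine ⟨⟨⟨J, eJ⟩, ⟨L, eL⟩⟩, Subtype.ext ?_⟩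
    obtain ⟨C, hC⟩ := Ideal.dvd_iff_le.2 hle
    have hC1 : C.absNorm = 1 := by
      have := congrArg Ideal.absNorm hC
      rw [map_mul, map_mul, eJ, eL, hI] at this
      exact Nat.eq_of_mul_eq_mul_left (Nat.pos_of_ne_zero (mul_ne_zero hm hn))
        (this.symm.trans (mul_one _).symm)
    rw [Ideal.absNorm_eq_one_iff] at hC1
    simpa [hC1] using hC

theorem isMultiplicative_idealCount (K : Type*) [Field K] [NumberField K] :
    (idealCount K).IsMultiplicative := by
  refine ArithmeticFunction.IsMultiplicative.iff_ne_zero.2 ⟨?_, fun {m n} hm hn hmn ↦ ?_⟩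
  · rw [idealCount_apply one_ne_zero]
    have : {I : Ideal (𝓞 K) | I.absNorm = 1} = {⊤} := by
      ext I
      simp [Ideal.absNorm_eq_one_iff]
    have h2 : Nat.card {I : Ideal (𝓞 K) // I.absNorm = 1} = ({⊤} : Set (Ideal (𝓞 K))).ncard := by
      rw [← this, ← Nat.card_coe_set_eq]
      rfl
    rw [h2, Set.ncard_singleton, Nat.cast_one]
  · rw [idealCount_apply hm, idealCount_apply hn, idealCount_apply (mul_ne_zero hm hn),
      card_absNorm_eq_mul hm hn hmn, Nat.cast_mul]

theorem ArithmeticFunction.IsMultiplicative.eq_of_eulerSeries_eq {f g : ArithmeticFunction ℂ}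
    (hf : f.IsMultiplicative) (hg : g.IsMultiplicative)
    (h : ∀ p : ℕ, p.Prime → eulerSeries p f = eulerSeries p g) : f = g := by
  refine (ArithmeticFunction.IsMultiplicative.eq_iff_eq_on_prime_powers f hf g hg).2 fun p k hp ↦ ?_
  simpa [eulerSeries] using congrArg (PowerSeries.coeff k) (h p hp)

end

/-- If the sum of `1` and the quadratic characters `χ i` is the regular character, then exactly
`(G : H)` of them, counting the trivial one, are trivial on `H`. -/
theorem card_mul_card_trivial_on {G ι : Type*} [Group G] [Fintype G] [Fintype ι]
    (χ : ι → G →* ℤˣ) (hcard : Nat.card G = 1 + Fintype.card ι)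
    (hχ : ∀ σ : G, σ ≠ 1 → 1 + ∑ i, ((χ i σ : ℤˣ) : ℤ) = 0) (H : Subgroup G)
    [DecidablePred fun i ↦ H ≤ (χ i).ker] :
    Nat.card H * (1 + (Finset.univ.filter fun i ↦ H ≤ (χ i).ker).card) = Nat.card G := by
  classical
  have hs (i : ι) : ∑ h : H, ((χ i h : ℤˣ) : ℤ) = if H ≤ (χ i).ker then (Nat.card H : ℤ) else 0 := by
    let f : H →* ℤ := (Units.coeHom ℤ).comp ((χ i).comp H.subtype)
    have := sum_hom_units f
    have hf : f = 1 ↔ H ≤ (χ i).ker := by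
      rw [MonoidHom.ext_iff]
      simp only [f, MonoidHom.comp_apply, Units.coeHom_apply, MonoidHom.one_apply,
        Units.val_eq_one, Subtype.forall]
      rfl
    simp only [hf] at this
    simpa [f, Nat.card_eq_fintype_card] using this
  have h1 : ∑ h : H, (1 + ∑ i, ((χ i h : ℤˣ) : ℤ)) = Nat.card G := by
    rw [Finset.sum_eq_single 1]
    · simp only [OneMemClass.coe_one, map_one, Units.val_one, Finset.sum_const, Finset.card_univ,
        hcard]
      simp
    · intro h _ hh
      exact hχ h (by simpa using hh)
    · simp
  rw [Finset.sum_add_distrib, Finset.sum_comm, Finset.sum_congr rfl fun i _ ↦ hs i,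
    Finset.sum_ite] at h1
  simp only [Finset.sum_const, Finset.card_univ, nsmul_eq_mul, mul_one, mul_zero, add_zero,
    ← Nat.card_eq_fintype_card] at h1
  zify
  rw [← h1]
  ring

section

variable {K : Type*} [Field K] [NumberField K]

theorem eulerSeries_idealCount_of_isGalois [IsGalois ℚ K] {p : ℕ} (hp : p.Prime) :
    eulerSeries p (idealCount K) *
      (1 - PowerSeries.X ^ (Ideal.span {(p : ℤ)}).inertiaDegIn (𝓞 K)) ^
        ((Ideal.span {(p : ℤ)}).primesOver (𝓞 K)).ncard = 1 := by
  have : (Ideal.span {(p : ℤ)}).IsPrime :=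
    (Ideal.span_singleton_prime (by simpa using hp.ne_zero)).2 (Nat.prime_iff_prime_int.1 hp)
  have hfin : ((Ideal.span {(p : ℤ)}).primesOver (𝓞 K)).Finite :=
    Algebra.QuasiFinite.finite_primesOver _
  have := eulerSeries_idealCount (K := K) hp hfin.toFinset (by simp)
  refine (congrArg _ ?_).trans this
  rw [Set.ncard_eq_toFinset_card _ hfin, ← Finset.prod_const]
  refine Finset.prod_congr rfl fun P hP ↦ ?_
  rw [Set.Finite.mem_toFinset] at hP
  have := hP.1
  have := hP.2
  rw [Ideal.inertiaDegIn_eq_inertiaDeg _ P Gal(K/ℚ)]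

theorem inertiaDeg_le_two [IsGalois ℚ K] (hG : ∀ σ : Gal(K/ℚ), σ ^ 2 = 1) (P : Ideal (𝓞 K))
    [P.IsPrime] (hP : P ≠ ⊥) : P.inertiaDeg ℤ = 1 ∨ P.inertiaDeg ℤ = 2 := by
  have hmax : P.IsMaximal := Ideal.IsPrime.isMaximal inferInstance hP
  have : Finite (𝓞 K ⧸ P) := Ideal.finiteQuotientOfFreeOfNeBot P hP
  have : Finite P.ResidueField := Finite.of_surjective _
    (Ideal.bijective_algebraMap_quotient_residueField P).2
  set p := P.under ℤ
  let := Localization.AtPrime.algebraOfLiesOver p P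
  have heq : (algebraMap (𝓞 K ⧸ P) P.ResidueField).comp (algebraMap (ℤ ⧸ p) (𝓞 K ⧸ P)) =
      (algebraMap p.ResidueField P.ResidueField).comp (algebraMap (ℤ ⧸ p) p.ResidueField) := by
    ext
    simp
  let := ((algebraMap (𝓞 K ⧸ P) P.ResidueField).comp
    (algebraMap (ℤ ⧸ p) (𝓞 K ⧸ P))).toAlgebra
  have : IsScalarTower (ℤ ⧸ p) (𝓞 K ⧸ P) P.ResidueField := .of_algebraMap_eq' rfl
  have : IsScalarTower (ℤ ⧸ p) p.ResidueField P.ResidueField := .of_algebraMap_eq' heq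
  have : IsGalois p.ResidueField P.ResidueField :=
    { __ := Ideal.IsFractionRing.normal Gal(K/ℚ) p P p.ResidueField P.ResidueField }
  have : Module.Finite p.ResidueField P.ResidueField :=
    Ideal.IsFractionRing.finite_of_isInvariant Gal(K/ℚ) p P p.ResidueField P.ResidueField
  rw [Ideal.inertiaDeg_eq p P, ← IsGalois.card_aut_eq_finrank p.ResidueField P.ResidueField]
  obtain ⟨g, hg⟩ := IsCyclic.exists_generator (α := Gal(P.ResidueField/p.ResidueField))
  rw [← Nat.dvd_prime Nat.prime_two, ← orderOf_eq_card_of_forall_mem_zpowers hg]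
  refine orderOf_dvd_of_pow_eq_one ?_
  let e := IsFractionRing.stabilizerQuotientInertiaEquiv Gal(K/ℚ) p P p.ResidueField P.ResidueField
  obtain ⟨x, rfl⟩ := e.surjective g
  obtain ⟨y, rfl⟩ := QuotientGroup.mk_surjective x
  rw [← map_pow, ← QuotientGroup.mk_pow, show y ^ 2 = 1 from Subtype.ext (hG y)]
  simp

open Ideal Pointwise in
/-- The decomposition and inertia groups at `P` of a Galois extension are, compared with those of
the extension of an intermediate field `F`, larger by the factors `e f` and `e` of `F`. -/
theorem card_stabilizer_inertia_fixingSubgroup [IsGalois ℚ K] (F : IntermediateField ℚ K)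
    [IsGalois ℚ F] (p : Ideal ℤ) [p.IsPrime] (P : Ideal (𝓞 K)) [P.IsPrime]
    [P.LiesOver p] :
    Nat.card (MulAction.stabilizer Gal(K/ℚ) P) =
        Nat.card (MulAction.stabilizer Gal(K/ℚ) P ⊓ F.fixingSubgroup : Subgroup Gal(K/ℚ)) *
          (p.ramificationIdxIn (𝓞 F) * p.inertiaDegIn (𝓞 F)) ∧
      Nat.card (P.inertia Gal(K/ℚ)) =
        Nat.card (P.inertia Gal(K/ℚ) ⊓ F.fixingSubgroup : Subgroup Gal(K/ℚ)) *
          p.ramificationIdxIn (𝓞 F) := by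
  set 𝔭 := P.under (𝓞 F)
  have : 𝔭.LiesOver p := LiesOver.tower_bot P 𝔭 p
  have : Nonempty (𝔭.primesOver (𝓞 K)) := ⟨⟨P, inferInstance, inferInstance⟩⟩
  have : IsGaloisGroup (fixingSubgroup Gal(K/ℚ) (F : Set K)) (𝓞 F) (𝓞 K) :=
    IsGaloisGroup.of_isFractionRing _ _ _ F K
  have h1 := card_stabilizer_eq (G := Gal(K/ℚ)) p P
  have h2 := card_stabilizer_eq (G := fixingSubgroup Gal(K/ℚ) (F : Set K)) 𝔭 P
  have h3 := card_inertia_eq_ramificationIdxIn (G := Gal(K/ℚ)) p P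
  have h4 := card_inertia_eq_ramificationIdxIn (G := fixingSubgroup Gal(K/ℚ) (F : Set K)) 𝔭 P
  have h5 := inertiaDegIn_mul_inertiaDegIn p 𝔭 Gal(F/ℚ) (𝓞 K) Gal(K/ℚ)
    (fixingSubgroup Gal(K/ℚ) (F : Set K))
  have h6 := ramificationIdxIn_mul_ramificationIdxIn (p := p) 𝔭 Gal(F/ℚ) (𝓞 K) Gal(K/ℚ)
    (fixingSubgroup Gal(K/ℚ) (F : Set K))
  have h7 : Nat.card (MulAction.stabilizer (fixingSubgroup Gal(K/ℚ) (F : Set K)) P) =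
      Nat.card (MulAction.stabilizer Gal(K/ℚ) P ⊓ F.fixingSubgroup : Subgroup Gal(K/ℚ)) :=
    Nat.card_congr ⟨fun x ↦ ⟨x.1.1, x.2, x.1.2⟩, fun x ↦ ⟨⟨x.1, x.2.2⟩, x.2.1⟩,
      fun _ ↦ rfl, fun _ ↦ rfl⟩
  have h8 : Nat.card (P.inertia (fixingSubgroup Gal(K/ℚ) (F : Set K))) =
      Nat.card (P.inertia Gal(K/ℚ) ⊓ F.fixingSubgroup : Subgroup Gal(K/ℚ)) :=
    Nat.card_congr ⟨fun x ↦ ⟨x.1.1, x.2, x.1.2⟩, fun x ↦ ⟨⟨x.1, x.2.2⟩, x.2.1⟩,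
      fun _ ↦ rfl, fun _ ↦ rfl⟩
  rw [← h7, ← h8, h1, h3, ← h5, ← h6]
  erw [h2, h4]
  constructor <;> ring

open Ideal Pointwise PowerSeries in
/-- The Euler factor of a quadratic field inside a Galois extension, in terms of the decomposition
and inertia groups of a prime of the top field. -/
theorem eulerSeries_idealCount_quadratic [IsGalois ℚ K] (F : IntermediateField ℚ K)
    (hF : Module.finrank ℚ F = 2) {p : ℕ} (hp : p.Prime) (P : Ideal (𝓞 K)) [P.IsPrime]
    [P.LiesOver (span {(p : ℤ)})]
    [Decidable (MulAction.stabilizer Gal(K/ℚ) P ≤ F.fixingSubgroup)]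
    [Decidable (P.inertia Gal(K/ℚ) ≤ F.fixingSubgroup)] :
    eulerSeries p (idealCount F) * ((1 - X) *
      if MulAction.stabilizer Gal(K/ℚ) P ≤ F.fixingSubgroup then 1 - X else
        if P.inertia Gal(K/ℚ) ≤ F.fixingSubgroup then 1 + X else 1) = 1 := by
  have : (span {(p : ℤ)}).IsPrime :=
    (span_singleton_prime (by simpa using hp.ne_zero)).2 (Nat.prime_iff_prime_int.1 hp)
  have : IsGalois ℚ F := by
    have : Algebra.IsQuadraticExtension ℚ F := ⟨hF⟩
    infer_instance
  have hle {H : Subgroup Gal(K/ℚ)} : H ≤ F.fixingSubgroup ↔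
      Nat.card H = Nat.card (H ⊓ F.fixingSubgroup : Subgroup Gal(K/ℚ)) := by
    rw [← inf_eq_left]
    refine ⟨fun h ↦ by rw [h], fun h ↦ Subgroup.eq_of_le_of_card_ge inf_le_left h.le⟩
  obtain ⟨h1, h2⟩ := card_stabilizer_inertia_fixingSubgroup F (span {(p : ℤ)}) P
  have h3 := ncard_primesOver_mul_ramificationIdxIn_mul_inertiaDegIn (span {(p : ℤ)}) (𝓞 F) Gal(F/ℚ)
  rw [IsGalois.card_aut_eq_finrank, hF] at h3
  refine (congrArg _ ?_).trans (eulerSeries_idealCount_of_isGalois (K := F) hp)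
  have hD : MulAction.stabilizer Gal(K/ℚ) P ≤ F.fixingSubgroup ↔
      (span {(p : ℤ)}).ramificationIdxIn (𝓞 F) * (span {(p : ℤ)}).inertiaDegIn (𝓞 F) = 1 := by
    rw [hle, h1, Nat.mul_eq_left Nat.card_pos.ne']
  have hI : P.inertia Gal(K/ℚ) ≤ F.fixingSubgroup ↔
      (span {(p : ℤ)}).ramificationIdxIn (𝓞 F) = 1 := by
    rw [hle, h2, Nat.mul_eq_left Nat.card_pos.ne']
  simp only [hD, hI]
  generalize (span {(p : ℤ)}).ramificationIdxIn (𝓞 F) = e at *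
  generalize (span {(p : ℤ)}).inertiaDegIn (𝓞 F) = f at *
  generalize ((span {(p : ℤ)}).primesOver (𝓞 F)).ncard = g at *
  have hg : g ∣ 2 := ⟨_, h3.symm⟩
  have hef : e * f ∣ 2 := ⟨_, by rw [← h3, mul_comm]⟩
  have he : e ∣ 2 := (Dvd.intro f rfl).trans hef
  have hf : f ∣ 2 := (Dvd.intro_left e rfl).trans hef
  rw [Nat.dvd_prime Nat.prime_two] at hg he hf
  rcases hg with rfl | rfl <;> rcases he with rfl | rfl <;> rcases hf with rfl | rfl <;>
    first | omega | (norm_num; done) | (norm_num; ring)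

open Ideal Pointwise PowerSeries in
theorem eulerSeries_idealCount_mul_zeta [IsGalois ℚ K] (hG : ∀ σ : Gal(K/ℚ), σ ^ 2 = 1)
    {ι : Type*} [Fintype ι] (F : ι → IntermediateField ℚ K) (χ : ι → Gal(K/ℚ) →* ℤˣ)
    (hker : ∀ i, (χ i).ker = (F i).fixingSubgroup) (hF : ∀ i, Module.finrank ℚ (F i) = 2)
    (hcard : Module.finrank ℚ K = 1 + Fintype.card ι)
    (hχ : ∀ σ : Gal(K/ℚ), σ ≠ 1 → 1 + ∑ i, ((χ i σ : ℤˣ) : ℤ) = 0) {p : ℕ} (hp : p.Prime) :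
    eulerSeries p (idealCount K) *
        ∏ _i : ι, eulerSeries p (ArithmeticFunction.zeta : ArithmeticFunction ℂ) =
      eulerSeries p (ArithmeticFunction.zeta : ArithmeticFunction ℂ) *
        ∏ i, eulerSeries p (idealCount (F i)) := by
  classical
  have hp0 : span {(p : ℤ)} ≠ ⊥ := by simpa using hp.ne_zero
  have hpP : (span {(p : ℤ)}).IsPrime :=
    (span_singleton_prime (by simpa using hp.ne_zero)).2 (Nat.prime_iff_prime_int.1 hp)
  obtain ⟨⟨P, hP, hPp⟩⟩ := (inferInstance : Nonempty ((span {(p : ℤ)}).primesOver (𝓞 K)))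
  have hP0 : P ≠ ⊥ := ne_bot_of_liesOver_of_ne_bot hp0 P
  set D := MulAction.stabilizer Gal(K/ℚ) P
  set I := P.inertia Gal(K/ℚ)
  have hID : I ≤ D := inertia_le_stabilizer (M := Gal(K/ℚ)) P
  have hGc : Nat.card Gal(K/ℚ) = 1 + Fintype.card ι := by
    rw [IsGalois.card_aut_eq_finrank, hcard]
  have cD := card_mul_card_trivial_on χ hGc hχ D
  have cI := card_mul_card_trivial_on χ hGc hχ I
  have cs := ncard_primesOver_mul_card_inertia_mul_finrank (G := Gal(K/ℚ)) (span {(p : ℤ)}) P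
  have cDI := card_stabilizer_eq_card_inertia_mul_finrank (G := Gal(K/ℚ)) (span {(p : ℤ)}) P
  have hK := eulerSeries_idealCount_of_isGalois (K := K) hp
  rw [inertiaDegIn_eq_inertiaDeg _ P Gal(K/ℚ)] at hK
  have hf := inertiaDeg_le_two hG P hP0
  set f := P.inertiaDeg ℤ
  set g := ((span {(p : ℤ)}).primesOver (𝓞 K)).ncard
  let L : ι → PowerSeries ℂ := fun i ↦
    if D ≤ (F i).fixingSubgroup then 1 - X else if I ≤ (F i).fixingSubgroup then 1 + X else 1
  have hL (i : ι) : eulerSeries p (idealCount (F i)) * ((1 - X) * L i) = 1 :=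
    eulerSeries_idealCount_quadratic (F i) (hF i) hp P
  have hZ := eulerSeries_zeta hp
  have hEL (i : ι) : eulerSeries p (idealCount (F i)) * L i =
      eulerSeries p (ArithmeticFunction.zeta : ArithmeticFunction ℂ) := by
    linear_combination (eulerSeries p (ArithmeticFunction.zeta : ArithmeticFunction ℂ)) * hL i -
      eulerSeries p (idealCount (F i)) * L i * hZ
  set A := Finset.univ.filter fun i ↦ D ≤ (χ i).ker
  set B := Finset.univ.filter fun i ↦ I ≤ (χ i).ker
  have hAB : A ⊆ B := fun i hi ↦ by
    simp only [A, B, Finset.mem_filter_univ] at hi ⊢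
    exact hID.trans hi
  have hprodL : ∏ i, L i = (1 - X) ^ A.card * (1 + X) ^ (B.card - A.card) := by
    have h1 (i : ι) : L i = if i ∈ A then 1 - X else if i ∈ B then 1 + X else 1 := by
      simp [L, A, B, hker]
    rw [Finset.prod_congr rfl fun i _ ↦ h1 i, Finset.prod_ite, Finset.prod_ite,
      Finset.prod_const, Finset.prod_const, Finset.prod_const_one, mul_one,
      ← Finset.card_sdiff_of_subset hAB]
    congr 3
    · simp
    · ext i
      simp [and_comm]
  have hmain : (1 - X ^ f) ^ g = (1 - X) * ∏ i, L i := by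
    have hIpos : 0 < Nat.card I := Nat.card_pos
    have hA : 1 + A.card = g := by
      have hDpos : 0 < Nat.card D := Nat.card_pos
      refine Nat.eq_of_mul_eq_mul_left hDpos ?_
      rw [cD, cDI, ← cs]
      ring
    have hB : 1 + B.card = g * f := by
      refine Nat.eq_of_mul_eq_mul_left hIpos ?_
      rw [cI, ← cs]
      ring
    rw [hprodL, ← mul_assoc, ← pow_succ', add_comm A.card, hA]
    rcases hf with h | h <;> rw [h] at hB ⊢
    · rw [show B.card - A.card = 0 by omega, pow_zero, mul_one, pow_one]
    · rw [show B.card - A.card = g by omega, ← mul_pow]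
      congr 1
      ring
  rw [hmain] at hK
  calc _ = eulerSeries p (idealCount K) * ∏ i, (eulerSeries p (idealCount (F i)) * L i) := by
        simp only [hEL]
    _ = _ := by
        rw [Finset.prod_mul_distrib]
        linear_combination (∏ i, eulerSeries p (idealCount (F i))) *
          ((eulerSeries p (ArithmeticFunction.zeta : ArithmeticFunction ℂ)) * hK -
          eulerSeries p (idealCount K) * (∏ i, L i) * hZ)

theorem residue_eq_prod_quadratic [IsGalois ℚ K] (hG : ∀ σ : Gal(K/ℚ), σ ^ 2 = 1)
    {ι : Type*} [Fintype ι] (F : ι → IntermediateField ℚ K) (χ : ι → Gal(K/ℚ) →* ℤˣ)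
    (hker : ∀ i, (χ i).ker = (F i).fixingSubgroup) (hF : ∀ i, Module.finrank ℚ (F i) = 2)
    (hcard : Module.finrank ℚ K = 1 + Fintype.card ι)
    (hχ : ∀ σ : Gal(K/ℚ), σ ≠ 1 → 1 + ∑ i, ((χ i σ : ℤˣ) : ℤ) = 0) :
    dedekindZeta_residue K = ∏ i, dedekindZeta_residue (F i) := by
  have h := residue_eq_prod Finset.univ (idealCount K) (fun i ↦ idealCount (F i))
    (dedekindZeta_residue K) (fun i ↦ dedekindZeta_residue (F i)) (hasLResidue_idealCount K)
    (fun i _ ↦ hasLResidue_idealCount (F i)) ?_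
  · exact_mod_cast h
  have hz : (ArithmeticFunction.zeta : ArithmeticFunction ℂ).IsMultiplicative :=
    ArithmeticFunction.isMultiplicative_zeta.natCast
  refine ArithmeticFunction.IsMultiplicative.eq_of_eulerSeries_eq
    ((isMultiplicative_idealCount K).mul
      (ArithmeticFunction.isMultiplicative_finsetProd _ _ fun _ _ ↦ hz))
    (hz.mul (ArithmeticFunction.isMultiplicative_finsetProd _ _
      fun i _ ↦ isMultiplicative_idealCount (F i))) fun p hp ↦ ?_
  rw [eulerSeries_mul hp, eulerSeries_mul hp, eulerSeries_prod hp, eulerSeries_prod hp]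
  exact eulerSeries_idealCount_mul_zeta hG F χ hker hF hcard hχ hp

end

theorem Rat.exists_int_eq_of_squarefree_mul_sq {d : ℤ} (hd : Squarefree d) {y : ℚ} {n : ℤ}
    (h : (d : ℚ) * y ^ 2 = n) : ∃ z : ℤ, y = z := by
  have hden : (y.den : ℤ) ^ 2 ∣ d * y.num ^ 2 := by
    refine ⟨n, ?_⟩
    have hy : y = y.num / y.den := (Rat.num_div_den y).symm
    have hne : (y.den : ℚ) ≠ 0 := by exact_mod_cast y.den_nz
    rw [hy, div_pow, mul_div_assoc', div_eq_iff (by positivity)] at h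
    have : ((d * y.num ^ 2 : ℤ) : ℚ) = (((y.den : ℤ) ^ 2 * n : ℤ) : ℚ) := by
      push_cast; rw [h]; ring
    exact_mod_cast this
  have hcop : IsCoprime ((y.den : ℤ) ^ 2) (y.num ^ 2) := by
    refine IsCoprime.pow ?_
    rw [Int.isCoprime_iff_gcd_eq_one, Int.gcd_comm]
    simpa [Int.gcd] using y.reduced
  have := hcop.dvd_of_dvd_mul_right hden
  have hu : IsUnit (y.den : ℤ) := hd _ (by simpa [sq] using this)
  have h1 : y.den = 1 := by simpa using Int.isUnit_iff_natAbs_eq.mp hu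
  exact ⟨y.num, (Rat.den_eq_one_iff y).mp h1 |>.symm⟩

theorem not_isSquare_of_squarefree {d : ℤ} (hd : Squarefree d) (hd1 : d ≠ 1) (q : ℚ) :
    q ^ 2 ≠ d := by
  intro h
  obtain ⟨z, rfl⟩ : ∃ z : ℤ, q = z := by
    refine Rat.exists_int_eq_of_squarefree_mul_sq (d := 1) squarefree_one (n := d) ?_
    simpa using h
  have h' : z ^ 2 = d := by exact_mod_cast h
  have hu : IsUnit z := hd z ⟨1, by rw [← h']; ring⟩
  apply hd1
  rw [← h']
  rcases Int.isUnit_iff.mp hu with rfl | rfl <;> norm_num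

section Quadratic

variable {k : Type*} [Field k] [NumberField k] {d : ℤ} {r : k}

theorem finrank_adjoin_sqrt {L : Type*} [Field L] [CharZero L] {d : ℤ} (hd : Squarefree d)
    (hd1 : d ≠ 1) {r : L} (hr : r ^ 2 = d) : Module.finrank ℚ ℚ⟮r⟯ = 2 := by
  have hm : (Polynomial.X ^ 2 - Polynomial.C (d : ℚ)).Monic :=
    Polynomial.monic_X_pow_sub_C _ two_ne_zero
  have hroot : Polynomial.aeval r (Polynomial.X ^ 2 - Polynomial.C (d : ℚ)) = 0 := by
    simp [hr]
  have hirr : Irreducible (Polynomial.X ^ 2 - Polynomial.C (d : ℚ)) := by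
    refine (X_pow_sub_C_irreducible_iff_of_prime Nat.prime_two).mpr fun b hb => ?_
    exact not_isSquare_of_squarefree hd hd1 b hb
  rw [IntermediateField.adjoin.finrank ⟨_, hm, hroot⟩,
    ← minpoly.eq_of_irreducible_of_monic hirr hroot hm, Polynomial.natDegree_X_pow_sub_C]

theorem sqrt_notMem_range (hd : Squarefree d) (hd1 : d ≠ 1) (hr : r ^ 2 = d) (q : ℚ) :
    (q : k) ≠ r := by
  intro h
  refine not_isSquare_of_squarefree hd hd1 q ?_
  rw [← h] at hr
  exact_mod_cast hr

theorem linearIndependent_one_sqrt (hd : Squarefree d) (hd1 : d ≠ 1) (hr : r ^ 2 = d) :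
    LinearIndependent ℚ ![(1 : k), r] := by
  rw [LinearIndependent.pair_iff]
  intro a b h
  rw [Algebra.smul_def, Algebra.smul_def, mul_one, eq_ratCast, eq_ratCast] at h
  have hb : b = 0 := by
    by_contra hb
    refine sqrt_notMem_range hd hd1 hr (-a / b) ?_
    have : (b : k) ≠ 0 := by exact_mod_cast hb
    push_cast
    rw [div_eq_iff this]
    linear_combination -h
  refine ⟨?_, hb⟩
  rw [hb] at h
  simpa using h

theorem exists_coords (hd : Squarefree d) (hd1 : d ≠ 1) (hr : r ^ 2 = d)
    (h2 : Module.finrank ℚ k = 2) (x : k) : ∃ a b : ℚ, x = a + b * r := by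
  have hspan := (linearIndependent_one_sqrt hd hd1 hr).span_eq_top_of_card_eq_finrank'
    (by simp [h2])
  have hx : x ∈ Submodule.span ℚ (Set.range ![(1 : k), r]) := hspan ▸ Submodule.mem_top
  rw [Matrix.range_cons, Matrix.range_cons, Matrix.range_empty, Set.union_empty,
    Set.singleton_union, Submodule.mem_span_pair] at hx
  obtain ⟨a, b, rfl⟩ := hx
  exact ⟨a, b, by simp [Algebra.smul_def]⟩

theorem exists_conj (hd : Squarefree d) (hd1 : d ≠ 1) (hr : r ^ 2 = d)
    (h2 : Module.finrank ℚ k = 2) :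
    ∃ σ : k ≃ₐ[ℚ] k, σ r = -r ∧ ∀ x, algebraMap ℚ k (Algebra.norm ℚ x) = x * σ x := by
  classical
  have : Algebra.IsQuadraticExtension ℚ k := ⟨h2⟩
  have hcard : Nat.card (k ≃ₐ[ℚ] k) = 2 := by rw [IsGalois.card_aut_eq_finrank, h2]
  have : Nontrivial (k ≃ₐ[ℚ] k) := by
    rw [← Finite.one_lt_card_iff_nontrivial, hcard]; norm_num
  obtain ⟨σ, hσ⟩ := exists_ne (1 : k ≃ₐ[ℚ] k)
  have huniv : (Finset.univ : Finset (k ≃ₐ[ℚ] k)) = {1, σ} := by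
    symm
    rw [← Finset.card_eq_iff_eq_univ, Finset.card_pair hσ.symm, ← Nat.card_eq_fintype_card, hcard]
  refine ⟨σ, ?_, fun x => ?_⟩
  · have h : (σ r) ^ 2 = r ^ 2 := by rw [← map_pow, hr, map_intCast]
    refine (sq_eq_sq_iff_eq_or_eq_neg.mp h).resolve_left fun h => hσ ?_
    ext x
    obtain ⟨a, b, rfl⟩ := exists_coords hd hd1 hr h2 x
    simp [h]
  · rw [Algebra.norm_eq_prod_automorphisms, huniv, Finset.prod_pair hσ.symm]
    simp

theorem norm_coords (hd : Squarefree d) (hd1 : d ≠ 1) (hr : r ^ 2 = d)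
    (h2 : Module.finrank ℚ k = 2) (a b : ℚ) :
    Algebra.norm ℚ ((a : k) + b * r) = a ^ 2 - d * b ^ 2 := by
  obtain ⟨σ, hσ, hn⟩ := exists_conj hd hd1 hr h2
  have h := hn (a + b * r)
  simp only [map_add, map_mul, hσ, map_ratCast] at h
  have : ((Algebra.norm ℚ ((a : k) + b * r) : ℚ) : k) = ((a ^ 2 - d * b ^ 2 : ℚ) : k) := by
    rw [← eq_ratCast (algebraMap ℚ k), h]
    push_cast
    rw [← hr]
    ring
  exact_mod_cast this

theorem exists_int_coords (hd : Squarefree d) (hd1 : d ≠ 1) (hr : r ^ 2 = d)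
    (h2 : Module.finrank ℚ k = 2) (x : 𝓞 k) :
    ∃ t y : ℤ, 2 * (x : k) = t + y * r ∧ 4 * Algebra.norm ℤ x = t ^ 2 - d * y ^ 2 := by
  obtain ⟨σ, hσ, hn⟩ := exists_conj hd hd1 hr h2
  obtain ⟨a, b, hab⟩ := exists_coords hd hd1 hr h2 (x : k)
  have hnorm := norm_coords hd hd1 hr h2 a b
  rw [← hab, ← Algebra.coe_norm_int] at hnorm
  have hr_int : IsIntegral ℤ ((2 * a : ℚ) : k) := by
    have : ((2 * a : ℚ) : k) = (x : k) + σ (x : k) := by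
      rw [hab]; simp [hσ]; ring
    rw [this]
    exact x.isIntegral_coe.add (x.isIntegral_coe.map σ)
  have hr_int' : IsIntegral ℤ (2 * a : ℚ) := by
    rw [← isIntegral_algebraMap_iff (algebraMap ℚ k).injective]
    simpa using hr_int
  obtain ⟨t, ht⟩ := IsIntegrallyClosed.isIntegral_iff.mp hr_int'
  have ht' : 2 * a = t := by simpa using ht.symm
  obtain ⟨y, hy⟩ := Rat.exists_int_eq_of_squarefree_mul_sq hd (y := 2 * b)
    (n := t ^ 2 - 4 * Algebra.norm ℤ x) (by push_cast; rw [hnorm, ← ht']; ring)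
  refine ⟨t, y, ?_, ?_⟩
  · have h1 : ((2 * a : ℚ) : k) = t := by rw [ht']; simp
    have h3 : ((2 * b : ℚ) : k) = y := by rw [hy]; simp
    push_cast at h1 h3
    rw [← h1, ← h3, hab]
    ring
  · have : ((4 * Algebra.norm ℤ x : ℤ) : ℚ) = ((t ^ 2 - d * y ^ 2 : ℤ) : ℚ) := by
      push_cast
      rw [hnorm, ← ht', ← hy]
      ring
    exact_mod_cast this

theorem trace_coords (hd : Squarefree d) (hd1 : d ≠ 1) (hr : r ^ 2 = d)
    (h2 : Module.finrank ℚ k = 2) (a b : ℚ) :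
    Algebra.trace ℚ k ((a : k) + b * r) = 2 * a := by
  classical
  have : Algebra.IsQuadraticExtension ℚ k := ⟨h2⟩
  have hcard : Nat.card (k ≃ₐ[ℚ] k) = 2 := by rw [IsGalois.card_aut_eq_finrank, h2]
  obtain ⟨σ, hσ, -⟩ := exists_conj hd hd1 hr h2
  have hr0 : r ≠ 0 := by
    rintro rfl
    exact hd.ne_zero (by exact_mod_cast (by simpa using hr.symm : (d : k) = 0))
  have hσ1 : (1 : k ≃ₐ[ℚ] k) ≠ σ := by
    rintro rfl
    exact hr0 (self_eq_neg.mp (by simpa using hσ))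
  have huniv : (Finset.univ : Finset (k ≃ₐ[ℚ] k)) = {1, σ} := by
    symm
    rw [← Finset.card_eq_iff_eq_univ, Finset.card_pair hσ1, ← Nat.card_eq_fintype_card, hcard]
  have h := trace_eq_sum_automorphisms (K := ℚ) ((a : k) + b * r)
  rw [huniv, Finset.sum_pair hσ1] at h
  have : ((Algebra.trace ℚ k ((a : k) + b * r) : ℚ) : k) = ((2 * a : ℚ) : k) := by
    rw [← eq_ratCast (algebraMap ℚ k), h]
    simp only [AlgEquiv.one_apply, map_add, map_mul, hσ, map_ratCast]
    push_cast
    ring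
  exact_mod_cast this

theorem discr_eq_of_integral_basis {ω : 𝓞 k} (hω : ∀ q : ℚ, (q : k) ≠ ω)
    (hspan : ∀ x : 𝓞 k, ∃ a b : ℤ, x = a + b * ω) (h2 : Module.finrank ℚ k = 2) :
    discr k = 2 * Algebra.trace ℤ (𝓞 k) (ω ^ 2) - Algebra.trace ℤ (𝓞 k) ω ^ 2 := by
  classical
  have hli : LinearIndependent ℤ ![(1 : 𝓞 k), ω] := by
    rw [LinearIndependent.pair_iff]
    intro a b h
    simp only [zsmul_eq_mul, mul_one] at h
    have h' : (a : k) + b * (ω : k) = 0 := by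
      have := congrArg (algebraMap (𝓞 k) k) h
      simpa using this
    have hb : b = 0 := by
      by_contra hb
      refine hω (-a / b) ?_
      have : (b : k) ≠ 0 := by exact_mod_cast hb
      push_cast
      rw [div_eq_iff this]
      linear_combination -h'
    refine ⟨?_, hb⟩
    rw [hb] at h'
    simpa using h'
  have htop : ⊤ ≤ Submodule.span ℤ (Set.range ![(1 : 𝓞 k), ω]) := by
    intro x _
    rw [Matrix.range_cons, Matrix.range_cons, Matrix.range_empty, Set.union_empty,
      Set.singleton_union, Submodule.mem_span_pair]
    obtain ⟨a, b, rfl⟩ := hspan x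
    exact ⟨a, b, by simp⟩
  have h1 : Algebra.trace ℤ (𝓞 k) 1 = 2 := by
    have : ((Algebra.trace ℤ (𝓞 k) 1 : ℤ) : ℚ) = 2 := by
      rw [Algebra.coe_trace_int]
      refine (congrArg _ ?_).trans ((Algebra.trace_algebraMap (S := k) (1 : ℚ)).trans (by simp [h2]))
      simp
    exact_mod_cast this
  rw [← discr_eq_discr k (Module.Basis.mk hli htop), Algebra.discr_def, Matrix.det_fin_two]
  simp only [Algebra.traceMatrix_apply, Algebra.traceForm_apply, Module.Basis.mk_apply,
    Matrix.cons_val_zero, Matrix.cons_val_one, mul_one, one_mul, h1]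
  ring_nf

theorem discr_eq_four_mul (hd : Squarefree d) (hr : r ^ 2 = d)
    (h2 : Module.finrank ℚ k = 2) (hmod : d % 4 = 2 ∨ d % 4 = 3) : discr k = 4 * d := by
  have hd1 : d ≠ 1 := by rintro rfl; omega
  have hr_int : IsIntegral ℤ r := IsIntegral.of_pow (n := 2) (by norm_num) (by
    rw [hr]; exact isIntegral_algebraMap (R := ℤ) (A := k) (x := d))
  obtain ⟨ω, hωr⟩ : ∃ ω : 𝓞 k, (ω : k) = r := ⟨⟨r, hr_int⟩, rfl⟩
  have hω := sqrt_notMem_range hd hd1 hr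
  rw [← hωr] at hω
  rw [discr_eq_of_integral_basis hω _ h2]
  · have e1 : ω ^ 2 = d := by
      apply RingOfIntegers.coe_injective
      rw [map_pow, map_intCast, ← RingOfIntegers.coe_eq_algebraMap, hωr, hr]
    have t1 := trace_coords hd hd1 hr h2 0 1
    have t2 := trace_coords hd hd1 hr h2 d 0
    have h1 : Algebra.trace ℤ (𝓞 k) ω = 0 := by
      have : ((Algebra.trace ℤ (𝓞 k) ω : ℤ) : ℚ) = 0 := by
        rw [Algebra.coe_trace_int]
        simpa [hωr] using t1
      exact_mod_cast this
    have h3 : Algebra.trace ℤ (𝓞 k) (d : 𝓞 k) = 2 * d := by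
      have : ((Algebra.trace ℤ (𝓞 k) (d : 𝓞 k) : ℤ) : ℚ) = ((2 * d : ℤ) : ℚ) := by
        rw [Algebra.coe_trace_int]
        simpa using t2
      exact_mod_cast this
    rw [e1, h1, h3]
    ring
  · intro x
    obtain ⟨t, y, hx, hn⟩ := exists_int_coords hd hd1 hr h2 x
    have h4 : (4 : ℤ) ∣ t ^ 2 - d * y ^ 2 := ⟨_, hn.symm⟩
    have hty : t % 2 = 0 ∧ y % 2 = 0 := by
      have h0 : (t ^ 2 - d * y ^ 2) % 4 = 0 := Int.emod_eq_zero_of_dvd h4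
      rw [Int.sub_emod, Int.mul_emod, pow_two, pow_two, Int.mul_emod t, Int.mul_emod y] at h0
      have a1 : t % 4 = 0 ∨ t % 4 = 1 ∨ t % 4 = 2 ∨ t % 4 = 3 := by omega
      have a2 : y % 4 = 0 ∨ y % 4 = 1 ∨ y % 4 = 2 ∨ y % 4 = 3 := by omega
      rcases a1 with a1 | a1 | a1 | a1 <;> rcases a2 with a2 | a2 | a2 | a2 <;>
        rcases hmod with hmod | hmod <;> rw [a1, a2, hmod] at h0 <;> omega
    obtain ⟨a, rfl⟩ := Int.dvd_of_emod_eq_zero hty.1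
    obtain ⟨b, rfl⟩ := Int.dvd_of_emod_eq_zero hty.2
    refine ⟨a, b, RingOfIntegers.coe_injective ?_⟩
    rw [map_add, map_mul, map_intCast, map_intCast,
      ← RingOfIntegers.coe_eq_algebraMap, ← RingOfIntegers.coe_eq_algebraMap, hωr]
    push_cast at hx
    linear_combination hx / 2

theorem discr_eq_self (hd : Squarefree d) (hd1 : d ≠ 1) (hr : r ^ 2 = d)
    (h2 : Module.finrank ℚ k = 2) (hmod : d % 4 = 1) : discr k = d := by
  obtain ⟨e, he⟩ : ∃ e, d = 4 * e + 1 := ⟨d / 4, by omega⟩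
  have heq : ((1 + r) / 2) ^ 2 = (1 + r) / 2 + e := by
    have : r ^ 2 = 4 * e + 1 := by rw [hr, he]; push_cast; ring
    linear_combination this / 4
  have hr_int : IsIntegral ℤ ((1 + r) / 2) := by
    refine ⟨Polynomial.X ^ 2 - Polynomial.X - Polynomial.C e, by monicity!, ?_⟩
    rw [Polynomial.eval₂_sub, Polynomial.eval₂_sub, Polynomial.eval₂_pow, Polynomial.eval₂_X,
      Polynomial.eval₂_C, heq]
    simp
  obtain ⟨ω, hωr⟩ : ∃ ω : 𝓞 k, (ω : k) = (1 + r) / 2 := ⟨⟨(1 + r) / 2, hr_int⟩, rfl⟩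
  have hω : ∀ q : ℚ, (q : k) ≠ ω := fun q h => by
    refine sqrt_notMem_range hd hd1 hr (2 * q - 1) ?_
    push_cast
    rw [h, hωr]
    ring
  rw [discr_eq_of_integral_basis hω _ h2]
  · have e1 : ω ^ 2 = ω + (e : 𝓞 k) := by
      apply RingOfIntegers.coe_injective
      rw [map_pow, map_add, map_intCast, ← RingOfIntegers.coe_eq_algebraMap, hωr, heq]
    have t1 := trace_coords hd hd1 hr h2 (1 / 2) (1 / 2)
    have t2 := trace_coords hd hd1 hr h2 e 0
    have h1 : Algebra.trace ℤ (𝓞 k) ω = 1 := by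
      have : ((Algebra.trace ℤ (𝓞 k) ω : ℤ) : ℚ) = 1 := by
        rw [Algebra.coe_trace_int]
        refine (congrArg _ ?_).trans (t1.trans (by norm_num))
        rw [hωr]
        push_cast
        ring
      exact_mod_cast this
    have h3 : Algebra.trace ℤ (𝓞 k) (e : 𝓞 k) = 2 * e := by
      have : ((Algebra.trace ℤ (𝓞 k) (e : 𝓞 k) : ℤ) : ℚ) = ((2 * e : ℤ) : ℚ) := by
        rw [Algebra.coe_trace_int]
        simpa using t2
      exact_mod_cast this
    rw [e1, map_add, h1, h3, he]
    ring
  · intro x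
    obtain ⟨t, y, hx, hn⟩ := exists_int_coords hd hd1 hr h2 x
    have h4 : (4 : ℤ) ∣ t ^ 2 - d * y ^ 2 := ⟨_, hn.symm⟩
    have hty : t % 2 = y % 2 := by
      have h0 : (t ^ 2 - d * y ^ 2) % 4 = 0 := Int.emod_eq_zero_of_dvd h4
      rw [Int.sub_emod, Int.mul_emod, pow_two, pow_two, Int.mul_emod t, Int.mul_emod y] at h0
      have a1 : t % 4 = 0 ∨ t % 4 = 1 ∨ t % 4 = 2 ∨ t % 4 = 3 := by omega
      have a2 : y % 4 = 0 ∨ y % 4 = 1 ∨ y % 4 = 2 ∨ y % 4 = 3 := by omega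
      rcases a1 with a1 | a1 | a1 | a1 <;> rcases a2 with a2 | a2 | a2 | a2 <;>
        rw [a1, a2, hmod] at h0 <;> omega
    obtain ⟨a, ha⟩ : ∃ a, t = 2 * a + y := ⟨(t - y) / 2, by omega⟩
    refine ⟨a, y, RingOfIntegers.coe_injective ?_⟩
    rw [map_add, map_mul, map_intCast, map_intCast,
      ← RingOfIntegers.coe_eq_algebraMap, ← RingOfIntegers.coe_eq_algebraMap, hωr]
    rw [ha] at hx
    push_cast at hx
    linear_combination hx / 2

end Quadratic

theorem exists_unit_of_pell {L : Type*} [Field L] [CharZero L] {d x y : ℤ} {r : L}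
    (hr : r ^ 2 = d) (h : x ^ 2 - d * y ^ 2 = 4 ∨ x ^ 2 - d * y ^ 2 = -4) :
    ∃ u : (𝓞 L)ˣ, 2 * (u : L) = x + y * r := by
  obtain ⟨s, hs, hxy⟩ : ∃ s : ℤ, s ^ 2 = 1 ∧ x ^ 2 - d * y ^ 2 = 4 * s := by
    rcases h with h | h
    · exact ⟨1, by norm_num, by rw [h]; norm_num⟩
    · exact ⟨-1, by norm_num, by rw [h]; norm_num⟩
  have hxy' : (x : L) ^ 2 - d * y ^ 2 = 4 * s := by exact_mod_cast hxy
  have key (z : ℤ) (hz : z ^ 2 = y ^ 2) : IsIntegral ℤ (((x : L) + z * r) / 2) := by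
    have hz' : (z : L) ^ 2 = y ^ 2 := by exact_mod_cast hz
    have heq : ((((x : L) + z * r) / 2)) ^ 2 = (((x : L) + z * r) / 2) * x - s := by
      linear_combination (1 / 4 : L) * z ^ 2 * hr - (1 / 4 : L) * hxy' + (1 / 4 : L) * d * hz'
    refine ⟨Polynomial.X ^ 2 - Polynomial.X * Polynomial.C x + Polynomial.C s, by monicity!, ?_⟩
    simp only [Polynomial.eval₂_sub, Polynomial.eval₂_add, Polynomial.eval₂_mul,
      Polynomial.eval₂_pow, Polynomial.eval₂_X, Polynomial.eval₂_C, heq]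
    simp
  have h1 := key y rfl
  have h2 := key (-y) (by ring)
  obtain ⟨a, ha⟩ : ∃ a : 𝓞 L, algebraMap (𝓞 L) L a = ((x : L) + y * r) / 2 := ⟨⟨_, h1⟩, rfl⟩
  obtain ⟨b, hb⟩ : ∃ b : 𝓞 L, algebraMap (𝓞 L) L b = ((x : L) + (-y : ℤ) * r) / 2 :=
    ⟨⟨_, h2⟩, rfl⟩
  have hab : a * (b * s) = 1 := by
    apply RingOfIntegers.coe_injective
    have hs' : (s : L) ^ 2 = 1 := by exact_mod_cast hs
    rw [map_mul, map_mul, map_intCast, map_one, ha, hb]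
    push_cast
    linear_combination (1 / 4 : L) * s * hxy' + hs' - (1 / 4 : L) * s * y ^ 2 * hr
  refine ⟨Units.mkOfMulEqOne a (b * s) hab, ?_⟩
  rw [Units.val_mkOfMulEqOne]
  refine (congrArg _ ha).trans ?_
  ring

section Quadratic

variable {k : Type*} [Field k] [NumberField k] {d : ℤ} {r : k}

theorem isTotallyReal_of_sqrt (hd : Squarefree d) (hd1 : d ≠ 1) (hr : r ^ 2 = d)
    (h2 : Module.finrank ℚ k = 2) (hpos : 0 < d) : IsTotallyReal k := by
  refine ⟨fun w => ?_⟩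
  rw [← InfinitePlace.mk_embedding w, InfinitePlace.isReal_mk_iff, ComplexEmbedding.isReal_iff]
  have hreal : starRingEnd ℂ (w.embedding r) = w.embedding r := by
    have h : (w.embedding r) ^ 2 = ((Real.sqrt d : ℝ) : ℂ) ^ 2 := by
      rw [← map_pow, hr, map_intCast, ← Complex.ofReal_pow,
        Real.sq_sqrt (by exact_mod_cast hpos.le), Complex.ofReal_intCast]
    rcases sq_eq_sq_iff_eq_or_eq_neg.mp h with h | h <;> simp [h]
  ext x
  obtain ⟨a, b, rfl⟩ := exists_coords hd hd1 hr h2 x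
  simp [hreal]

theorem isTotallyComplex_of_sqrt {L : Type*} [Field L] {r : L} {d : ℤ} (hr : r ^ 2 = d)
    (hneg : d < 0) : IsTotallyComplex L := by
  refine ⟨fun w => ?_⟩
  rw [← InfinitePlace.not_isReal_iff_isComplex]
  intro hw
  have h : (InfinitePlace.embedding_of_isReal hw r) ^ 2 = (d : ℝ) := by
    rw [← map_pow, hr, map_intCast]
  have : (d : ℝ) < 0 := by exact_mod_cast hneg
  nlinarith [sq_nonneg (InfinitePlace.embedding_of_isReal hw r)]

theorem regulator_eq_one_of_rank_eq_zero {L : Type*} [Field L] [NumberField L]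
    (h : Units.rank L = 0) : Units.regulator L = 1 := by
  classical
  rw [Units.regulator_eq_det']
  have : IsEmpty {w : InfinitePlace L // w ≠ Units.dirichletUnitTheorem.w₀} := by
    have := (Units.equivFinRank (K := L)).symm
    rw [h] at this
    exact this.isEmpty
  simp

theorem exists_real_embedding (hd : Squarefree d) (hd1 : d ≠ 1) (hr : r ^ 2 = d)
    (h2 : Module.finrank ℚ k = 2) (hpos : 0 < d) :
    ∃ φ : k →+* ℝ, φ r = Real.sqrt d := by
  have := isTotallyReal_of_sqrt hd hd1 hr h2 hpos
  obtain ⟨w⟩ : Nonempty (InfinitePlace k) := inferInstance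
  set φ := InfinitePlace.embedding_of_isReal (IsTotallyReal.isReal w)
  obtain ⟨σ, hσ, -⟩ := exists_conj hd hd1 hr h2
  have h : (φ r) ^ 2 = (Real.sqrt d) ^ 2 := by
    rw [← map_pow, hr, map_intCast, Real.sq_sqrt (by exact_mod_cast hpos.le)]
  rcases sq_eq_sq_iff_eq_or_eq_neg.mp h with h | h
  · exact ⟨φ, h⟩
  · exact ⟨φ.comp (σ : k →+* k), by simp [hσ, h]⟩

theorem nrRealPlaces_of_sqrt (hd : Squarefree d) (hd1 : d ≠ 1) (hr : r ^ 2 = d)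
    (h2 : Module.finrank ℚ k = 2) (hpos : 0 < d) :
    InfinitePlace.nrRealPlaces k = 2 ∧ InfinitePlace.nrComplexPlaces k = 0 := by
  have := isTotallyReal_of_sqrt hd hd1 hr h2 hpos
  exact ⟨by rw [← IsTotallyReal.finrank, h2], IsTotallyReal.nrComplexPlaces_eq_zero k⟩

theorem nrComplexPlaces_of_sqrt (hr : r ^ 2 = d)
    (h2 : Module.finrank ℚ k = 2) (hneg : d < 0) :
    InfinitePlace.nrRealPlaces k = 0 ∧ InfinitePlace.nrComplexPlaces k = 1 := by
  have := isTotallyComplex_of_sqrt hr hneg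
  have h := IsTotallyComplex.finrank k
  exact ⟨IsTotallyComplex.nrRealPlaces_eq_zero k, by omega⟩

theorem exists_generator_regulator (φ : k →+* ℝ) [IsTotallyReal k]
    (h2 : Module.finrank ℚ k = 2) :
    ∃ η : (𝓞 k)ˣ, Units.regulator k = |Real.log (|φ (η : k)|)| ∧
      ∀ u : (𝓞 k)ˣ, ∃ n : ℤ, Real.log |φ (u : k)| =
        n * Real.log |φ (η : k)| := by
  classical
  have hcard : Fintype.card (InfinitePlace k) = 2 := by
    rw [InfinitePlace.card_eq_nrRealPlaces_add_nrComplexPlaces,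
      IsTotallyReal.nrComplexPlaces_eq_zero, ← IsTotallyReal.finrank, h2]
  have hrank : Units.rank k = 1 := by rw [Units.rank, hcard]
  set w₀ : InfinitePlace k := InfinitePlace.mk (Complex.ofRealHom.comp φ) with hw₀
  have happ (x : k) : w₀ x = |φ x| := by
    rw [hw₀, InfinitePlace.apply]
    simp
  obtain ⟨w', hw'⟩ : ∃ w', w₀ ≠ w' := by
    have : Nontrivial (InfinitePlace k) := by
      rw [← Fintype.one_lt_card_iff_nontrivial, hcard]; norm_num
    obtain ⟨w', hw'⟩ := exists_ne w₀
    exact ⟨w', hw'.symm⟩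
  have hcard' : Fintype.card {w // w ≠ w'} = 1 := by
    rw [Fintype.card_subtype_compl, hcard, Fintype.card_unique]
  obtain ⟨e⟩ : Nonempty ({w // w ≠ w'} ≃ Fin (Units.rank k)) :=
    ⟨Fintype.equivOfCardEq (by rw [hcard', Fintype.card_fin, hrank])⟩
  have hsub : Subsingleton {w // w ≠ w'} := by
    rw [← Fintype.card_le_one_iff_subsingleton, hcard']
  refine ⟨Units.fundSystem k (e ⟨w₀, hw'⟩), ?_, fun u => ?_⟩
  · rw [Units.regulator_eq_det k w' e, Matrix.det_eq_elem_of_subsingleton _ ⟨w₀, hw'⟩,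
      Matrix.of_apply, happ, IsTotallyReal.mult_eq]
    simp
  · obtain ⟨⟨ζ, f⟩, hu, -⟩ := Units.exist_unique_eq_mul_prod k u
    refine ⟨f (e ⟨w₀, hw'⟩), ?_⟩
    have huniv : (Finset.univ : Finset (Fin (Units.rank k))) = {e ⟨w₀, hw'⟩} := by
      ext i
      obtain ⟨j, rfl⟩ := e.surjective i
      simp [Subsingleton.elim j ⟨w₀, hw'⟩]
    have hζ := (Units.mem_torsion k).mp ζ.2 w₀
    rw [← happ, ← happ, hu, huniv, Finset.prod_singleton]
    rw [Units.coe_mul, map_mul, hζ, one_mul, Units.coe_zpow, map_zpow₀, Real.log_zpow]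

theorem exists_pell_of_unit {d : ℤ} (hd : Squarefree d) (hd1 : d ≠ 1) (hr : r ^ 2 = d)
    (h2 : Module.finrank ℚ k = 2) (u : (𝓞 k)ˣ) :
    ∃ x y : ℤ, 2 * (u : k) = x + y * r ∧
      (x ^ 2 - d * y ^ 2 = 4 ∨ x ^ 2 - d * y ^ 2 = -4) := by
  obtain ⟨x, y, hxy, hn⟩ := exists_int_coords hd hd1 hr h2 (u : 𝓞 k)
  refine ⟨x, y, hxy, ?_⟩
  have hu : IsUnit (Algebra.norm ℤ (u : 𝓞 k)) := u.isUnit.map _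
  rcases Int.isUnit_iff.mp hu with h | h <;> rw [h] at hn
  · exact Or.inl (by linarith)
  · exact Or.inr (by linarith)

theorem regulator_of_isFundUnit {D : ℕ} (hd : Squarefree (D : ℤ)) (hD : 1 < D)
    (hr : r ^ 2 = (D : ℤ)) (h2 : Module.finrank ℚ k = 2) {ε : ℝ} (hε : IsFundUnit D ε) :
    Units.regulator k = Real.log ε := by
  have hd1 : (D : ℤ) ≠ 1 := by omega
  have hpos : 0 < (D : ℤ) := by omega
  have := isTotallyReal_of_sqrt hd hd1 hr h2 hpos
  obtain ⟨φ, hφ⟩ := exists_real_embedding hd hd1 hr h2 hpos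
  rw [Int.cast_natCast] at hφ
  obtain ⟨η, hreg, hη⟩ := exists_generator_regulator φ h2
  obtain ⟨h1, ⟨x, y, hxy, hpell⟩, hmin⟩ := hε
  obtain ⟨e, he⟩ := exists_unit_of_pell hr hpell
  have hφe : φ (e : k) = ε := by
    have := congrArg φ he
    simp only [map_mul, map_add, map_ofNat, map_intCast, hφ] at this
    rw [hxy, ← this]
    ring
  obtain ⟨n, hn⟩ := hη e
  rw [hφe, abs_of_pos (by linarith)] at hn
  have hlog : 0 < Real.log ε := Real.log_pos h1
  have hle (v : (𝓞 k)ˣ) (hv : 1 < φ (v : k)) : ε ≤ φ (v : k) := by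
    obtain ⟨a, b, hab, hp⟩ := exists_pell_of_unit hd hd1 hr h2 v
    have := congrArg φ hab
    simp only [map_mul, map_add, map_ofNat, map_intCast, hφ] at this
    have hv' : φ (v : k) = ((a : ℝ) + b * Real.sqrt D) / 2 := by rw [← this]; ring
    rw [hv'] at hv ⊢
    exact hmin a b hp hv
  have hge : Real.log ε ≤ |Real.log (|φ (η : k)|)| := by
    set t := φ (η : k) with ht
    have ht0 : t ≠ 0 := by
      rw [ht, map_ne_zero]
      exact Units.coe_ne_zero η
    have hne : Real.log |t| ≠ 0 := by
      intro h0
      rw [h0, mul_zero] at hn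
      exact hlog.ne' hn
    have aux (v : (𝓞 k)ˣ) (hv : 1 < |φ (v : k)|) : ε ≤ |φ (v : k)| := by
      rcases abs_choice (φ (v : k)) with h | h
      · rw [h] at hv ⊢
        exact hle v hv
      · have hneg : φ ((-v : (𝓞 k)ˣ) : k) = -φ (v : k) := by
          rw [Units.val_neg, map_neg, map_neg]
        rw [h, ← hneg] at hv ⊢
        exact hle _ hv
    rcases lt_or_gt_of_ne hne with hlt | hgt
    · have hinv : φ ((η⁻¹ : (𝓞 k)ˣ) : k) = t⁻¹ := by
        rw [← zpow_neg_one, Units.coe_zpow, map_zpow₀, zpow_neg_one]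
      rw [abs_of_neg hlt, ← Real.log_inv, ← abs_inv]
      refine Real.log_le_log (by linarith) ?_
      have := aux η⁻¹
      rw [hinv] at this
      refine this ?_
      rw [abs_inv]
      refine (one_lt_inv₀ (by positivity)).mpr ?_
      by_contra! h
      exact absurd (Real.log_nonneg h) (not_le.mpr hlt)
    · rw [abs_of_pos hgt]
      refine Real.log_le_log (by linarith) (aux η ?_)
      by_contra! h
      exact absurd (Real.log_nonpos (abs_nonneg _) h) (not_le.mpr hgt)
  have hle' : |Real.log (|φ (η : k)|)| ≤ Real.log ε := by
    have hn0 : n ≠ 0 := by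
      rintro rfl
      simp only [Int.cast_zero, zero_mul] at hn
      exact hlog.ne' hn
    have hn1 : (1 : ℝ) ≤ |(n : ℝ)| := by exact_mod_cast Int.one_le_abs hn0
    rw [← abs_of_pos hlog, hn, abs_mul]
    exact le_mul_of_one_le_left (abs_nonneg _) hn1
  rw [hreg]
  exact le_antisymm hle' hge

theorem residue_mul {L : Type*} [Field L] [NumberField L] :
    dedekindZeta_residue L * (Units.torsionOrder L * Real.sqrt |discr L|) =
      2 ^ InfinitePlace.nrRealPlaces L * (2 * Real.pi) ^ InfinitePlace.nrComplexPlaces L *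
        Units.regulator L * classNumber L := by
  rw [dedekindZeta_residue_def]
  refine div_mul_cancel₀ _ (mul_ne_zero ?_ ?_)
  · exact_mod_cast Units.torsionOrder_ne_zero L
  · rw [Real.sqrt_ne_zero']
    exact_mod_cast abs_pos.mpr (discr_ne_zero L)

theorem residue_real_quadratic {D : ℕ} (hd : Squarefree (D : ℤ)) (hD : 1 < D)
    (hr : r ^ 2 = (D : ℤ)) (h2 : Module.finrank ℚ k = 2) {ε : ℝ} (hε : IsFundUnit D ε) :
    dedekindZeta_residue k * (Units.torsionOrder k * Real.sqrt |discr k|) =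
      4 * Real.log ε * classNumber k := by
  obtain ⟨h1, h3⟩ := nrRealPlaces_of_sqrt hd (by omega) hr h2 (by omega)
  rw [residue_mul, h1, h3, regulator_of_isFundUnit hd hD hr h2 hε]
  norm_num

theorem residue_imaginary_quadratic (hr : r ^ 2 = d)
    (h2 : Module.finrank ℚ k = 2) (hneg : d < 0) :
    dedekindZeta_residue k * (Units.torsionOrder k * Real.sqrt |discr k|) =
      2 * Real.pi * classNumber k := by
  obtain ⟨h1, h3⟩ := nrComplexPlaces_of_sqrt hr h2 hneg
  have hrank : Units.rank k = 0 := by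
    rw [Units.rank, InfinitePlace.card_eq_nrRealPlaces_add_nrComplexPlaces, h1, h3]
  rw [residue_mul, h1, h3, regulator_eq_one_of_rank_eq_zero hrank]
  ring

end Quadratic

theorem factorization_two_card_eq_two {G : Type*} [CommGroup G] [Finite G] {a b : G}
    (ha : a ^ 2 = 1) (hb : b ^ 2 = 1) (hall : ∀ g : G, g ^ 2 = 1 → g = 1 ∨ g = a ∨ g = b ∨ g = a * b)
    (hna : ¬ IsSquare a) (hnb : ¬ IsSquare b) (hnab : ¬ IsSquare (a * b)) :
    (Nat.card G).factorization 2 = 2 := by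
  have hsq (g : G) (hg : (g ^ 2) ^ 2 = 1) : g ^ 2 = 1 := by
    rcases hall _ hg with h | h | h | h
    · exact h
    · exact absurd ⟨g, by rw [← h, sq]⟩ hna
    · exact absurd ⟨g, by rw [← h, sq]⟩ hnb
    · exact absurd ⟨g, by rw [← h, sq]⟩ hnab
  have hpow (n : ℕ) : ∀ g : G, g ^ 2 ^ n = 1 → g ^ 2 = 1 := by
    induction n with
    | zero => intro g hg; simp_all
    | succ n ih =>
      intro g hg
      exact hsq g (ih _ (by rw [← pow_mul, ← pow_succ', hg]))
  set H : Subgroup G := (powMonoidHom 2 : G →* G).ker with hH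
  have hmem (g : G) : g ∈ H ↔ g ^ 2 = 1 := by rw [hH, MonoidHom.mem_ker, powMonoidHom_apply]
  have hHp : IsPGroup 2 H := fun g => ⟨1, Subtype.ext (by simpa using (hmem g).mp g.2)⟩
  obtain ⟨P, hP⟩ := hHp.exists_le_sylow
  have hPH : (P : Subgroup G) = H := by
    refine le_antisymm (fun g hg => ?_) hP
    obtain ⟨n, hn⟩ := P.2 ⟨g, hg⟩
    exact (hmem g).mpr (hpow n g (by simpa using congrArg Subtype.val hn))
  have hcardP : Nat.card P = 2 ^ (Nat.card G).factorization 2 := P.card_eq_multiplicity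
  have h1a : (1 : G) ≠ a := fun h => hna (h ▸ IsSquare.one)
  have h1b : (1 : G) ≠ b := fun h => hnb (h ▸ IsSquare.one)
  have h1ab : (1 : G) ≠ a * b := fun h => hnab (h ▸ IsSquare.one)
  have hab : a ≠ b := by
    rintro rfl
    exact h1ab (by rw [← sq, ha])
  have haab : a ≠ a * b := fun h => h1b (left_eq_mul.mp h).symm
  have hbab : b ≠ a * b := fun h => h1a (right_eq_mul.mp h).symm
  have hset : (H : Set G) = {1, a, b, a * b} := by
    ext g
    simp only [SetLike.mem_coe, hmem, Set.mem_insert_iff, Set.mem_singleton_iff]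
    refine ⟨hall g, ?_⟩
    rintro (rfl | rfl | rfl | rfl)
    · simp
    · exact ha
    · exact hb
    · rw [mul_pow, ha, hb, one_mul]
  have hcardH : Nat.card H = 4 := by
    have : Nat.card H = (H : Set G).ncard := rfl
    rw [this, hset, Set.ncard_insert_of_notMem (by simp [h1a, h1b, h1ab]),
      Set.ncard_insert_of_notMem (by simp [hab, haab]), Set.ncard_pair hbab]
  have : 2 ^ (Nat.card G).factorization 2 = 2 ^ 2 := by
    rw [← hcardP]
    rw [hPH, hcardH]
    norm_num
  exact Nat.pow_right_injective le_rfl this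

theorem eq_zero_of_ternary {q : ℕ} [Fact q.Prime] {A B C : ℤ} (hAC : legendreSym q (A * C) = -1)
    (hB : ¬ (q : ℤ) ∣ B) {x y z : ℤ} (h : A * x ^ 2 + q * B * y ^ 2 = C * z ^ 2) :
    z = 0 := by
  have hq : Prime (q : ℤ) := Nat.prime_iff_prime_int.mp Fact.out
  have key : ∀ N : ℕ, ∀ x y z : ℤ, x.natAbs + y.natAbs + z.natAbs ≤ N →
      A * x ^ 2 + q * B * y ^ 2 = C * z ^ 2 → z = 0 := by
    intro N
    induction N with
    | zero => intro x y z hN _; omega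
    | succ N ih =>
      intro x y z hN h
      have hdvd : (q : ℤ) ∣ (C * z) ^ 2 - (A * C) * x ^ 2 := ⟨C * B * y ^ 2, by
        linear_combination -C * h⟩
      obtain ⟨h1, x', rfl⟩ := legendreSym.prime_dvd_of_eq_neg_one hAC hdvd
      have hC : ¬ (q : ℤ) ∣ C := by
        rintro ⟨c, rfl⟩
        rw [show A * (q * c) = q * (A * c) by ring, legendreSym.mul] at hAC
        have h0 : legendreSym q (q : ℤ) = 0 := (legendreSym.eq_zero_iff q q).mpr (by simp)
        rw [h0, zero_mul] at hAC
        norm_num at hAC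
      obtain ⟨z', rfl⟩ := (hq.dvd_or_dvd h1).resolve_left hC
      have hq0 : (q : ℤ) ≠ 0 := hq.ne_zero
      have hy : (q : ℤ) ∣ B * y ^ 2 := by
        refine ⟨C * z' ^ 2 - A * x' ^ 2, mul_left_cancel₀ hq0 ?_⟩
        linear_combination h
      obtain ⟨y', rfl⟩ := hq.dvd_of_dvd_pow ((hq.dvd_or_dvd hy).resolve_left hB)
      by_contra hz
      have hz' : z' ≠ 0 := by rintro rfl; simp at hz
      refine hz' (ih x' y' z' ?_ ?_)
      · rw [Int.natAbs_mul, Int.natAbs_mul, Int.natAbs_mul, Int.natAbs_natCast] at hN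
        have h2 : 2 ≤ q := (Fact.out : q.Prime).two_le
        have h3 : 0 < z'.natAbs := Int.natAbs_pos.mpr hz'
        nlinarith [Nat.zero_le x'.natAbs, Nat.zero_le y'.natAbs]
      · refine mul_left_cancel₀ (pow_ne_zero 2 hq0) ?_
        linear_combination h
  exact key _ x y z le_rfl h

section Obstruction

variable {p₁ p₂ : ℕ} [Fact p₁.Prime] [Fact p₂.Prime]

theorem legendreSym_two_of_mod_eight_eq_five {p : ℕ} [Fact p.Prime] (hp : p % 8 = 5) :
    legendreSym p 2 = -1 := by
  rw [legendreSym.at_two (by rintro rfl; norm_num at hp), ZMod.χ₈_nat_mod_eight, hp]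
  rfl

theorem legendreSym_sign_of_mod_eight_eq_five {p : ℕ} [Fact p.Prime] (hp : p % 8 = 5) {e : ℤ}
    (he : e = 1 ∨ e = -1) : legendreSym p e = 1 := by
  rcases he with rfl | rfl
  · exact legendreSym.at_one p
  · rw [legendreSym.at_neg_one (by rintro rfl; norm_num at hp), ZMod.χ₄_nat_one_mod_four (by omega)]

theorem legendreSym_eq_or (hne : p₁ ≠ p₂) (hm₁ : p₁ % 8 = 5) (hm₂ : p₂ % 8 = 5) :
    (legendreSym p₁ p₂ = 1 ∧ legendreSym p₂ p₁ = 1) ∨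
      (legendreSym p₁ p₂ = -1 ∧ legendreSym p₂ p₁ = -1) := by
  have hrec : legendreSym p₂ p₁ = legendreSym p₁ p₂ :=
    legendreSym.quadratic_reciprocity_one_mod_four (by omega) (by rintro rfl; norm_num at hm₂)
  rw [hrec]
  have h0 : ((p₂ : ℤ) : ZMod p₁) ≠ 0 := by
    rw [Int.cast_natCast, Ne, ZMod.natCast_eq_zero_iff]
    exact fun h => hne ((Nat.prime_dvd_prime_iff_eq Fact.out Fact.out).mp h)
  rcases legendreSym.eq_one_or_neg_one p₁ h0 with h | h <;> simp [h]

theorem not_dvd_two_mul_of_mod_eight {p q : ℕ} [hp : Fact p.Prime] [hq : Fact q.Prime] (hne : p ≠ q)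
    (hm : p % 8 = 5) {e : ℤ} (he : e = 1 ∨ e = -1) : ¬ (p : ℤ) ∣ e * (2 * q) := by
  intro h
  have h' : (p : ℤ) ∣ ((2 * q : ℕ) : ℤ) := by
    push_cast
    rcases he with rfl | rfl
    · simpa using h
    · rw [neg_one_mul] at h
      exact (dvd_neg).mp h
  rw [Int.natCast_dvd_natCast, hp.out.dvd_mul] at h'
  rcases h' with h' | h'
  · rw [Nat.prime_dvd_prime_iff_eq hp.out Nat.prime_two] at h'
    omega
  · exact hne ((Nat.prime_dvd_prime_iff_eq hp.out hq.out).mp h')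

theorem eq_zero_of_two_mul_sq (hne : p₁ ≠ p₂) (hm₁ : p₁ % 8 = 5) {e δ : ℤ} (he : e = 1 ∨ e = -1)
    (hδ : δ = 1 ∨ δ = -1) {x y n : ℤ}
    (h : 2 * n ^ 2 = e * (x ^ 2 - δ * (2 * p₁ * p₂) * y ^ 2)) : n = 0 := by
  refine eq_zero_of_ternary (q := p₁) (A := e) (B := -e * δ * (2 * p₂)) (C := 2) (x := x) (y := y)
    ?_ (not_dvd_two_mul_of_mod_eight hne hm₁ ?_) (by linear_combination -h)
  · rw [legendreSym.mul, legendreSym_sign_of_mod_eight_eq_five hm₁ he,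
      legendreSym_two_of_mod_eight_eq_five hm₁]
    rfl
  · rcases he with rfl | rfl <;> rcases hδ with rfl | rfl <;> norm_num

theorem eq_zero_of_prime_mul_sq (hne : p₁ ≠ p₂) (hm₁ : p₁ % 8 = 5) (hm₂ : p₂ % 8 = 5) {e δ : ℤ}
    (he : e = 1 ∨ e = -1) (hδ : δ = 1 ∨ δ = -1) {x y n : ℤ}
    (h : p₁ * n ^ 2 = e * (x ^ 2 - δ * (2 * p₁ * p₂) * y ^ 2)) : n = 0 := by
  have hp : Prime (p₁ : ℤ) := Nat.prime_iff_prime_int.mp Fact.out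
  have hf : -e * δ = 1 ∨ -e * δ = -1 := by
    rcases he with rfl | rfl <;> rcases hδ with rfl | rfl <;> norm_num
  have he2 : e ^ 2 = 1 := by rcases he with rfl | rfl <;> norm_num
  obtain ⟨x, rfl⟩ : (p₁ : ℤ) ∣ x := hp.dvd_of_dvd_pow (n := 2)
    ⟨e * n ^ 2 + δ * (2 * p₂) * y ^ 2, by linear_combination -x ^ 2 * he2 - e * h
      + δ * 2 * p₁ * p₂ * y ^ 2 * he2⟩
  have h' : n ^ 2 = e * p₁ * x ^ 2 + -e * δ * (2 * p₂) * y ^ 2 :=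
    mul_left_cancel₀ hp.ne_zero (by linear_combination h)
  rcases legendreSym_eq_or hne hm₁ hm₂ with ⟨h1, -⟩ | ⟨-, h2⟩
  · refine eq_zero_of_ternary (q := p₁) (A := -e * δ * (2 * p₂)) (B := e) (C := 1) (x := y) (y := x)
      ?_ (fun hdvd => ?_) (by linear_combination -h')
    · rw [mul_one, legendreSym.mul, legendreSym.mul p₁ 2, h1,
        legendreSym_sign_of_mod_eight_eq_five hm₁ hf, legendreSym_two_of_mod_eight_eq_five hm₁]
      rfl
    · exact hp.not_isUnit (isUnit_of_dvd_unit hdvd (Int.isUnit_iff.mpr he))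
  · refine eq_zero_of_ternary (q := p₂) (A := e * p₁) (B := -e * δ * 2) (C := 1) (x := x) (y := y)
      ?_ (fun hdvd => ?_) (by linear_combination -h')
    · rw [mul_one, legendreSym.mul, h2, legendreSym_sign_of_mod_eight_eq_five hm₂ he]
      rfl
    · refine not_dvd_two_mul_of_mod_eight hne.symm hm₂ hf (hdvd.trans ⟨p₁, by ring⟩)

theorem eq_zero_of_two_mul_prime_mul_sq (hne : p₁ ≠ p₂) (hm₁ : p₁ % 8 = 5) (hm₂ : p₂ % 8 = 5)
    {e δ : ℤ} (he : e = 1 ∨ e = -1) (hδ : δ = 1 ∨ δ = -1) {x y n : ℤ}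
    (h : 2 * p₁ * n ^ 2 = e * (x ^ 2 - δ * (2 * p₁ * p₂) * y ^ 2)) : n = 0 := by
  have hp : Prime (p₁ : ℤ) := Nat.prime_iff_prime_int.mp Fact.out
  have hf : -e * δ = 1 ∨ -e * δ = -1 := by
    rcases he with rfl | rfl <;> rcases hδ with rfl | rfl <;> norm_num
  have he2 : e ^ 2 = 1 := by rcases he with rfl | rfl <;> norm_num
  obtain ⟨x, rfl⟩ : (p₁ : ℤ) ∣ x := hp.dvd_of_dvd_pow (n := 2)
    ⟨2 * e * n ^ 2 + δ * (2 * p₂) * y ^ 2, by linear_combination -x ^ 2 * he2 - e * h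
      + δ * 2 * p₁ * p₂ * y ^ 2 * he2⟩
  have h1 : 2 * n ^ 2 = e * p₁ * x ^ 2 + 2 * (-e * δ * p₂ * y ^ 2) :=
    mul_left_cancel₀ hp.ne_zero (by linear_combination h)
  obtain ⟨x, rfl⟩ : (2 : ℤ) ∣ x := by
    have h2 : (2 : ℤ) ∣ e * p₁ * x ^ 2 := ⟨n ^ 2 - -e * δ * p₂ * y ^ 2, by linear_combination -h1⟩
    have h3 : ¬ (2 : ℤ) ∣ e * p₁ := by
      rcases he with rfl | rfl <;> omega
    exact Int.prime_two.dvd_of_dvd_pow ((Int.prime_two.dvd_or_dvd h2).resolve_left h3)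
  have h' : n ^ 2 = e * 2 * p₁ * x ^ 2 + -e * δ * p₂ * y ^ 2 :=
    mul_left_cancel₀ two_ne_zero (by linear_combination h1)
  rcases legendreSym_eq_or hne hm₁ hm₂ with ⟨-, h2⟩ | ⟨h2, -⟩
  · refine eq_zero_of_ternary (q := p₂) (A := e * 2 * p₁) (B := -e * δ) (C := 1) (x := x) (y := y)
      ?_ (fun hdvd => ?_) (by linear_combination -h')
    · rw [mul_one, legendreSym.mul, legendreSym.mul, h2,
        legendreSym_sign_of_mod_eight_eq_five hm₂ he, legendreSym_two_of_mod_eight_eq_five hm₂]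
      rfl
    · refine (Nat.prime_iff_prime_int.mp (Fact.out : p₂.Prime)).not_isUnit
        (isUnit_of_dvd_unit hdvd (Int.isUnit_iff.mpr hf))
  · refine eq_zero_of_ternary (q := p₁) (A := -e * δ * p₂) (B := e * 2) (C := 1) (x := y) (y := x)
      ?_ (fun hdvd => ?_) (by linear_combination -h')
    · rw [mul_one, legendreSym.mul, h2, legendreSym_sign_of_mod_eight_eq_five hm₁ hf]
      rfl
    · refine not_dvd_two_mul_of_mod_eight hne hm₁ he (hdvd.trans ⟨p₂, by ring⟩)

end Obstruction

theorem Ideal.eq_of_sq_eq_sq {A : Type*} [CommRing A] [IsDedekindDomain A] {I J : Ideal A}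
    (h : I ^ 2 = J ^ 2) : I = J :=
  dvd_antisymm ((UniqueFactorizationMonoid.pow_dvd_pow_iff_dvd two_ne_zero).mp h.dvd)
    ((UniqueFactorizationMonoid.pow_dvd_pow_iff_dvd two_ne_zero).mp h.symm.dvd)

theorem Ideal.span_pair_sq_of_isCoprime {A : Type*} [CommRing A] {s e r : A} (hr : r ^ 2 = s * e)
    (h : IsCoprime s e) : Ideal.span {s, r} ^ 2 = Ideal.span {s} := by
  obtain ⟨u, v, huv⟩ := h
  rw [sq, Ideal.span_pair_mul_span_pair]
  refine le_antisymm (Ideal.span_le.mpr ?_) ((Ideal.span_singleton_le_iff_mem _).mpr ?_)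
  · rintro x (rfl | rfl | rfl | rfl) <;> rw [SetLike.mem_coe, Ideal.mem_span_singleton]
    · exact ⟨s, rfl⟩
    · exact ⟨r, rfl⟩
    · exact ⟨r, mul_comm _ _⟩
    · exact ⟨e, by rw [← hr, sq]⟩
  · have h1 : s * s ∈ Ideal.span {s * s, s * r, r * s, r * r} :=
      Ideal.subset_span (by simp)
    have h2 : r * r ∈ Ideal.span {s * s, s * r, r * s, r * r} :=
      Ideal.subset_span (by simp)
    have h3 := Ideal.add_mem _ (Ideal.mul_mem_left _ u h1) (Ideal.mul_mem_left _ v h2)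
    rwa [show u * (s * s) + v * (r * r) = s by linear_combination s * huv + v * hr] at h3

section Quadratic

variable {k : Type*} [Field k] [NumberField k] {d : ℤ} {r : 𝓞 k}

theorem exists_integral_conj (hd : Squarefree d) (hd1 : d ≠ 1) (hr : r ^ 2 = d)
    (h2 : Module.finrank ℚ k = 2) :
    ∃ σ : 𝓞 k ≃+* 𝓞 k, ∀ x, ((Algebra.norm ℤ x : ℤ) : 𝓞 k) = x * σ x := by
  have hr' : (r : k) ^ 2 = d := by
    rw [RingOfIntegers.coe_eq_algebraMap, ← map_pow, hr, map_intCast]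
  obtain ⟨σ, -, hn⟩ := exists_conj hd hd1 hr' h2
  refine ⟨RingOfIntegers.mapRingEquiv σ.toRingEquiv, fun x => ?_⟩
  apply RingOfIntegers.coe_injective
  rw [map_mul, map_intCast]
  have h := hn (x : k)
  rw [RingOfIntegers.coe_eq_algebraMap, ← Algebra.coe_norm_int] at h
  simpa using h

theorem exists_int_two_mul_eq (hd : Squarefree d) (hd1 : d ≠ 1) (hr : r ^ 2 = d)
    (h2 : Module.finrank ℚ k = 2) (x : 𝓞 k) :
    ∃ t y : ℤ, 2 * x = t + y * r ∧ 4 * Algebra.norm ℤ x = t ^ 2 - d * y ^ 2 := by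
  have hr' : (r : k) ^ 2 = d := by
    rw [RingOfIntegers.coe_eq_algebraMap, ← map_pow, hr, map_intCast]
  obtain ⟨t, y, h, hn⟩ := exists_int_coords hd hd1 hr' h2 x
  refine ⟨t, y, ?_, hn⟩
  apply RingOfIntegers.coe_injective
  simp only [map_add, map_mul, map_intCast, map_ofNat]
  exact h

theorem int_coords_unique (hd : Squarefree d) (hd1 : d ≠ 1) (hr : r ^ 2 = d) {a b a' b' : ℤ}
    (h : (a : 𝓞 k) + b * r = a' + b' * r) : a = a' ∧ b = b' := by
  have hr' : (r : k) ^ 2 = d := by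
    rw [RingOfIntegers.coe_eq_algebraMap, ← map_pow, hr, map_intCast]
  have hz : ((a - a' : ℤ) : ℚ) • (1 : k) + ((b - b' : ℤ) : ℚ) • (r : k) = 0 := by
    have h' := congrArg (algebraMap (𝓞 k) k) h
    simp only [map_add, map_mul, map_intCast] at h'
    simp only [Algebra.smul_def, eq_ratCast]
    push_cast
    rw [RingOfIntegers.coe_eq_algebraMap]
    linear_combination h'
  have hli := linearIndependent_one_sqrt hd hd1 hr'
  rw [LinearIndependent.pair_iff] at hli
  replace hli := hli _ _ hz
  simp only [Int.cast_eq_zero] at hli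
  omega

theorem exists_ideal_sq_eq_span_int (hd : Squarefree d) (hd1 : d ≠ 1) (hr : r ^ 2 = d)
    (h2 : Module.finrank ℚ k = 2)
    (hu : (∃ u : (𝓞 k)ˣ, Algebra.norm ℤ (u : 𝓞 k) = -1) ∨ ∀ x : 𝓞 k, 0 ≤ Algebra.norm ℤ x)
    {g : ClassGroup (𝓞 k)} (hg : g ^ 2 = 1) :
    ∃ (J : nonZeroDivisors (Ideal (𝓞 k))) (T : ℤ), ClassGroup.mk0 J = g ∧
      (J : Ideal (𝓞 k)) ^ 2 = Ideal.span {(T : 𝓞 k)} := by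
  obtain ⟨I, rfl⟩ := ClassGroup.mk0_surjective g
  obtain ⟨σ, hσ⟩ := exists_integral_conj hd hd1 hr h2
  have hI0 : (I : Ideal (𝓞 k)) ≠ ⊥ := nonZeroDivisors.coe_ne_zero I
  obtain ⟨α, hα⟩ : ∃ α, (I : Ideal (𝓞 k)) ^ 2 = Ideal.span {α} := by
    rw [← map_pow, ClassGroup.mk0_eq_one_iff] at hg
    obtain ⟨α, hα⟩ := hg.principal
    exact ⟨α, hα⟩
  set n := Ideal.absNorm (I : Ideal (𝓞 k)) with hn
  have hn0 : n ≠ 0 := fun h => hI0 (Ideal.absNorm_eq_zero_iff.mp h)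
  have hnorm : (Algebra.norm ℤ α).natAbs = n ^ 2 := by
    rw [← Ideal.absNorm_span_singleton, ← hα, map_pow]
  obtain ⟨α, hα, hαn⟩ : ∃ α, (I : Ideal (𝓞 k)) ^ 2 = Ideal.span {α} ∧
      Algebra.norm ℤ α = (n : ℤ) ^ 2 := by
    by_cases h : 0 ≤ Algebra.norm ℤ α
    · exact ⟨α, hα, by rw [← Int.natAbs_of_nonneg h, hnorm]; push_cast; rfl⟩
    · obtain ⟨u, hu⟩ := hu.resolve_right fun h' => h (h' α)
      refine ⟨α * u, ?_, ?_⟩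
      · rw [hα, Ideal.span_singleton_eq_span_singleton]
        exact ⟨u, rfl⟩
      · rw [map_mul, hu]
        have : ((Algebra.norm ℤ α).natAbs : ℤ) = n ^ 2 := by exact_mod_cast hnorm
        omega
  have hασ : α * σ α = (n : 𝓞 k) ^ 2 := by
    rw [← hσ, hαn]
    push_cast
    rfl
  by_cases hβ : (n : 𝓞 k) + σ α = 0
  · refine ⟨I, -n, rfl, ?_⟩
    have h1 : σ α = -n := by linear_combination hβ
    have h2 : α = -n := by
      have := congrArg σ.symm h1
      simpa using this
    rw [hα, h2]
    push_cast
    rfl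
  · set β := (n : 𝓞 k) + σ α with hβ'
    have hspan : Ideal.span {β} ≠ ⊥ := by simpa using hβ
    have hσα : σ α ≠ 0 := by
      intro h
      rw [h, mul_zero] at hασ
      exact hn0 (by simpa using hασ.symm)
    have hσσ : σ (σ α) = α := by
      have h := congrArg σ hασ
      rw [map_mul, map_pow, map_natCast, ← hασ, mul_comm] at h
      exact mul_right_cancel₀ hσα h
    have hββ : β * σ β = (Algebra.norm ℤ β : ℤ) := (hσ β).symm
    rw [hβ', map_add, map_natCast, hσσ, ← hβ'] at hββ
    refine ⟨⟨Ideal.span {β} * I, mem_nonZeroDivisors_of_ne_zero (mul_ne_zero hspan hI0)⟩,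
      n * Algebra.norm ℤ β, ?_, ?_⟩
    · refine ClassGroup.mk0_eq_mk0_iff.mpr ⟨1, β, one_ne_zero, hβ, ?_⟩
      simp
    · rw [mul_pow, hα, Ideal.span_singleton_pow, Ideal.span_singleton_mul_span_singleton]
      congr 2
      push_cast
      rw [← hββ, hβ']
      linear_combination (n + σ α) * hασ

theorem exists_ideal_sq_eq_span_dvd (hd : Squarefree d) (hd2 : d % 4 = 2) (hr : r ^ 2 = d)
    (h2 : Module.finrank ℚ k = 2)
    (hu : (∃ u : (𝓞 k)ˣ, Algebra.norm ℤ (u : 𝓞 k) = -1) ∨ ∀ x : 𝓞 k, 0 ≤ Algebra.norm ℤ x)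
    {g : ClassGroup (𝓞 k)} (hg : g ^ 2 = 1) :
    ∃ (J : nonZeroDivisors (Ideal (𝓞 k))) (s : ℕ), ClassGroup.mk0 J = g ∧
      (J : Ideal (𝓞 k)) ^ 2 = Ideal.span {(s : 𝓞 k)} ∧ s ∣ d.natAbs := by
  have hd1 : d ≠ 1 := by rintro rfl; omega
  obtain ⟨J, T, rfl, hJ⟩ := exists_ideal_sq_eq_span_int hd hd1 hr h2 hu hg
  obtain ⟨s, t, hst, hs⟩ := Nat.sq_mul_squarefree T.natAbs
  have hJ0 : (J : Ideal (𝓞 k)) ≠ ⊥ := nonZeroDivisors.coe_ne_zero J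
  have hT : Ideal.span {(T : 𝓞 k)} = Ideal.span {(t : 𝓞 k)} ^ 2 * Ideal.span {(s : 𝓞 k)} := by
    rw [Ideal.span_singleton_pow, Ideal.span_singleton_mul_span_singleton,
      Ideal.span_singleton_eq_span_singleton]
    rcases Int.natAbs_eq T with h | h
    · rw [h, ← hst]
      push_cast
      rfl
    · rw [h, ← hst]
      push_cast
      exact (Associated.refl _).neg_left
  have htJ : Ideal.span {(t : 𝓞 k)} ∣ J :=
    (UniqueFactorizationMonoid.pow_dvd_pow_iff_dvd two_ne_zero).mp (⟨_, hJ.trans hT⟩ : _ ∣ (J : Ideal (𝓞 k)) ^ 2)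
  obtain ⟨J', hJ'⟩ := htJ
  have ht0 : (t : 𝓞 k) ≠ 0 := by
    intro h
    rw [h] at hJ'
    exact hJ0 (by simpa using hJ')
  have hspan : Ideal.span {(t : 𝓞 k)} ≠ ⊥ := by simpa using ht0
  have hJ'0 : J' ≠ ⊥ := by
    rintro rfl
    exact hJ0 (by simpa using hJ')
  have hJs : J' ^ 2 = Ideal.span {(s : 𝓞 k)} := by
    rw [hJ', mul_pow, hT] at hJ
    exact mul_left_cancel₀ (pow_ne_zero 2 hspan) hJ
  refine ⟨⟨J', mem_nonZeroDivisors_of_ne_zero hJ'0⟩, s, ?_, hJs, ?_⟩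
  · refine ClassGroup.mk0_eq_mk0_iff.mpr ⟨t, 1, ht0, one_ne_zero, ?_⟩
    simp [hJ']
  rw [← Nat.prod_primeFactors_of_squarefree hs]
  refine Finset.prod_primes_dvd _ (fun q hq => (Nat.prime_of_mem_primeFactors hq).prime)
    fun q hq => ?_
  have hqs := Nat.dvd_of_mem_primeFactors hq
  have hqp := Nat.prime_of_mem_primeFactors hq
  have hqi : Prime (q : ℤ) := Nat.prime_iff_prime_int.mp hqp
  by_contra hqd
  have hqd' : ¬ (q : ℤ) ∣ d := fun h => hqd (Int.natCast_dvd.mp h)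
  have hq2 : ¬ (q : ℤ) ∣ 2 := fun h => hqd' (h.trans (by omega))
  have hsub : J' ≤ Ideal.span {(q : 𝓞 k)} := by
    intro x hx
    have hx2 : x ^ 2 ∈ Ideal.span {(s : 𝓞 k)} := hJs ▸ Ideal.pow_mem_pow hx 2
    obtain ⟨s', rfl⟩ := hqs
    obtain ⟨z, hz⟩ := Ideal.mem_span_singleton.mp hx2
    push_cast at hz
    obtain ⟨a, b, hab, -⟩ := exists_int_two_mul_eq hd hd1 hr h2 x
    obtain ⟨a', b', hab', -⟩ := exists_int_two_mul_eq hd hd1 hr h2 z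
    have hco : (((2 * (a ^ 2 + d * b ^ 2) : ℤ) : 𝓞 k)) + ((4 * a * b : ℤ) : 𝓞 k) * r =
        ((4 * (q * s' * a') : ℤ) : 𝓞 k) + ((4 * (q * s' * b') : ℤ) : 𝓞 k) * r := by
      push_cast
      linear_combination (-4) * x * hab - 2 * (a + b * r) * hab + 8 * hz + 4 * q * s' * hab'
        - 2 * b ^ 2 * hr
    obtain ⟨h1, h3⟩ := int_coords_unique hd hd1 hr hco
    have h4 : ¬ (q : ℤ) ∣ 4 := fun h => hq2 (hqi.dvd_of_dvd_pow (n := 2) (by norm_num; exact h))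
    have h5 : (q : ℤ) ∣ a ^ 2 + d * b ^ 2 :=
      (hqi.dvd_or_dvd (⟨4 * (s' * a'), by linear_combination h1⟩ :
        (q : ℤ) ∣ 2 * (a ^ 2 + d * b ^ 2))).resolve_left hq2
    have h6 : (q : ℤ) ∣ a * b :=
      (hqi.dvd_or_dvd (⟨4 * (s' * b'), by linear_combination h3⟩ :
        (q : ℤ) ∣ 4 * (a * b))).resolve_left h4
    have h7 : (q : ℤ) ∣ a ∧ (q : ℤ) ∣ b := by
      rcases hqi.dvd_or_dvd h6 with h | h
      · refine ⟨h, ?_⟩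
        have h8 : (q : ℤ) ∣ d * b ^ 2 := (Int.dvd_add_right (dvd_pow h two_ne_zero)).mp h5
        exact hqi.dvd_of_dvd_pow ((hqi.dvd_or_dvd h8).resolve_left hqd')
      · refine ⟨?_, h⟩
        exact hqi.dvd_of_dvd_pow ((Int.dvd_add_left (dvd_mul_of_dvd_right
          (dvd_pow h two_ne_zero) _)).mp h5)
    obtain ⟨⟨a, rfl⟩, ⟨b, rfl⟩⟩ := h7
    obtain ⟨u, v, huv⟩ : IsCoprime (2 : ℤ) q := ((Int.prime_two.coprime_iff_not_dvd).mpr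
      fun h => hq2 (((Int.prime_two.dvd_prime_iff_associated hqi).mp h).symm.dvd))
    have huv' : (u : 𝓞 k) * 2 + v * q = 1 := by exact_mod_cast huv
    refine Ideal.mem_span_singleton.mpr ⟨u * (a + b * r) + v * x, ?_⟩
    push_cast at hab
    linear_combination -x * huv' + u * hab
  obtain ⟨L, hL⟩ := Ideal.dvd_iff_le.mpr hsub
  have hqs2 : (Ideal.span {(q : 𝓞 k)}) ^ 2 ∣ Ideal.span {(s : 𝓞 k)} :=
    ⟨L ^ 2, by rw [← hJs, hL, mul_pow]⟩
  have hdvd : ((q : 𝓞 k)) ^ 2 ∣ s := by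
    rwa [Ideal.span_singleton_pow, Ideal.dvd_span_singleton, Ideal.mem_span_singleton] at hqs2
  obtain ⟨z, hz⟩ := hdvd
  obtain ⟨a, b, hab, -⟩ := exists_int_two_mul_eq hd hd1 hr h2 z
  have hco : ((2 * s : ℤ) : 𝓞 k) + ((0 : ℤ) : 𝓞 k) * r =
      ((q ^ 2 * a : ℤ) : 𝓞 k) + ((q ^ 2 * b : ℤ) : 𝓞 k) * r := by
    push_cast
    linear_combination 2 * hz + (q : 𝓞 k) ^ 2 * hab
  have h8 : (q : ℤ) ^ 2 ∣ s * 2 := ⟨a, by rw [mul_comm]; exact (int_coords_unique hd hd1 hr hco).1⟩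
  have h9 : (q : ℤ) ^ 2 ∣ s := by
    refine IsCoprime.dvd_of_dvd_mul_right (IsCoprime.pow_left ?_) h8
    exact (hqi.coprime_iff_not_dvd).mpr hq2
  have h10 : q * q ∣ s := by rw [← sq]; exact_mod_cast h9
  exact hqp.not_isUnit (hs q h10)

theorem not_isSquare_mk0 (hd : Squarefree d) (hd1 : d ≠ 1) (hr : r ^ 2 = d)
    (h2 : Module.finrank ℚ k = 2) {s : ℕ}
    (hs : ∀ e x y n : ℤ, e = 1 ∨ e = -1 → s * n ^ 2 = e * (x ^ 2 - d * y ^ 2) → n = 0)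
    {Q : nonZeroDivisors (Ideal (𝓞 k))}
    (hQ : (Q : Ideal (𝓞 k)) ^ 2 = Ideal.span {(s : 𝓞 k)}) :
    ¬ IsSquare (ClassGroup.mk0 Q) := by
  rintro ⟨c, hc⟩
  obtain ⟨I, rfl⟩ := ClassGroup.mk0_surjective c
  have hI0 : (I : Ideal (𝓞 k)) ≠ ⊥ := nonZeroDivisors.coe_ne_zero I
  have h1 : ClassGroup.mk0 (Q ^ 2) = 1 := by
    rw [ClassGroup.mk0_eq_one_iff]
    exact ⟨⟨s, by rw [SubmonoidClass.coe_pow, hQ]⟩⟩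
  have h3 : ClassGroup.mk0 (I * I * Q) = 1 := by
    rw [map_mul, map_mul, ← hc, ← map_mul, ← sq, h1]
  obtain ⟨α, hα⟩ := ((ClassGroup.mk0_eq_one_iff _).mp h3).principal
  have hα' : (I : Ideal (𝓞 k)) * I * Q = Ideal.span {α} := hα
  have hnQ : Ideal.absNorm (Q : Ideal (𝓞 k)) = s := by
    have h := congrArg Ideal.absNorm hQ
    rw [map_pow, Ideal.absNorm_span_singleton, ← Int.cast_natCast, ← eq_intCast (algebraMap ℤ (𝓞 k)),
      Algebra.norm_algebraMap, RingOfIntegers.rank, h2, Int.natAbs_pow, Int.natAbs_natCast] at h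
    exact Nat.pow_left_injective two_ne_zero h
  have hn := congrArg Ideal.absNorm hα'
  rw [map_mul, map_mul, hnQ, Ideal.absNorm_span_singleton] at hn
  obtain ⟨x, y, -, hxy⟩ := exists_int_two_mul_eq hd hd1 hr h2 α
  obtain ⟨e, he, heα⟩ : ∃ e : ℤ, (e = 1 ∨ e = -1) ∧
      ((Algebra.norm ℤ α).natAbs : ℤ) = e * Algebra.norm ℤ α := by
    rcases Int.natAbs_eq (Algebra.norm ℤ α) with h | h
    · exact ⟨1, Or.inl rfl, by rw [one_mul]; exact h.symm⟩
    · exact ⟨-1, Or.inr rfl, by omega⟩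
  have hn' : ((Ideal.absNorm (I : Ideal (𝓞 k)) : ℤ)) * Ideal.absNorm (I : Ideal (𝓞 k)) * s =
      e * Algebra.norm ℤ α := by
    rw [← heα]
    exact_mod_cast hn
  have h0 := hs e x y (2 * Ideal.absNorm (I : Ideal (𝓞 k))) he
    (by linear_combination 4 * hn' + e * hxy)
  rw [mul_eq_zero_iff_left two_ne_zero] at h0
  exact hI0 (Ideal.absNorm_eq_zero_iff.mp (by exact_mod_cast h0))

theorem factorization_two_classNumber {p₁ p₂ : ℕ} (hp₁ : p₁.Prime) (hp₂ : p₂.Prime) (hne : p₁ ≠ p₂)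
    (hm₁ : p₁ % 8 = 5) (hm₂ : p₂ % 8 = 5) {δ : ℤ} (hδ : δ = 1 ∨ δ = -1)
    (hd : Squarefree (δ * (2 * p₁ * p₂))) (hr : r ^ 2 = (δ * (2 * p₁ * p₂) : ℤ))
    (h2 : Module.finrank ℚ k = 2)
    (hu : (∃ u : (𝓞 k)ˣ, Algebra.norm ℤ (u : 𝓞 k) = -1) ∨ ∀ x : 𝓞 k, 0 ≤ Algebra.norm ℤ x) :
    (classNumber k).factorization 2 = 2 := by
  have := Fact.mk hp₁
  have := Fact.mk hp₂
  have hd2 : δ * (2 * p₁ * p₂) % 4 = 2 := by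
    have h1 : (p₁ * p₂ : ℤ) % 2 = 1 := by
      rw [Int.mul_emod, show (p₁ : ℤ) % 2 = 1 by omega, show (p₂ : ℤ) % 2 = 1 by omega]
      rfl
    rcases hδ with rfl | rfl
    · rw [show (1 : ℤ) * (2 * p₁ * p₂) = 2 * (p₁ * p₂) by ring]
      omega
    · rw [show (-1 : ℤ) * (2 * p₁ * p₂) = -(2 * (p₁ * p₂)) by ring]
      omega
  have hd1 : δ * (2 * p₁ * p₂) ≠ 1 := by intro h; omega
  have hδ2 : δ ^ 2 = 1 := by rcases hδ with rfl | rfl <;> norm_num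
  have hr' : r ^ 2 = (δ : 𝓞 k) * (2 * p₁ * p₂) := by rw [hr]; push_cast; rfl
  have hr0 : r ≠ 0 := by
    rintro rfl
    have : ((δ * (2 * p₁ * p₂) : ℤ) : 𝓞 k) = 0 := by rw [← hr]; ring
    rw [Int.cast_eq_zero] at this
    omega
  -- ramified primes above `2` and `p₁`
  have hram {s e : ℤ} (hse : s * e = δ * (2 * p₁ * p₂)) (hco : IsCoprime s e) :
      ∃ Q : nonZeroDivisors (Ideal (𝓞 k)), (Q : Ideal (𝓞 k)) ^ 2 = Ideal.span {(s : 𝓞 k)} := by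
    refine ⟨⟨Ideal.span {(s : 𝓞 k), r}, mem_nonZeroDivisors_of_ne_zero fun h => hr0 ?_⟩,
      Ideal.span_pair_sq_of_isCoprime (e := (e : 𝓞 k)) ?_ (hco.intCast)⟩
    · rw [Ideal.zero_eq_bot, Ideal.span_eq_bot] at h
      exact h r (by simp)
    · rw [hr, ← hse]
      push_cast
      rfl
  have h12 : IsCoprime (2 : ℤ) p₁ :=
    (Int.prime_two.coprime_iff_not_dvd).mpr (by omega)
  have h22 : IsCoprime (2 : ℤ) p₂ :=
    (Int.prime_two.coprime_iff_not_dvd).mpr (by omega)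
  have hpp : IsCoprime (p₁ : ℤ) p₂ :=
    Nat.isCoprime_iff_coprime.mpr ((Nat.coprime_primes hp₁ hp₂).mpr hne)
  have hδu : IsUnit δ := Int.isUnit_iff.mpr hδ
  obtain ⟨A, hA⟩ := hram (s := 2) (e := δ * (p₁ * p₂)) (by ring)
    ((isCoprime_mul_unit_left_right hδu _ _).mpr (h12.mul_right h22))
  obtain ⟨B, hB⟩ := hram (s := p₁) (e := δ * (2 * p₂)) (by ring)
    ((isCoprime_mul_unit_left_right hδu _ _).mpr (h12.symm.mul_right hpp))
  have hA' : (A : Ideal (𝓞 k)) ^ 2 = Ideal.span {((2 : ℕ) : 𝓞 k)} := by rw [hA]; simp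
  have hB' : (B : Ideal (𝓞 k)) ^ 2 = Ideal.span {(p₁ : 𝓞 k)} := by rw [hB]; simp
  have hAB : ((A * B : nonZeroDivisors (Ideal (𝓞 k))) : Ideal (𝓞 k)) ^ 2 =
      Ideal.span {((2 * p₁ : ℕ) : 𝓞 k)} := by
    rw [Submonoid.coe_mul, mul_pow, hA', hB', Ideal.span_singleton_mul_span_singleton]
    push_cast
    rfl
  have hprinc {Q : nonZeroDivisors (Ideal (𝓞 k))} {z : 𝓞 k}
      (hQ : (Q : Ideal (𝓞 k)) = Ideal.span {z}) : ClassGroup.mk0 Q = 1 := by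
    rw [ClassGroup.mk0_eq_one_iff, hQ]
    exact ⟨⟨z, rfl⟩⟩
  have hsq {Q : nonZeroDivisors (Ideal (𝓞 k))} {z : 𝓞 k}
      (hQ : (Q : Ideal (𝓞 k)) ^ 2 = Ideal.span {z}) : ClassGroup.mk0 Q ^ 2 = 1 := by
    rw [← map_pow]
    exact hprinc (by simpa using hQ)
  have hsame {J Q : nonZeroDivisors (Ideal (𝓞 k))} {s : ℕ}
      (hJ : (J : Ideal (𝓞 k)) ^ 2 = Ideal.span {(s : 𝓞 k)})
      (hQ : (Q : Ideal (𝓞 k)) ^ 2 = Ideal.span {(s : 𝓞 k)}) :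
      ClassGroup.mk0 J = ClassGroup.mk0 Q :=
    congrArg _ (Subtype.ext (Ideal.eq_of_sq_eq_sq (hJ.trans hQ.symm)))
  have hcompl {J Q : nonZeroDivisors (Ideal (𝓞 k))} {s s' : ℕ}
      (hJ : (J : Ideal (𝓞 k)) ^ 2 = Ideal.span {(s : 𝓞 k)})
      (hQ : (Q : Ideal (𝓞 k)) ^ 2 = Ideal.span {(s' : 𝓞 k)}) (hss : s * s' = 2 * p₁ * p₂) :
      ClassGroup.mk0 J = ClassGroup.mk0 Q := by
    have h : ClassGroup.mk0 (J * Q) = 1 := by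
      refine hprinc (z := r) (Ideal.eq_of_sq_eq_sq ?_)
      rw [Submonoid.coe_mul, mul_pow, hJ, hQ, Ideal.span_singleton_mul_span_singleton,
        Ideal.span_singleton_pow, Ideal.span_singleton_eq_span_singleton, hr']
      have hss' : (s : 𝓞 k) * s' = 2 * p₁ * p₂ := by exact_mod_cast hss
      rw [hss']
      rcases hδ with rfl | rfl
      · simp
      · simp
    rw [map_mul, mul_eq_one_iff_eq_inv] at h
    rw [h, inv_eq_iff_mul_eq_one, ← sq, hsq hQ]
  have hone : ((1 : nonZeroDivisors (Ideal (𝓞 k))) : Ideal (𝓞 k)) ^ 2 =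
      Ideal.span {((1 : ℕ) : 𝓞 k)} := by simp
  have hcard : classNumber k = Nat.card (ClassGroup (𝓞 k)) := by
    rw [classNumber, Nat.card_eq_fintype_card]
  rw [hcard]
  refine factorization_two_card_eq_two (hsq hA) (hsq hB) (fun g hg => ?_)
    (not_isSquare_mk0 hd hd1 hr h2 (fun e x y n he h => ?_) hA')
    (not_isSquare_mk0 hd hd1 hr h2 (fun e x y n he h => ?_) hB') ?_
  · obtain ⟨J, s, rfl, hJ, hs⟩ := exists_ideal_sq_eq_span_dvd hd hd2 hr h2 hu hg
    have hs' : s ∣ 2 * p₁ * p₂ := by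
      rcases hδ with rfl | rfl
      · rw [one_mul] at hs
        exact_mod_cast hs
      · rw [neg_one_mul, Int.natAbs_neg] at hs
        exact_mod_cast hs
    obtain ⟨f, c, hf, hc, rfl⟩ := (Nat.dvd_mul).mp hs'
    obtain ⟨a, b, ha, hb, rfl⟩ := (Nat.dvd_mul).mp hf
    rw [← map_mul]
    rcases (Nat.dvd_prime Nat.prime_two).mp ha with rfl | rfl <;>
    rcases (Nat.dvd_prime hp₁).mp hb with rfl | rfl <;>
    rcases (Nat.dvd_prime hp₂).mp hc with rfl | rfl
    · left; rw [← map_one ClassGroup.mk0]; exact hsame hJ (by simp)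
    · right; right; right; exact hcompl hJ hAB (by ring)
    · right; right; left; exact hsame hJ (by rw [hB']; simp)
    · right; left; exact hcompl hJ hA' (by ring)
    · right; left; exact hsame hJ (by rw [hA'])
    · right; right; left; exact hcompl hJ hB' (by ring)
    · right; right; right; exact hsame hJ (by rw [hAB]; simp)
    · left; rw [← map_one ClassGroup.mk0]; exact hcompl hJ hone (by ring)
  · exact eq_zero_of_two_mul_sq hne hm₁ he hδ h
  · exact eq_zero_of_prime_mul_sq hne hm₁ hm₂ he hδ h
  · rw [← map_mul]
    refine not_isSquare_mk0 hd hd1 hr h2 (fun e x y n he h => ?_) hAB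
    exact eq_zero_of_two_mul_prime_mul_sq hne hm₁ hm₂ he hδ (by push_cast at h; exact h)

end Quadratic

section SqrtChar

variable {K : Type*} [Field K] [NumberField K]

theorem apply_sqrt_eq {d : ℤ} {r : K} (hr : r ^ 2 = d) (σ : Gal(K/ℚ)) : σ r = r ∨ σ r = -r := by
  rw [← sq_eq_sq_iff_eq_or_eq_neg, ← map_pow, hr, map_intCast]

open Classical in
/-- The sign character of the Galois group attached to a square root `r` of an integer. -/
noncomputable def sqrtChar {d : ℤ} {r : K} (hr : r ^ 2 = d) (h0 : r ≠ 0) : Gal(K/ℚ) →* ℤˣ where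
  toFun σ := if σ r = r then 1 else -1
  map_one' := by simp
  map_mul' σ τ := by
    have hne : -r ≠ r := fun h => h0 (self_eq_neg.mp h.symm)
    rcases apply_sqrt_eq hr σ with h1 | h1 <;> rcases apply_sqrt_eq hr τ with h2 | h2 <;>
      simp [AlgEquiv.mul_apply, h1, h2, hne]

theorem apply_sqrt {d : ℤ} {r : K} (hr : r ^ 2 = d) (h0 : r ≠ 0) (σ : Gal(K/ℚ)) :
    σ r = ((sqrtChar hr h0 σ : ℤˣ) : ℤ) * r := by
  have hne : -r ≠ r := fun h => h0 (self_eq_neg.mp h.symm)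
  rcases apply_sqrt_eq hr σ with h1 | h1 <;> simp [sqrtChar, h1, hne]

theorem sqrtChar_eq_of_apply {d : ℤ} {r : K} (hr : r ^ 2 = d) (h0 : r ≠ 0) {σ : Gal(K/ℚ)} {e : ℤˣ}
    (h : σ r = ((e : ℤ) : K) * r) : sqrtChar hr h0 σ = e := by
  rw [apply_sqrt hr h0] at h
  exact Units.ext (by exact_mod_cast mul_right_cancel₀ h0 h)

theorem sqrtChar_eq_one_iff {d : ℤ} {r : K} (hr : r ^ 2 = d) (h0 : r ≠ 0) {σ : Gal(K/ℚ)} :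
    sqrtChar hr h0 σ = 1 ↔ σ r = r := by
  refine ⟨fun h => by rw [apply_sqrt hr h0, h]; simp, fun h => sqrtChar_eq_of_apply hr h0 ?_⟩
  simpa using h

theorem ker_sqrtChar {d : ℤ} {r : K} (hr : r ^ 2 = d) (h0 : r ≠ 0) :
    (sqrtChar hr h0).ker = (ℚ⟮r⟯).fixingSubgroup := by
  ext σ
  rw [MonoidHom.mem_ker, sqrtChar_eq_one_iff]
  refine ⟨fun h => ?_, fun h => ?_⟩
  · rw [IntermediateField.mem_fixingSubgroup_iff]
    have : ℚ⟮r⟯ ≤ fixedField (Subgroup.zpowers σ) := by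
      rw [adjoin_simple_le_iff, mem_fixedField_iff]
      intro f hf
      obtain ⟨n, rfl⟩ := Subgroup.mem_zpowers_iff.mp hf
      have hs : σ ∈ MulAction.stabilizer Gal(K/ℚ) r := h
      exact (MulAction.stabilizer Gal(K/ℚ) r).zpow_mem hs n
    intro x hx
    exact (mem_fixedField_iff _ _).mp (this hx) σ (Subgroup.mem_zpowers σ)
  · exact (IntermediateField.mem_fixingSubgroup_iff _ _).mp h r (mem_adjoin_simple_self ℚ r)

end SqrtChar

/-- `K = ℚ(√2, √m, i)` with `m ≡ 1 (mod 4)` squarefree. -/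
structure IsTriquadratic {K : Type*} [Field K] [NumberField K] (m : ℕ) (r s i : K) : Prop where
  squarefree : Squarefree (m : ℤ)
  one_lt : 1 < m
  mod_four : m % 4 = 1
  sq_two : r ^ 2 = (2 : ℤ)
  sq_m : s ^ 2 = (m : ℤ)
  sq_i : i ^ 2 = (-1 : ℤ)
  adjoin_eq_top : IntermediateField.adjoin ℚ {r, s, i} = ⊤

namespace IsTriquadratic

variable {K : Type*} [Field K] [NumberField K] {m : ℕ} {r s i : K}

theorem r_ne_zero (h : IsTriquadratic m r s i) : r ≠ 0 := by
  rintro rfl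
  simpa using h.sq_two

theorem s_ne_zero (h : IsTriquadratic m r s i) : s ≠ 0 := by
  rintro rfl
  have h1 := h.one_lt
  have h2 := h.sq_m
  rw [zero_pow two_ne_zero, eq_comm] at h2
  have : m = 0 := by exact_mod_cast h2
  omega

theorem i_ne_zero (h : IsTriquadratic m r s i) : i ≠ 0 := by
  rintro rfl
  simpa using h.sq_i

theorem ext_apply (h : IsTriquadratic m r s i) {L : Type*} [Field L] [Algebra ℚ L] {f g : K →ₐ[ℚ] L}
    (h1 : f r = g r) (h2 : f s = g s) (h3 : f i = g i) : f = g := by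
  ext x
  have hx : x ∈ IntermediateField.adjoin ℚ {r, s, i} := h.adjoin_eq_top ▸ mem_top
  induction hx using adjoin_induction with
  | mem x hx => rcases hx with rfl | rfl | rfl <;> assumption
  | algebraMap x => rw [f.commutes, g.commutes]
  | add x y _ _ hx hy => rw [map_add, map_add, hx, hy]
  | inv x _ hx => rw [map_inv₀, map_inv₀, hx]
  | mul x y _ _ hx hy => rw [map_mul, map_mul, hx, hy]

theorem isPrimitiveRoot (h : IsTriquadratic m r s i) : IsPrimitiveRoot (r * (1 + i) / 2) 8 := by
  have hr := h.sq_two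
  have hi := h.sq_i
  push_cast at hr hi
  have h2 : (r * (1 + i) / 2) ^ 2 = i := by linear_combination (1 + i) ^ 2 / 4 * hr + hi / 2
  have h4 : (r * (1 + i) / 2) ^ 2 ^ 2 = -1 := by
    rw [show 2 ^ 2 = 2 * 2 from rfl, pow_mul, h2, hi]
  have : orderOf (r * (1 + i) / 2) = 2 ^ (2 + 1) := by
    refine orderOf_eq_prime_pow ?_ ?_
    · rw [h4]
      norm_num
    · rw [pow_succ, pow_mul, h4]
      norm_num
  have h8 := IsPrimitiveRoot.orderOf (r * (1 + i) / 2)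
  rw [this] at h8
  exact h8

theorem adjoin_sup_adjoin (h : IsTriquadratic m r s i) : ℚ⟮r * (1 + i) / 2⟯ ⊔ ℚ⟮s⟯ = ⊤ := by
  have hr := h.sq_two
  have hi := h.sq_i
  push_cast at hr hi
  rw [eq_top_iff, ← h.adjoin_eq_top, adjoin_le_iff]
  have hζ : r * (1 + i) / 2 ∈ ℚ⟮r * (1 + i) / 2⟯ ⊔ ℚ⟮s⟯ :=
    (le_sup_left : _ ≤ ℚ⟮r * (1 + i) / 2⟯ ⊔ ℚ⟮s⟯) (mem_adjoin_simple_self ℚ _)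
  have hs : s ∈ ℚ⟮r * (1 + i) / 2⟯ ⊔ ℚ⟮s⟯ :=
    (le_sup_right : _ ≤ ℚ⟮r * (1 + i) / 2⟯ ⊔ ℚ⟮s⟯) (mem_adjoin_simple_self ℚ _)
  have hi' : i ∈ ℚ⟮r * (1 + i) / 2⟯ ⊔ ℚ⟮s⟯ := by
    have := pow_mem hζ 2
    rwa [show (r * (1 + i) / 2) ^ 2 = i by linear_combination (1 + i) ^ 2 / 4 * hr + hi / 2] at this
  have hr' : r ∈ ℚ⟮r * (1 + i) / 2⟯ ⊔ ℚ⟮s⟯ := by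
    have := mul_mem hζ (sub_mem (one_mem _) hi')
    rwa [show r * (1 + i) / 2 * (1 - i) = r by linear_combination -r / 2 * hi] at this
  rintro x (rfl | rfl | rfl) <;> assumption

theorem isGalois (h : IsTriquadratic m r s i) : IsGalois ℚ K := by
  have h2 : Module.finrank ℚ ℚ⟮s⟯ = 2 := by
    refine finrank_adjoin_sqrt h.squarefree ?_ h.sq_m
    have := h.one_lt
    omega
  have : Algebra.IsQuadraticExtension ℚ ℚ⟮s⟯ := ⟨h2⟩
  have hc : IsCyclotomicExtension {8} ℚ ℚ⟮r * (1 + i) / 2⟯ :=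
    h.isPrimitiveRoot.intermediateField_adjoin_isCyclotomicExtension ℚ
  have hg : IsGalois ℚ ℚ⟮r * (1 + i) / 2⟯ := IsCyclotomicExtension.isGalois {8} ℚ _
  have hn1 : Normal ℚ ℚ⟮s⟯ := Algebra.IsQuadraticExtension.normal ℚ ℚ⟮s⟯
  have hn2 : Normal ℚ ℚ⟮r * (1 + i) / 2⟯ := hg.to_normal
  have hn := @normal_sup ℚ K _ _ _ ℚ⟮r * (1 + i) / 2⟯ ℚ⟮s⟯ hn2 hn1
  rw [h.adjoin_sup_adjoin] at hn
  have := Normal.of_algEquiv (topEquiv (F := ℚ) (E := K))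
  constructor

theorem discr_and_finrank (h : IsTriquadratic m r s i) :
    (discr K).natAbs = 2 ^ 16 * m ^ 4 ∧ Module.finrank ℚ K = 8 := by
  have h1 : (m : ℤ) ≠ 1 := by
    have := h.one_lt
    omega
  have h2 : Module.finrank ℚ ℚ⟮s⟯ = 2 := finrank_adjoin_sqrt h.squarefree h1 h.sq_m
  have hdm : discr ℚ⟮s⟯ = m := discr_eq_self (r := AdjoinSimple.gen ℚ s) h.squarefree h1
    (by apply (algebraMap ℚ⟮s⟯ K).injective; simpa using h.sq_m) h2 (by have := h.mod_four; omega)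
  have hc : IsCyclotomicExtension {8} ℚ ℚ⟮r * (1 + i) / 2⟯ :=
    h.isPrimitiveRoot.intermediateField_adjoin_isCyclotomicExtension ℚ
  have := IsCyclotomicExtension.isGalois {8} ℚ ℚ⟮r * (1 + i) / 2⟯
  have h4 : Module.finrank ℚ ℚ⟮r * (1 + i) / 2⟯ = 4 := by
    rw [IsCyclotomicExtension.Rat.finrank 8]
    rfl
  have hd8 : (discr ℚ⟮r * (1 + i) / 2⟯).natAbs = 2 ^ 8 := by
    rw [IsCyclotomicExtension.Rat.natAbs_discr 8]
    rw [show Nat.primeFactors 8 = {2} by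
      rw [show 8 = 2 ^ 3 by norm_num, Nat.primeFactors_prime_pow (by norm_num) Nat.prime_two],
      Finset.prod_singleton, show Nat.totient 8 = 4 by decide]
    norm_num
  have hco : IsCoprime (discr ℚ⟮r * (1 + i) / 2⟯) (discr ℚ⟮s⟯) := by
    rw [Int.isCoprime_iff_gcd_eq_one, Int.gcd_def, hd8, hdm]
    have := h.mod_four
    exact Nat.Coprime.pow_left 8 ((Nat.coprime_two_left).mpr (Nat.odd_iff.mpr (by omega)))
  have hdis := linearDisjoint_of_isGalois_isCoprime_discr (L := K) _ _ hco
  constructor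
  · rw [natAbs_discr_eq_natAbs_discr_pow_mul_natAbs_discr_pow K _ _ hdis h.adjoin_sup_adjoin
      (isCoprime_differentIdeal_of_isCoprime_discr K hco), hd8, hdm, h2, h4]
    norm_num
  · have := hdis.finrank_sup
    rwa [h.adjoin_sup_adjoin, finrank_top', h2, h4] at this

noncomputable def charR (h : IsTriquadratic m r s i) : Gal(K/ℚ) →* ℤˣ :=
  sqrtChar h.sq_two h.r_ne_zero

noncomputable def charS (h : IsTriquadratic m r s i) : Gal(K/ℚ) →* ℤˣ :=
  sqrtChar h.sq_m h.s_ne_zero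

noncomputable def charI (h : IsTriquadratic m r s i) : Gal(K/ℚ) →* ℤˣ :=
  sqrtChar h.sq_i h.i_ne_zero

theorem apply_r (h : IsTriquadratic m r s i) (σ : Gal(K/ℚ)) : σ r = ((h.charR σ : ℤˣ) : ℤ) * r :=
  apply_sqrt h.sq_two h.r_ne_zero σ

theorem apply_s (h : IsTriquadratic m r s i) (σ : Gal(K/ℚ)) : σ s = ((h.charS σ : ℤˣ) : ℤ) * s :=
  apply_sqrt h.sq_m h.s_ne_zero σ

theorem apply_i (h : IsTriquadratic m r s i) (σ : Gal(K/ℚ)) : σ i = ((h.charI σ : ℤˣ) : ℤ) * i :=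
  apply_sqrt h.sq_i h.i_ne_zero σ

theorem ext_char (h : IsTriquadratic m r s i) {σ τ : Gal(K/ℚ)} (h1 : h.charR σ = h.charR τ)
    (h2 : h.charS σ = h.charS τ) (h3 : h.charI σ = h.charI τ) : σ = τ := by
  have : (σ : K →ₐ[ℚ] K) = τ := h.ext_apply
    (show σ r = τ r by rw [h.apply_r, h.apply_r, h1]) (show σ s = τ s by rw [h.apply_s, h.apply_s, h2])
    (show σ i = τ i by rw [h.apply_i, h.apply_i, h3])
  ext x
  exact DFunLike.congr_fun this x

theorem sq_eq_one (h : IsTriquadratic m r s i) (σ : Gal(K/ℚ)) : σ ^ 2 = 1 := by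
  refine h.ext_char ?_ ?_ ?_ <;> rw [map_pow, map_one, Int.units_sq]

theorem exists_char_eq (h : IsTriquadratic m r s i) (a b c : ℤˣ) :
    ∃ σ : Gal(K/ℚ), h.charR σ = a ∧ h.charS σ = b ∧ h.charI σ = c := by
  have := h.isGalois
  have hinj : Function.Injective (fun σ => (h.charR σ, h.charS σ, h.charI σ)) := by
    intro σ τ hst
    simp only [Prod.mk.injEq] at hst
    exact h.ext_char hst.1 hst.2.1 hst.2.2
  have hcard : Nat.card (ℤˣ × ℤˣ × ℤˣ) ≤ Nat.card Gal(K/ℚ) := by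
    rw [IsGalois.card_aut_eq_finrank, h.discr_and_finrank.2, Nat.card_eq_fintype_card]
    decide
  obtain ⟨σ, hσ⟩ := (hinj.bijective_of_nat_card_le hcard).2 (a, b, c)
  simp only [Prod.mk.injEq] at hσ
  exact ⟨σ, hσ⟩

/-- The seven square roots generating the quadratic subfields of `K`. -/
def roots (r s i : K) : Fin 7 → K := ![r, s, r * s, i, i * r, i * s, i * r * s]

/-- The squares of the entries of `roots`. -/
def radicands (m : ℕ) : Fin 7 → ℤ := ![2, m, 2 * m, -1, -2, -m, -(2 * m)]

theorem roots_sq (h : IsTriquadratic m r s i) (j : Fin 7) : roots r s i j ^ 2 = radicands m j := by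
  have hr := h.sq_two
  have hs := h.sq_m
  have hi := h.sq_i
  fin_cases j <;> simp [roots, radicands, mul_pow, hr, hs, hi]

theorem roots_ne_zero (h : IsTriquadratic m r s i) (j : Fin 7) : roots r s i j ≠ 0 := by
  have hr := h.r_ne_zero
  have hs := h.s_ne_zero
  have hi := h.i_ne_zero
  fin_cases j <;> simp [roots, hr, hs, hi]

theorem squarefree_two_mul (h : IsTriquadratic m r s i) : Squarefree (2 * m : ℤ) := by
  have := h.mod_four
  have hc : IsCoprime (2 : ℤ) m := by
    rw [Int.isCoprime_iff_gcd_eq_one]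
    exact (Nat.coprime_two_left).mpr (Nat.odd_iff.mpr (by omega))
  exact (squarefree_mul_iff).mpr
    ⟨hc.isRelPrime, Int.prime_two.squarefree, h.squarefree⟩

theorem squarefree_radicands (h : IsTriquadratic m r s i) (j : Fin 7) :
    Squarefree (radicands m j) ∧ radicands m j ≠ 1 := by
  have h1 := h.one_lt
  have h2 : Squarefree (2 : ℤ) := Int.prime_two.squarefree
  have h2m := h.squarefree_two_mul
  have hm := h.squarefree
  have hneg {a : ℤ} (ha : Squarefree a) : Squarefree (-a) := by
    rwa [← Int.squarefree_natAbs, Int.natAbs_neg, Int.squarefree_natAbs]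
  have h1' := hneg (squarefree_one (R := ℤ))
  have h2' := hneg h2
  have h2m' := hneg h2m
  have hm' := hneg hm
  fin_cases j <;> simp only [radicands] <;> refine ⟨by assumption, ?_⟩ <;> simp <;> omega

theorem finrank_adjoin_roots (h : IsTriquadratic m r s i) (j : Fin 7) :
    Module.finrank ℚ ℚ⟮roots r s i j⟯ = 2 :=
  finrank_adjoin_sqrt (h.squarefree_radicands j).1 (h.squarefree_radicands j).2 (h.roots_sq j)

theorem residue_eq_prod (h : IsTriquadratic m r s i) :
    dedekindZeta_residue K = ∏ j, dedekindZeta_residue ℚ⟮roots r s i j⟯ := by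
  have := h.isGalois
  refine residue_eq_prod_quadratic h.sq_eq_one (fun j => ℚ⟮roots r s i j⟯)
    (fun j => sqrtChar (h.roots_sq j) (h.roots_ne_zero j))
    (fun j => ker_sqrtChar (h.roots_sq j) (h.roots_ne_zero j)) h.finrank_adjoin_roots
    (by rw [h.discr_and_finrank.2]; rfl) fun σ hσ => ?_
  have key : ∀ j, sqrtChar (h.roots_sq j) (h.roots_ne_zero j) σ =
      (![h.charR σ, h.charS σ, h.charR σ * h.charS σ, h.charI σ, h.charI σ * h.charR σ,
        h.charI σ * h.charS σ, h.charI σ * h.charR σ * h.charS σ] : Fin 7 → ℤˣ) j := by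
    intro j
    apply sqrtChar_eq_of_apply
    fin_cases j <;> simp [roots, h.apply_r σ, h.apply_s σ, h.apply_i σ] <;> ring
  simp only [key]
  have hne : ¬ (h.charR σ = 1 ∧ h.charS σ = 1 ∧ h.charI σ = 1) := fun h' => hσ <|
    h.ext_char (by rw [h'.1, map_one]) (by rw [h'.2.1, map_one]) (by rw [h'.2.2, map_one])
  generalize h.charR σ = a at *
  generalize h.charS σ = b at *
  generalize h.charI σ = c at *
  clear key
  revert hne
  revert a b c
  decide

end IsTriquadratic

section Torsion

theorem exists_isPrimitiveRoot_of_dvd_torsionOrder {K : Type*} [Field K] [NumberField K] {n : ℕ}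
    (h : n ∣ Units.torsionOrder K) : ∃ ζ : K, IsPrimitiveRoot ζ n := by
  obtain ⟨g, hg⟩ := IsCyclic.exists_ofOrder_eq_natCard (α := Units.torsion K)
  obtain ⟨c, hc⟩ := h
  have hn0 : n ≠ 0 := by
    rintro rfl
    exact Units.torsionOrder_ne_zero K (by rw [hc, zero_mul])
  have hc0 : c ≠ 0 := by
    rintro rfl
    exact Units.torsionOrder_ne_zero K (by rw [hc, mul_zero])
  have hgc : orderOf (g ^ c) = n := by
    have hg' : orderOf g = n * c := hg.trans hc
    rw [orderOf_pow_of_dvd hc0 (hg' ▸ dvd_mul_left c n), hg', Nat.mul_div_cancel _ hc0.bot_lt]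
  have hp := IsPrimitiveRoot.orderOf (g ^ c)
  rw [hgc] at hp
  have h1 := hp.map_of_injective (f := (Units.torsion K).subtype) Subtype.val_injective
  have h2 := h1.map_of_injective (f := Units.coeHom (𝓞 K)) Units.val_injective
  exact ⟨_, h2.map_of_injective (f := algebraMap (𝓞 K) K) RingOfIntegers.coe_injective⟩

theorem dvd_torsionOrder_iff {K : Type*} [Field K] [NumberField K] {n : ℕ} [NeZero n] :
    n ∣ Units.torsionOrder K ↔ ∃ ζ : K, IsPrimitiveRoot ζ n :=
  ⟨exists_isPrimitiveRoot_of_dvd_torsionOrder,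
    fun ⟨_, h⟩ => Units.dvd_torsionOrder_of_isPrimitiveRoot h⟩

theorem factorization_two_eq {n e : ℕ} (h1 : 2 ^ e ∣ n) (h2 : ¬ 2 ^ (e + 1) ∣ n) :
    n.factorization 2 = e := by
  have hn : n ≠ 0 := fun h => h2 (h ▸ dvd_zero _)
  rw [Nat.prime_two.pow_dvd_iff_le_factorization hn] at h1 h2
  omega

variable {k : Type*} [Field k] [NumberField k] {d : ℤ} {r : k}

theorem factorization_two_torsionOrder_quadratic (hd : Squarefree d) (hd1 : d ≠ 1) (hd1' : d ≠ -1)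
    (hr : r ^ 2 = d) (h2 : Module.finrank ℚ k = 2) :
    (Units.torsionOrder k).factorization 2 = 1 := by
  refine factorization_two_eq (by simpa using (Units.even_torsionOrder k).two_dvd) ?_
  rw [dvd_torsionOrder_iff]
  rintro ⟨ζ, hζ⟩
  have hζ2 : ζ ^ 2 = -1 := by
    have h := (hζ.pow (by norm_num) (show 2 ^ (1 + 1) = 2 * 2 by norm_num)).eq_neg_one_of_two_right
    exact h
  obtain ⟨a, b, rfl⟩ := exists_coords hd hd1 hr h2 ζ
  have hab : (a : k) ^ 2 + d * b ^ 2 + 1 + 2 * a * b * r = 0 := by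
    linear_combination hζ2 - (b : k) ^ 2 * hr
  have hab0 : a * b = 0 := by
    by_contra h0
    refine sqrt_notMem_range hd hd1 hr (-(a ^ 2 + d * b ^ 2 + 1) / (2 * (a * b))) ?_
    have h0' : ((a : k) * b) ≠ 0 := by exact_mod_cast h0
    push_cast
    rw [div_eq_iff (mul_ne_zero two_ne_zero h0')]
    linear_combination -hab
  have hab' : a ^ 2 + d * b ^ 2 + 1 = 0 := by
    have h0' : ((a : k) * b) = 0 := by exact_mod_cast hab0
    have : (a : k) ^ 2 + d * b ^ 2 + 1 = 0 := by linear_combination hab - 2 * r * h0'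
    exact_mod_cast this
  rcases mul_eq_zero.mp hab0 with rfl | rfl
  · have hb : (d : ℚ) * b ^ 2 = (-1 : ℤ) := by
      push_cast
      linear_combination hab'
    obtain ⟨z, rfl⟩ := Rat.exists_int_eq_of_squarefree_mul_sq hd hb
    have hz : d * z ^ 2 = -1 := by exact_mod_cast hb
    have hu : IsUnit d := IsUnit.of_mul_eq_one (-z ^ 2) (by linear_combination -hz)
    rcases Int.isUnit_iff.mp hu with h | h <;> contradiction
  · nlinarith

theorem factorization_two_torsionOrder_sqrt_neg_one (hr : r ^ 2 = (-1 : ℤ))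
    (h2 : Module.finrank ℚ k = 2) : (Units.torsionOrder k).factorization 2 = 2 := by
  refine factorization_two_eq ?_ ?_
  · rw [dvd_torsionOrder_iff]
    refine ⟨r, ?_⟩
    push_cast at hr
    have : orderOf r = 2 ^ (1 + 1) := by
      refine orderOf_eq_prime_pow ?_ ?_
      · rw [pow_one, hr]
        norm_num
      · rw [pow_succ, pow_mul, pow_one, hr]
        norm_num
    have h8 := IsPrimitiveRoot.orderOf r
    rwa [this] at h8
  · rw [dvd_torsionOrder_iff]
    rintro ⟨ζ, hζ⟩
    have hc : IsCyclotomicExtension {8} ℚ ℚ⟮ζ⟯ :=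
      hζ.intermediateField_adjoin_isCyclotomicExtension ℚ
    have h4 := IsCyclotomicExtension.Rat.finrank 8 ℚ⟮ζ⟯
    have hle : Module.finrank ℚ ℚ⟮ζ⟯ ≤ Module.finrank ℚ k := Submodule.finrank_le ℚ⟮ζ⟯.toSubmodule
    rw [h4, h2, show Nat.totient 8 = 4 by decide] at hle
    omega

theorem classNumber_eq_one_of_real (hd : Squarefree d) (hd1 : d ≠ 1) (hr : r ^ 2 = d)
    (h2 : Module.finrank ℚ k = 2) (hpos : 0 < d) (hdisc : |discr k| < 16) : classNumber k = 1 := by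
  rw [classNumber_eq_one_iff]
  apply RingOfIntegers.isPrincipalIdealRing_of_abs_discr_lt
  rw [h2, (nrRealPlaces_of_sqrt hd hd1 hr h2 hpos).2]
  have : ((|discr k| : ℤ) : ℝ) < (16 : ℤ) := Int.cast_lt.mpr hdisc
  refine this.trans_eq ?_
  norm_num [Nat.factorial]

theorem classNumber_eq_one_of_imaginary (hr : r ^ 2 = d) (h2 : Module.finrank ℚ k = 2)
    (hneg : d < 0) (hdisc : |discr k| < 9) : classNumber k = 1 := by
  rw [classNumber_eq_one_iff]
  apply RingOfIntegers.isPrincipalIdealRing_of_abs_discr_lt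
  rw [h2, (nrComplexPlaces_of_sqrt hr h2 hneg).2]
  have : ((|discr k| : ℤ) : ℝ) < (9 : ℤ) := Int.cast_lt.mpr hdisc
  refine this.trans ?_
  have hpi := Real.pi_gt_three
  norm_num [Nat.factorial]
  nlinarith

end Torsion

namespace IsTriquadratic

variable {K : Type*} [Field K] [NumberField K] {m : ℕ} {r s i : K}

theorem factorization_two_torsionOrder (h : IsTriquadratic m r s i) :
    (Units.torsionOrder K).factorization 2 = 3 := by
  refine factorization_two_eq (dvd_torsionOrder_iff.mpr ⟨_, h.isPrimitiveRoot⟩) ?_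
  rw [dvd_torsionOrder_iff]
  rintro ⟨ζ, hζ⟩
  have hc : IsCyclotomicExtension {16} ℚ ℚ⟮ζ⟯ :=
    hζ.intermediateField_adjoin_isCyclotomicExtension ℚ
  have hd := Int.natAbs_dvd_natAbs.mpr (discr_dvd_discr ℚ⟮ζ⟯ K)
  rw [h.discr_and_finrank.1, IsCyclotomicExtension.Rat.natAbs_discr 16, show Nat.primeFactors 16 = {2} by
      rw [show 16 = 2 ^ 4 by norm_num, Nat.primeFactors_prime_pow (by norm_num) Nat.prime_two],
      Finset.prod_singleton, show Nat.totient 16 = 8 by decide] at hd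
  norm_num at hd
  have := h.mod_four
  have h2 : 2 ∣ m ^ 4 := by
    refine Nat.dvd_of_mul_dvd_mul_left (show 0 < 65536 by norm_num) (dvd_trans ?_ hd)
    norm_num
  have := Nat.prime_two.dvd_of_dvd_pow h2
  omega

end IsTriquadratic

section CommGroup

variable {G : Type*} [CommGroup G] {c σ τ : G →* G} {ε a b d e : G}

theorem mul_map_eq_of_sq_eq (hcσ : ∀ x, c (σ x) = σ (c x)) (hε : ε ^ 2 = 1)
    (hno : ∀ x, x * c x ≠ ε) (hroot : ∀ x : G, x ^ 2 = 1 → x = 1 ∨ x = ε)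
    (ha : a * σ a = ε) (hb : σ b = b) (hd : d * σ d = 1 ∨ d * σ d = ε) (he : e ^ 2 = a * b * d)
    (hcb : c b = b) (hce : c e = e) :
    d * σ d = ε ∧ (e * σ e = b ∨ e * σ e = ε * b) := by
  have hsq : (e * σ e / b) ^ 2 = ε * (d * σ d) := by
    calc (e * σ e / b) ^ 2 = e ^ 2 * σ (e ^ 2) / b ^ 2 := by
          rw [div_pow, mul_pow, map_pow]
      _ = (a * σ a) * (b * σ b / b ^ 2) * (d * σ d) := by
          rw [he, map_mul, map_mul, div_eq_mul_inv, div_eq_mul_inv]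
          ac_rfl
      _ = ε * (d * σ d) := by rw [ha, hb, ← sq, div_self', mul_one]
  have hc : c (e * σ e / b) = e * σ e / b := by rw [map_div, map_mul, hcσ, hce, hcb]
  rcases hd with hd | hd
  · exact absurd (by rw [hc, ← sq, hsq, hd, mul_one]) (hno (e * σ e / b))
  · refine ⟨hd, ?_⟩
    rw [hd, ← sq, hε] at hsq
    rcases hroot _ hsq with h | h
    · exact Or.inl (div_eq_one.mp h)
    · exact Or.inr (div_eq_iff_eq_mul.mp h)

theorem even_of_mul_map_eq_mul_sq (hcσ : ∀ x, c (σ x) = σ (c x)) (hε : ε ^ 2 = 1) (hno : ∀ x, x * c x ≠ ε) {u w : G} {p : ℤ} (hw : c w = w)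
    (h : u * c u * σ (u * c u) = ε ^ p * w ^ 2) : Even p := by
  by_contra hp
  obtain ⟨n, rfl⟩ := Int.not_even_iff_odd.mp hp
  refine hno (u * σ u / w) ?_
  rw [zpow_add, zpow_mul, zpow_ofNat, hε, one_zpow, one_mul, zpow_one] at h
  calc u * σ u / w * c (u * σ u / w) = u * c u * σ (u * c u) / w ^ 2 := by
        rw [map_div, map_mul, hcσ, hw, map_mul, sq, div_mul_div_comm]
        congr 1
        ac_rfl
    _ = ε := by rw [h, mul_div_cancel_right]

theorem even_exponents_of_sq_eq (hcσ : ∀ x, c (σ x) = σ (c x)) (hcτ : ∀ x, c (τ x) = τ (c x))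
    (hε : ε ^ 2 = 1) (hσε : σ ε = ε) (hτε : τ ε = ε)
    (hno : ∀ x, x * c x ≠ ε) (hroot : ∀ x : G, x ^ 2 = 1 → x = 1 ∨ x = ε)
    (ha : a * σ a = ε) (ha' : τ a = a) (hb : σ b = b) (hb' : b * τ b = ε)
    (hca : c a = a) (hcb : c b = b) (hce : c e = e)
    (he : e * σ e = b ∨ e * σ e = ε * b) (he' : e * τ e = a ∨ e * τ e = ε * a)
    {u ζ : G} {p q n : ℤ} (hζ : ζ * c ζ = 1) (hu : u ^ 2 = ζ * (a ^ p * b ^ q * e ^ n)) :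
    Even p ∧ Even q ∧ Even n := by
  have hε1 : ε ≠ 1 := fun h => hno 1 (by rw [map_one, mul_one, h])
  set g := a ^ p * b ^ q * e ^ n with hg
  have hcg : c g = g := by simp only [hg, map_mul, map_zpow, hca, hcb, hce]
  obtain ⟨δ, hδ, hv⟩ : ∃ δ : G, (δ = 1 ∨ δ = ε) ∧ u * c u = δ * g := by
    have hsq : (u * c u / g) ^ 2 = 1 := by
      calc (u * c u / g) ^ 2 = u ^ 2 * c (u ^ 2) / g ^ 2 := by rw [div_pow, mul_pow, map_pow]
        _ = (ζ * c ζ) * (g * g / g ^ 2) := by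
            rw [hu, map_mul, hcg, div_eq_mul_inv, div_eq_mul_inv]
            ac_rfl
        _ = 1 := by rw [hζ, ← sq, div_self', mul_one]
    exact ⟨u * c u / g, hroot _ hsq, (div_mul_cancel _ _).symm⟩
  have hδ2 : δ * δ = 1 := by
    rcases hδ with rfl | rfl
    · exact one_mul 1
    · rw [← sq, hε]
  have hδσ : σ δ = δ := by rcases hδ with rfl | rfl <;> simp [hσε]
  have hδτ : τ δ = δ := by rcases hδ with rfl | rfl <;> simp [hτε]
  have h1 : u * c u * σ (u * c u) = ε ^ p * (b ^ q) ^ 2 * (e * σ e) ^ n := by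
    calc u * c u * σ (u * c u) = (δ * δ) * (g * σ g) := by
          rw [hv, map_mul, hδσ]
          ac_rfl
      _ = (a * σ a) ^ p * (b ^ q) ^ 2 * (e * σ e) ^ n := by
          simp only [hδ2, hg, map_mul, map_zpow, hb, mul_zpow, sq, one_mul]
          simp only [mul_comm, mul_left_comm, mul_assoc]
      _ = _ := by rw [ha]
  have h2 : u * c u * τ (u * c u) = ε ^ q * (a ^ p) ^ 2 * (e * τ e) ^ n := by
    calc u * c u * τ (u * c u) = (δ * δ) * (g * τ g) := by
          rw [hv, map_mul, hδτ]
          ac_rfl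
      _ = (b * τ b) ^ q * (a ^ p) ^ 2 * (e * τ e) ^ n := by
          simp only [hδ2, hg, map_mul, map_zpow, ha', mul_zpow, sq, one_mul]
          simp only [mul_comm, mul_left_comm, mul_assoc]
      _ = _ := by rw [hb']
  have hεz (z : ℤ) : ε ^ z * ε ^ z = 1 := by rw [← mul_zpow, ← sq, hε, one_zpow]
  have hn : Even n := by
    obtain ⟨δ', hδ', he⟩ : ∃ δ' : G, δ' * τ δ' = 1 ∧ e * σ e = δ' * b := by
      rcases he with he | he
      · exact ⟨1, by rw [map_one, mul_one], by rw [he, one_mul]⟩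
      · exact ⟨ε, by rw [hτε, ← sq, hε], he⟩
    refine even_of_mul_map_eq_mul_sq (u := u * σ u) (w := 1) hcτ hε hno (map_one c) ?_
    have hN : u * σ u * c (u * σ u) = u * c u * σ (u * c u) := by
      rw [map_mul, hcσ, map_mul]
      ac_rfl
    rw [hN, h1, he]
    calc _ = (ε ^ p * ε ^ p) * ((b * τ b) ^ q * (b * τ b) ^ q) * (δ' * τ δ') ^ n * (b * τ b) ^ n := by
          simp only [map_mul, map_zpow, hτε, mul_zpow, sq]
          simp only [mul_comm, mul_left_comm, mul_assoc]
      _ = ε ^ n * 1 ^ 2 := by rw [hεz, hb', hεz, hδ', one_zpow, one_pow, one_mul, one_mul, one_mul,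
            mul_one]
  obtain ⟨k, rfl⟩ := hn
  have hE (x : G) : x ^ (k + k) = (x ^ k) ^ 2 := by rw [zpow_add, sq]
  have hεk : (ε ^ k) ^ 2 = 1 := by rw [sq, hεz]
  refine ⟨?_, ?_, k, rfl⟩
  · refine even_of_mul_map_eq_mul_sq (u := u) (w := b ^ q * b ^ k) hcσ hε hno
      (by rw [map_mul, map_zpow, map_zpow, hcb]) ?_
    rw [h1, hE, mul_assoc, mul_pow]
    rcases he with he | he <;> rw [he]
    rw [mul_zpow, mul_pow, hεk, one_mul]
  · refine even_of_mul_map_eq_mul_sq (u := u) (w := a ^ p * a ^ k) hcτ hε hno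
      (by rw [map_mul, map_zpow, map_zpow, hca]) ?_
    rw [h2, hE, mul_assoc, mul_pow]
    rcases he' with he' | he' <;> rw [he']
    rw [mul_zpow, mul_pow, hεk, one_mul]

theorem Subgroup.odd_index_of_sq_mem {H : Subgroup G} (h0 : H.index ≠ 0)
    (h : ∀ u : G, u ^ 2 ∈ H → u ∈ H) : Odd H.index := by
  rw [← Nat.not_even_iff_odd, even_iff_two_dvd]
  intro h2
  have : Finite (G ⧸ H) := Nat.finite_of_card_ne_zero h0
  obtain ⟨x, hx⟩ := exists_prime_orderOf_dvd_card' (G := G ⧸ H) 2 h2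
  obtain ⟨u, rfl⟩ := QuotientGroup.mk_surjective x
  have hu : u ^ 2 ∈ H := by
    rw [← QuotientGroup.eq_one_iff, QuotientGroup.mk_pow, ← hx, pow_orderOf_eq_one]
  rw [(QuotientGroup.eq_one_iff u).mpr (h u hu), orderOf_one] at hx
  omega

end CommGroup

namespace IsTriquadratic

variable {K : Type*} [Field K] [NumberField K] {m : ℕ} {r s i : K}

theorem exists_embedding (h : IsTriquadratic m r s i) :
    ∃ φ : K →+* ℂ, φ r = (Real.sqrt 2 : ℝ) ∧ φ s = (Real.sqrt m : ℝ) := by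
  obtain ⟨φ⟩ : Nonempty (K →+* ℂ) := inferInstance
  have key {t : K} {D : ℕ} (ht : t ^ 2 = (D : ℤ)) :
      ∃ a : ℤˣ, φ (((a : ℤ) : K) * t) = (Real.sqrt D : ℝ) := by
    have hsq : (φ t) ^ 2 = ((Real.sqrt D : ℝ) : ℂ) ^ 2 := by
      rw [← map_pow, ht, map_intCast, ← Complex.ofReal_pow, Real.sq_sqrt (Nat.cast_nonneg D)]
      simp
    rcases sq_eq_sq_iff_eq_or_eq_neg.mp hsq with h | h
    · exact ⟨1, by simp [h]⟩
    · exact ⟨-1, by simp [h]⟩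
  obtain ⟨a, ha⟩ := key (D := 2) h.sq_two
  obtain ⟨b, hb⟩ := key h.sq_m
  obtain ⟨g, hg1, hg2, -⟩ := h.exists_char_eq a b 1
  refine ⟨φ.comp (g : K →+* K), ?_, ?_⟩
  · have := h.apply_r g
    rw [hg1] at this
    simpa [this] using ha
  · have := h.apply_s g
    rw [hg2] at this
    simpa [this] using hb

theorem embedding_apply_conj (h : IsTriquadratic m r s i) {c : Gal(K/ℚ)} (h1 : h.charR c = 1)
    (h2 : h.charS c = 1) (h3 : h.charI c = -1) (φ : K →+* ℂ) (x : K) :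
    φ (c x) = starRingEnd ℂ (φ x) := by
  have hreal {t : K} {D : ℕ} (ht : t ^ 2 = (D : ℤ)) : starRingEnd ℂ (φ t) = φ t := by
    have hsq : (φ t) ^ 2 = ((Real.sqrt D : ℝ) : ℂ) ^ 2 := by
      rw [← map_pow, ht, map_intCast, ← Complex.ofReal_pow, Real.sq_sqrt (Nat.cast_nonneg D)]
      simp
    rcases sq_eq_sq_iff_eq_or_eq_neg.mp hsq with h | h <;> simp [h]
  have hi : starRingEnd ℂ (φ i) = -φ i := by
    have hsq : (φ i) ^ 2 = Complex.I ^ 2 := by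
      rw [← map_pow, h.sq_i, map_intCast, Complex.I_sq]
      norm_num
    rcases sq_eq_sq_iff_eq_or_eq_neg.mp hsq with h | h <;> simp [h]
  have heq : (φ.comp (c : K →+* K)).toRatAlgHom = ((starRingEnd ℂ).comp φ).toRatAlgHom := by
    refine h.ext_apply ?_ ?_ ?_
    · simp [h.apply_r c, h1, hreal (D := 2) h.sq_two]
    · simp [h.apply_s c, h2, hreal h.sq_m]
    · simp [h.apply_i c, h3, hi]
  exact DFunLike.congr_fun heq x

/-- The action of the Galois group on units. -/
noncomputable def _root_.unitMap (σ : Gal(K/ℚ)) : (𝓞 K)ˣ →* (𝓞 K)ˣ :=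
  Units.map (RingOfIntegers.mapRingHom (σ : K →+* K)).toMonoidHom

theorem _root_.coe_unitMap (σ : Gal(K/ℚ)) (u : (𝓞 K)ˣ) : (unitMap σ u : K) = σ (u : K) := rfl

theorem _root_.unitMap_comm {σ τ : Gal(K/ℚ)} (hc : σ * τ = τ * σ) (u : (𝓞 K)ˣ) :
    unitMap σ (unitMap τ u) = unitMap τ (unitMap σ u) := by
  ext
  exact DFunLike.congr_fun hc (u : K)

theorem _root_.mul_unitMap_eq {t : K} {D x y n : ℤ} {u : (𝓞 K)ˣ} (ht : t ^ 2 = D)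
    (hu : 2 * (u : K) = x + y * t) (hn : x ^ 2 - D * y ^ 2 = 4 * n) {σ : Gal(K/ℚ)}
    (hσ : σ t = -t) : (u : K) * σ (u : K) = n := by
  have h1 : 2 * σ (u : K) = x - y * t := by
    have := congrArg σ hu
    simp only [map_mul, map_add, map_ofNat, map_intCast, hσ] at this
    linear_combination this
  have hn' : (x : K) ^ 2 - D * y ^ 2 = 4 * n := by exact_mod_cast hn
  have h4 : (4 : K) ≠ 0 := by norm_num
  refine mul_left_cancel₀ h4 ?_
  linear_combination (2 * σ (u : K)) * hu + (x + y * t) * h1 - (y : K) ^ 2 * ht + hn'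

theorem _root_.unitMap_eq_self {t : K} {x y : ℤ} {u : (𝓞 K)ˣ}
    (hu : 2 * (u : K) = x + y * t) {σ : Gal(K/ℚ)} (hσ : σ t = t) : unitMap σ u = u := by
  ext
  change σ (u : K) = (u : K)
  have := congrArg σ hu
  simp only [map_mul, map_add, map_ofNat, map_intCast, hσ] at this
  refine mul_left_cancel₀ two_ne_zero (this.trans hu.symm)

theorem commute (h : IsTriquadratic m r s i) (σ τ : Gal(K/ℚ)) : σ * τ = τ * σ :=
  h.ext_char (by rw [map_mul, map_mul, mul_comm]) (by rw [map_mul, map_mul, mul_comm])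
    (by rw [map_mul, map_mul, mul_comm])

theorem mul_unitMap_ne_neg_one (h : IsTriquadratic m r s i) {c : Gal(K/ℚ)} (h1 : h.charR c = 1)
    (h2 : h.charS c = 1) (h3 : h.charI c = -1) (u : (𝓞 K)ˣ) : u * unitMap c u ≠ -1 := by
  intro hu
  obtain ⟨φ, -⟩ := h.exists_embedding
  have h4 : (u : K) * c (u : K) = -1 := congrArg (fun v : (𝓞 K)ˣ => (v : K)) hu |>.trans (by simp)
  have h5 := congrArg φ h4
  rw [map_mul, h.embedding_apply_conj h1 h2 h3, Complex.mul_conj, map_neg, map_one] at h5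
  have h6 : Complex.normSq (φ (u : K)) = -1 := by exact_mod_cast h5
  linarith [Complex.normSq_nonneg (φ (u : K))]

theorem mul_unitMap_torsion (h : IsTriquadratic m r s i) {c : Gal(K/ℚ)} (h1 : h.charR c = 1)
    (h2 : h.charS c = 1) (h3 : h.charI c = -1) {u : (𝓞 K)ˣ} (hu : u ∈ Units.torsion K) :
    u * unitMap c u = 1 := by
  obtain ⟨φ, -⟩ := h.exists_embedding
  ext
  apply φ.injective
  change φ ((u : K) * c (u : K)) = φ 1
  rw [map_mul, h.embedding_apply_conj h1 h2 h3, Complex.mul_conj,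
    Complex.normSq_eq_norm_sq]
  have hw := (Units.mem_torsion K).mp hu (InfinitePlace.mk φ)
  rw [InfinitePlace.apply] at hw
  simp [hw]

theorem card_infinitePlace (h : IsTriquadratic m r s i) :
    Fintype.card (InfinitePlace K) = 4 := by
  have := isTotallyComplex_of_sqrt h.sq_i (by norm_num)
  have hf := IsTotallyComplex.finrank K
  rw [h.discr_and_finrank.2] at hf
  rw [InfinitePlace.card_eq_nrRealPlaces_add_nrComplexPlaces,
    IsTotallyComplex.nrRealPlaces_eq_zero]
  omega

theorem rank_eq (h : IsTriquadratic m r s i) : Units.rank K = 3 := by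
  rw [Units.rank, h.card_infinitePlace]

/-- Units of the real quadratic subfields of `K` together with a square root of their product. -/
structure IsUnitSystem (h : IsTriquadratic m r s i) (a b d e : (𝓞 K)ˣ) (n n' : ℤ) : Prop where
  coe_a : ∃ x y : ℤ, 2 * (a : K) = x + y * r ∧ x ^ 2 - 2 * y ^ 2 = 4 * (-1)
  coe_b : ∃ x y : ℤ, 2 * (b : K) = x + y * s ∧ x ^ 2 - m * y ^ 2 = 4 * n
  coe_d : ∃ x y : ℤ, 2 * (d : K) = x + y * (r * s) ∧ x ^ 2 - 2 * m * y ^ 2 = 4 * n'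
  hn : n = 1 ∨ n = -1
  hn' : n' = 1 ∨ n' = -1
  sq_e : e ^ 2 = a * b * d
  mem_e : (e : K) ∈ ℚ⟮r, s⟯

theorem apply_eq_of_mem (h : IsTriquadratic m r s i) {c : Gal(K/ℚ)} (h1 : h.charR c = 1)
    (h2 : h.charS c = 1) {x : K} (hx : x ∈ ℚ⟮r, s⟯) : c x = x := by
  induction hx using adjoin_induction with
  | mem x hx =>
    rcases hx with rfl | rfl
    · simp [h.apply_r, h1]
    · simp [h.apply_s, h2]
  | algebraMap x => exact c.commutes x
  | add x y _ _ hx hy => rw [map_add, hx, hy]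
  | inv x _ hx => rw [map_inv₀, hx]
  | mul x y _ _ hx hy => rw [map_mul, hx, hy]

omit [NumberField K] in
theorem unit_eq_of_coe_eq {u : (𝓞 K)ˣ} {n : ℤ} (hn : n = 1 ∨ n = -1) (hu : (u : K) = n) :
    u = 1 ∧ n = 1 ∨ u = -1 ∧ n = -1 := by
  rcases hn with rfl | rfl
  · refine Or.inl ⟨?_, rfl⟩
    ext
    simpa using hu
  · refine Or.inr ⟨?_, rfl⟩
    ext
    simpa using hu

theorem IsUnitSystem.norms_and_odd_index {h : IsTriquadratic m r s i} {a b d e : (𝓞 K)ˣ} {n n' : ℤ}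
    (hs : IsUnitSystem h a b d e n n')
    (h0 : (Subgroup.closure (Set.range ![a, b, e]) ⊔ Units.torsion K).index ≠ 0) :
    n' = -1 ∧ Odd (Subgroup.closure (Set.range ![a, b, e]) ⊔ Units.torsion K).index := by
  obtain ⟨c, hc1, hc2, hc3⟩ := h.exists_char_eq 1 1 (-1)
  obtain ⟨σ, hσ1, hσ2, -⟩ := h.exists_char_eq (-1) 1 1
  obtain ⟨τ, hτ1, hτ2, -⟩ := h.exists_char_eq 1 (-1) 1
  obtain ⟨xa, ya, ha, hna⟩ := hs.coe_a
  obtain ⟨xb, yb, hb, hnb⟩ := hs.coe_b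
  obtain ⟨xd, yd, hd, hnd⟩ := hs.coe_d
  have hcr : c r = r := by simp [h.apply_r, hc1]
  have hcs : c s = s := by simp [h.apply_s, hc2]
  have hσr : σ r = -r := by simp [h.apply_r, hσ1]
  have hσs : σ s = s := by simp [h.apply_s, hσ2]
  have hτr : τ r = r := by simp [h.apply_r, hτ1]
  have hτs : τ s = -s := by simp [h.apply_s, hτ2]
  have hrs : (r * s) ^ 2 = ((2 * m : ℤ) : K) := by
    rw [mul_pow, h.sq_two, h.sq_m]
    push_cast
    ring
  have hca : unitMap c a = a := unitMap_eq_self ha hcr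
  have hcb : unitMap c b = b := unitMap_eq_self hb hcs
  have hce : unitMap c e = e := by
    ext
    exact h.apply_eq_of_mem hc1 hc2 hs.mem_e
  have hτa : unitMap τ a = a := unitMap_eq_self ha hτr
  have hσb : unitMap σ b = b := unitMap_eq_self hb hσs
  have hσa : a * unitMap σ a = -1 := by
    have := unit_eq_of_coe_eq (u := a * unitMap σ a) (n := -1) (Or.inr rfl)
      (mul_unitMap_eq h.sq_two ha hna hσr)
    simpa using this
  have hτb := unit_eq_of_coe_eq (u := b * unitMap τ b) hs.hn (mul_unitMap_eq h.sq_m hb hnb hτs)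
  have hσd := unit_eq_of_coe_eq (u := d * unitMap σ d) hs.hn'
    (mul_unitMap_eq hrs hd hnd (by rw [map_mul, hσr, hσs, neg_mul]))
  have hτd := unit_eq_of_coe_eq (u := d * unitMap τ d) hs.hn'
    (mul_unitMap_eq hrs hd hnd (by rw [map_mul, hτr, hτs, mul_neg]))
  have hne : (1 : (𝓞 K)ˣ) ≠ -1 := by
    intro h1
    have := congrArg (fun u : (𝓞 K)ˣ => (u : K)) h1
    simp only [Units.coe_one, Units.coe_neg_one] at this
    norm_num at this
  have hε : (-1 : (𝓞 K)ˣ) ^ 2 = 1 := neg_one_sq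
  have hno := h.mul_unitMap_ne_neg_one hc1 hc2 hc3
  have hroot (x : (𝓞 K)ˣ) (hx : x ^ 2 = 1) : x = 1 ∨ x = -1 := by
    have : (x : 𝓞 K) ^ 2 = 1 := by rw [← Units.val_pow_eq_pow_val, hx, Units.val_one]
    rcases sq_eq_sq_iff_eq_or_eq_neg.mp (this.trans (one_pow 2).symm) with h | h
    · exact Or.inl (Units.ext h)
    · exact Or.inr (Units.ext h)
  have hcσ := unitMap_comm (h.commute c σ)
  have hcτ := unitMap_comm (h.commute c τ)
  obtain ⟨hσd', hσe⟩ := mul_map_eq_of_sq_eq hcσ hε hno hroot hσa hσb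
    (hσd.imp And.left And.left) hs.sq_e hcb hce
  have hn' : n' = -1 := by
    rcases hσd with h1 | h1
    · exact absurd (h1.1.symm.trans hσd') hne
    · exact h1.2
  have hτd' : d * unitMap τ d = -1 := by
    rcases hτd with h1 | h1
    · exact absurd (h1.2.symm.trans hn') (by norm_num)
    · exact h1.1
  obtain ⟨hτb', hτe⟩ := mul_map_eq_of_sq_eq hcτ hε hno hroot hτd' hτa
    (hτb.imp And.left And.left) (show e ^ 2 = d * a * b by rw [hs.sq_e]; ac_rfl) hca hce
  refine ⟨hn', Subgroup.odd_index_of_sq_mem h0 fun u hu => ?_⟩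
  obtain ⟨g, hg, ζ, hζ, hgu⟩ := Subgroup.mem_sup.mp hu
  obtain ⟨f, rfl⟩ := Subgroup.exists_of_mem_closure_range _ _ hg
  have hmem (j : Fin 3) : ![a, b, e] j ∈ Subgroup.closure (Set.range ![a, b, e]) :=
    Subgroup.subset_closure (Set.mem_range_self j)
  have hma : a ∈ Subgroup.closure (Set.range ![a, b, e]) := hmem 0
  have hmb : b ∈ Subgroup.closure (Set.range ![a, b, e]) := hmem 1
  have hme : e ∈ Subgroup.closure (Set.range ![a, b, e]) := hmem 2
  have hu2 : u ^ 2 = ζ * (a ^ f 0 * b ^ f 1 * e ^ f 2) := by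
    rw [← hgu, Fin.prod_univ_three, mul_comm]
    rfl
  obtain ⟨⟨p, hp⟩, ⟨q, hq⟩, ⟨k, hk⟩⟩ := even_exponents_of_sq_eq hcσ hcτ hε (by ext; simp [unitMap])
    (by ext; simp [unitMap]) hno hroot hσa hτa hσb hτb' hca hcb hce
    (by simpa using hσe) (by simpa using hτe) (h.mul_unitMap_torsion hc1 hc2 hc3 hζ) hu2
  have hv : (u / (a ^ p * b ^ q * e ^ k)) ^ 2 ∈ Units.torsion K := by
    have : (u / (a ^ p * b ^ q * e ^ k)) ^ 2 = ζ := by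
      rw [div_pow, hu2, hp, hq, hk, div_eq_iff_eq_mul]
      simp only [zpow_add, sq]
      simp only [mul_comm, mul_left_comm, mul_assoc]
    rwa [this]
  have hv' : u / (a ^ p * b ^ q * e ^ k) ∈ Units.torsion K := by
    rw [Units.torsion, CommGroup.mem_torsion] at hv ⊢
    exact hv.of_pow two_ne_zero
  rw [← div_mul_cancel u (a ^ p * b ^ q * e ^ k)]
  exact mul_mem ((le_sup_right : Units.torsion K ≤ _) hv')
    ((le_sup_left : Subgroup.closure (Set.range ![a, b, e]) ≤ _)
      (mul_mem (mul_mem (zpow_mem hma p) (zpow_mem hmb q)) (zpow_mem hme k)))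

end IsTriquadratic

namespace IsTriquadratic

variable {K : Type*} [Field K] [NumberField K] {m : ℕ} {r s i : K}

omit [NumberField K] in
theorem log_norm_apply_of_mul_eq {φ : K →+* ℂ} {u v : (𝓞 K)ˣ} {n : ℤ} (hn : n = 1 ∨ n = -1)
    (h : (u : K) * (v : K) = n) : Real.log ‖φ (v : K)‖ = -Real.log ‖φ (u : K)‖ := by
  have h1 : ‖φ (u : K)‖ * ‖φ (v : K)‖ = 1 := by
    rw [← norm_mul, ← map_mul, h, map_intCast]
    rcases hn with rfl | rfl <;> simp
  rw [eq_neg_iff_add_eq_zero, add_comm, ← Real.log_mul (left_ne_zero_of_mul_eq_one h1)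
    (right_ne_zero_of_mul_eq_one h1), h1, Real.log_one]

theorem mk_comp_injective (h : IsTriquadratic m r s i) {φ : K →+* ℂ} (hr : φ r = (Real.sqrt 2 : ℝ))
    (hs : φ s = (Real.sqrt m : ℝ)) {g g' : Gal(K/ℚ)}
    (heq : InfinitePlace.mk (φ.comp (g : K →+* K)) = InfinitePlace.mk (φ.comp (g' : K →+* K))) :
    h.charR g = h.charR g' ∧ h.charS g = h.charS g' := by
  have hreal (f : Gal(K/ℚ)) : starRingEnd ℂ (φ (f r)) = φ (f r) ∧
      starRingEnd ℂ (φ (f s)) = φ (f s) := by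
    simp [h.apply_r, h.apply_s, hr, hs]
  have key : φ (g r) = φ (g' r) ∧ φ (g s) = φ (g' s) := by
    rcases InfinitePlace.mk_eq_iff.mp heq with h1 | h1
    · exact ⟨DFunLike.congr_fun h1 r, DFunLike.congr_fun h1 s⟩
    · exact ⟨(hreal g).1.symm.trans (DFunLike.congr_fun h1 r),
        (hreal g).2.symm.trans (DFunLike.congr_fun h1 s)⟩
  have h1 := φ.injective key.1
  have h2 := φ.injective key.2
  rw [h.apply_r g, h.apply_r g'] at h1
  rw [h.apply_s g, h.apply_s g'] at h2
  exact ⟨Units.ext (by exact_mod_cast mul_right_cancel₀ h.r_ne_zero h1),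
    Units.ext (by exact_mod_cast mul_right_cancel₀ h.s_ne_zero h2)⟩

theorem exists_equiv_infinitePlace (h : IsTriquadratic m r s i) {φ : K →+* ℂ}
    (hr : φ r = (Real.sqrt 2 : ℝ)) (hs : φ s = (Real.sqrt m : ℝ)) {g : Fin 4 → Gal(K/ℚ)}
    (hg : ∀ j, (h.charR (g j), h.charS (g j)) = (![(1, 1), (-1, 1), (1, -1), (-1, -1)] : _ → _) j) :
    ∃ E : Fin 4 ≃ InfinitePlace K, ∀ j, E j = InfinitePlace.mk (φ.comp (g j : K →+* K)) := by
  have hinj : Function.Injective fun j => InfinitePlace.mk (φ.comp (g j : K →+* K)) := by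
    intro j j' hjj
    obtain ⟨h1, h2⟩ := h.mk_comp_injective hr hs hjj
    have h3 := (hg j).symm.trans ((Prod.ext h1 h2).trans (hg j'))
    clear hjj h1 h2
    revert j j'
    decide
  exact ⟨Equiv.ofBijective _ ((Fintype.bijective_iff_injective_and_card _).mpr
    ⟨hinj, by rw [h.card_infinitePlace, Fintype.card_fin]⟩), fun j => rfl⟩

theorem IsUnitSystem.regulator_mul_index {h : IsTriquadratic m r s i} {a b d e : (𝓞 K)ˣ} {n n' : ℤ}
    (hS : IsUnitSystem h a b d e n n') {φ : K →+* ℂ} (hr : φ r = (Real.sqrt 2 : ℝ))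
    (hs : φ s = (Real.sqrt m : ℝ)) :
    |16 * (Real.log ‖φ (a : K)‖ * Real.log ‖φ (b : K)‖ * Real.log ‖φ (d : K)‖)| =
      (Subgroup.closure (Set.range ![a, b, e]) ⊔ Units.torsion K).index * Units.regulator K := by
  classical
  obtain ⟨σ, hσ1, hσ2, -⟩ := h.exists_char_eq (-1) 1 1
  obtain ⟨τ, hτ1, hτ2, -⟩ := h.exists_char_eq 1 (-1) 1
  obtain ⟨ρ, hρ1, hρ2, -⟩ := h.exists_char_eq (-1) (-1) 1
  obtain ⟨xa, ya, ha, hna⟩ := hS.coe_a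
  obtain ⟨xb, yb, hb, hnb⟩ := hS.coe_b
  obtain ⟨xd, yd, hd, hnd⟩ := hS.coe_d
  have hrs : (r * s) ^ 2 = ((2 * m : ℤ) : K) := by
    rw [mul_pow, h.sq_two, h.sq_m]
    push_cast
    ring
  have hσr : σ r = -r := by simp [h.apply_r, hσ1]
  have hσs : σ s = s := by simp [h.apply_s, hσ2]
  have hτr : τ r = r := by simp [h.apply_r, hτ1]
  have hτs : τ s = -s := by simp [h.apply_s, hτ2]
  have hρr : ρ r = -r := by simp [h.apply_r, hρ1]
  have hρs : ρ s = -s := by simp [h.apply_s, hρ2]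
  have hσrs : σ (r * s) = -(r * s) := by rw [map_mul, hσr, hσs, neg_mul]
  have hτrs : τ (r * s) = -(r * s) := by rw [map_mul, hτr, hτs, mul_neg]
  have hρrs : ρ (r * s) = r * s := by rw [map_mul, hρr, hρs, neg_mul_neg]
  have hneg {t : K} {D x y k : ℤ} {u : (𝓞 K)ˣ} (hk : k = 1 ∨ k = -1) (ht : t ^ 2 = D)
      (hu : 2 * (u : K) = x + y * t) (hn : x ^ 2 - D * y ^ 2 = 4 * k) {g : Gal(K/ℚ)}
      (hg : g t = -t) : Real.log ‖φ (g (u : K))‖ = -Real.log ‖φ (u : K)‖ :=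
    log_norm_apply_of_mul_eq (v := unitMap g u) hk (mul_unitMap_eq ht hu hn hg)
  have hpos {t : K} {x y : ℤ} {u : (𝓞 K)ˣ} (hu : 2 * (u : K) = x + y * t) {g : Gal(K/ℚ)}
      (hg : g t = t) : Real.log ‖φ (g (u : K))‖ = Real.log ‖φ (u : K)‖ := by
    rw [← coe_unitMap, unitMap_eq_self hu hg]
  have he (g : Gal(K/ℚ)) : 2 * Real.log ‖φ (g (e : K))‖ = Real.log ‖φ (g (a : K))‖ +
      Real.log ‖φ (g (b : K))‖ + Real.log ‖φ (g (d : K))‖ := by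
    have hne (u : (𝓞 K)ˣ) : ‖φ (g (u : K))‖ ≠ 0 := by simp
    have := congrArg (fun u : (𝓞 K)ˣ => ‖φ (g (u : K))‖) hS.sq_e
    simp only [Units.coe_pow, Units.coe_mul, map_mul, map_pow, norm_mul, norm_pow] at this
    rw [← Real.log_mul (hne a) (hne b), ← Real.log_mul (mul_ne_zero (hne a) (hne b)) (hne d),
      ← this, Real.log_pow]
    norm_num
  obtain ⟨E, hE⟩ := h.exists_equiv_infinitePlace hr hs (g := ![1, σ, τ, ρ]) (by
    intro j
    fin_cases j <;> simp [hσ1, hσ2, hτ1, hτ2, hρ1, hρ2])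
  have hmult (w : InfinitePlace K) : (w.mult : ℝ) = 2 := by
    have := isTotallyComplex_of_sqrt h.sq_i (by norm_num)
    have hw := InfinitePlace.not_isReal_iff_isComplex.mpr (IsTotallyComplex.isComplex w)
    simp [InfinitePlace.mult, hw]
  let G : Fin 3 ≃ {w : InfinitePlace K // w ≠ E 0} :=
    (finSuccAboveEquiv (0 : Fin 4)).trans (E.subtypeEquiv fun j => by simp)
  have hG (j : Fin 3) : ((G j : {w // w ≠ E 0}) : InfinitePlace K) = E j.succ := rfl
  have hreg := Units.regOfFamily_eq_det
    (fun j : Fin (Units.rank K) => ![a, b, e] (finCongr h.rank_eq j)) (E 0)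
    (G.symm.trans (finCongr h.rank_eq.symm))
  have hrange : Set.range (fun j : Fin (Units.rank K) => ![a, b, e] (finCongr h.rank_eq j)) =
      Set.range ![a, b, e] := (finCongr h.rank_eq).surjective.range_comp _
  rw [← hrange, ← Units.regOfFamily_div_regulator, div_mul_cancel₀ _ (Units.regulator_ne_zero K),
    hreg, ← Matrix.det_submatrix_equiv_self G, Matrix.det_fin_three]
  congr 1
  simp only [Matrix.submatrix_apply, Matrix.of_apply, hG, hE, hmult, Equiv.trans_apply,
    Equiv.symm_apply_apply]
  have hW (g : Gal(K/ℚ)) (x : K) : InfinitePlace.mk (φ.comp (g : K →+* K)) x = ‖φ (g x)‖ := rfl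
  have hneg1 : (-1 : ℤ) = 1 ∨ (-1 : ℤ) = -1 := Or.inr rfl
  simp only [finCongr_apply, Fin.cast_cast, Fin.cast_eq_self, Fin.succ_zero_eq_one,
    Fin.succ_one_eq_two, show Fin.succ (2 : Fin 3) = 3 from rfl, Matrix.cons_val, hW, he]
  rw [hneg hneg1 h.sq_two ha hna hσr, hpos ha hτr, hneg hneg1 h.sq_two ha hna hρr,
    hpos hb hσs, hneg hS.hn h.sq_m hb hnb hτs, hneg hS.hn h.sq_m hb hnb hρs,
    hneg hS.hn' hrs hd hnd hσrs, hneg hS.hn' hrs hd hnd hτrs, hpos hd hρrs]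
  ring

end IsTriquadratic

section Quadratic

variable {k : Type*} [Field k] [NumberField k] {d : ℤ} {r : k}

theorem exists_unit_norm_eq_neg_one (hd : Squarefree d) (hd1 : d ≠ 1) (hr : r ^ 2 = d)
    (h2 : Module.finrank ℚ k = 2) {x y : ℤ} (hxy : x ^ 2 - d * y ^ 2 = -4) :
    ∃ u : (𝓞 k)ˣ, Algebra.norm ℤ (u : 𝓞 k) = -1 := by
  obtain ⟨u, hu⟩ := exists_unit_of_pell hr (Or.inr hxy)
  refine ⟨u, ?_⟩
  have hu' : (u : k) = ((x / 2 : ℚ) : k) + ((y / 2 : ℚ) : k) * r := by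
    push_cast
    linear_combination hu / 2
  have hnorm := norm_coords hd hd1 hr h2 (x / 2) (y / 2)
  rw [← hu', ← Algebra.coe_norm_int] at hnorm
  have hxy' : (x : ℚ) ^ 2 - d * y ^ 2 = -4 := by exact_mod_cast hxy
  have : ((Algebra.norm ℤ (u : 𝓞 k) : ℤ) : ℚ) = ((-1 : ℤ) : ℚ) := by
    rw [hnorm]
    push_cast
    linear_combination hxy' / 4
  exact_mod_cast this

theorem norm_nonneg_of_neg (hd : Squarefree d) (hneg : d < 0) (hr : r ^ 2 = d)
    (h2 : Module.finrank ℚ k = 2) (x : 𝓞 k) : 0 ≤ Algebra.norm ℤ x := by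
  obtain ⟨t, y, -, hn⟩ := exists_int_coords hd (by omega) hr h2 x
  nlinarith [sq_nonneg t, sq_nonneg y]

end Quadratic

namespace IsTriquadratic

variable {K : Type*} [Field K] [NumberField K] {m : ℕ} {r s i : K}

theorem gen_sq (h : IsTriquadratic m r s i) (j : Fin 7) :
    AdjoinSimple.gen ℚ (roots r s i j) ^ 2 = ((radicands m j : ℤ) : ℚ⟮roots r s i j⟯) := by
  apply (algebraMap ℚ⟮roots r s i j⟯ K).injective
  simpa using h.roots_sq j

theorem discr_adjoin_roots (h : IsTriquadratic m r s i) (j : Fin 7) :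
    discr ℚ⟮roots r s i j⟯ = (![8, m, 8 * m, -4, -8, -(4 * m), -(8 * m)] : Fin 7 → ℤ) j := by
  have hmod := h.mod_four
  obtain ⟨hsf, hne⟩ := h.squarefree_radicands j
  have hself := discr_eq_self hsf hne (h.gen_sq j) (h.finrank_adjoin_roots j)
  have hfour := discr_eq_four_mul hsf (h.gen_sq j) (h.finrank_adjoin_roots j)
  generalize discr ℚ⟮roots r s i j⟯ = D at *
  fin_cases j <;> simp only [radicands] at * <;> simp at * <;> omega

theorem prod_sqrt_discr (h : IsTriquadratic m r s i) :
    ∏ j, Real.sqrt |discr ℚ⟮roots r s i j⟯| = Real.sqrt |discr K| := by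
  rw [← Real.sqrt_prod _ fun j _ => by positivity]
  congr 1
  have h1 : ((discr K).natAbs : ℝ) = |(discr K : ℝ)| := by
    rw [Nat.cast_natAbs, Int.cast_abs]
  rw [Fin.prod_univ_seven]
  simp only [h.discr_adjoin_roots]
  rw [← h1, h.discr_and_finrank.1]
  simp [abs_mul]
  ring

theorem classNumber_mul_prod_torsionOrder (h : IsTriquadratic m r s i) {ε₂ εm εd : ℝ}
    (hε₂ : IsFundUnit 2 ε₂) (hεm : IsFundUnit m εm) (hεd : IsFundUnit (2 * m) εd) {J : ℕ}
    (hJ : 16 * (Real.log ε₂ * Real.log εm * Real.log εd) = J * Units.regulator K) :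
    classNumber K * ∏ j, Units.torsionOrder ℚ⟮roots r s i j⟯ =
      4 * J * (∏ j, classNumber ℚ⟮roots r s i j⟯) * Units.torsionOrder K := by
  have h1 := h.one_lt
  have hK := residue_mul (L := K)
  have htc := isTotallyComplex_of_sqrt h.sq_i (by norm_num)
  have hplaces := h.card_infinitePlace
  rw [InfinitePlace.card_eq_nrRealPlaces_add_nrComplexPlaces,
    IsTotallyComplex.nrRealPlaces_eq_zero, zero_add] at hplaces
  rw [IsTotallyComplex.nrRealPlaces_eq_zero, hplaces, pow_zero, one_mul, h.residue_eq_prod,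
    ← h.prod_sqrt_discr] at hK
  have hreal {D : ℕ} {ε : ℝ} (j : Fin 7) (hD : radicands m j = D) (hD1 : 1 < D)
      (hε : IsFundUnit D ε) := residue_real_quadratic (hD ▸ (h.squarefree_radicands j).1) hD1
    (by rw [h.gen_sq j, hD]) (h.finrank_adjoin_roots j) hε
  have himag (j : Fin 7) (hneg : radicands m j < 0) :=
    residue_imaginary_quadratic (h.gen_sq j) (h.finrank_adjoin_roots j) hneg
  have e0 := hreal 0 rfl one_lt_two hε₂
  have e1 := hreal 1 rfl h1 hεm
  have e2 := hreal 2 (by simp [radicands]) (by omega) hεd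
  have e3 := himag 3 (by simp [radicands])
  have e4 := himag 4 (by simp [radicands])
  have e5 := himag 5 (by simp [radicands]; omega)
  have e6 := himag 6 (by simp [radicands]; omega)
  have hprod : ∏ j, (dedekindZeta_residue ℚ⟮roots r s i j⟯ *
      (Units.torsionOrder ℚ⟮roots r s i j⟯ * Real.sqrt |discr ℚ⟮roots r s i j⟯|)) =
      64 * (Real.log ε₂ * Real.log εm * Real.log εd) * (2 * Real.pi) ^ 4 *
        ∏ j, (classNumber ℚ⟮roots r s i j⟯ : ℝ) := by
    rw [Fin.prod_univ_seven, Fin.prod_univ_seven, e0, e1, e2, e3, e4, e5, e6]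
    ring
  simp only [Finset.prod_mul_distrib] at hprod
  have hpi : (2 * Real.pi) ^ 4 ≠ 0 := by positivity
  have hR := Units.regulator_ne_zero K
  have : (classNumber K * ∏ j, (Units.torsionOrder ℚ⟮roots r s i j⟯ : ℝ) : ℝ) =
      4 * J * (∏ j, (classNumber ℚ⟮roots r s i j⟯ : ℝ)) * Units.torsionOrder K := by
    refine mul_left_cancel₀ (mul_ne_zero hpi hR) ?_
    linear_combination (-∏ j, (Units.torsionOrder ℚ⟮roots r s i j⟯ : ℝ)) * hK +
      (Units.torsionOrder K : ℝ) * hprod + 4 * (2 * Real.pi) ^ 4 *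
        (∏ j, (classNumber ℚ⟮roots r s i j⟯ : ℝ)) * Units.torsionOrder K * hJ
  exact_mod_cast this

theorem factorization_two_classNumber {p₁ p₂ : ℕ} (h : IsTriquadratic (p₁ * p₂) r s i)
    (hp₁ : p₁.Prime) (hp₂ : p₂.Prime) (hne : p₁ ≠ p₂) (hm₁ : p₁ % 8 = 5) (hm₂ : p₂ % 8 = 5)
    {ε₂ εm εd : ℝ} (hε₂ : IsFundUnit 2 ε₂) (hεm : IsFundUnit (p₁ * p₂) εm)
    (hεd : IsFundUnit (2 * p₁ * p₂) εd) {a b d e : (𝓞 K)ˣ} {n n' : ℤ}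
    (hS : IsUnitSystem h a b d e n n') {φ : K →+* ℂ} (hr : φ r = (Real.sqrt 2 : ℝ))
    (hs : φ s = (Real.sqrt (p₁ * p₂ : ℕ) : ℝ)) (ha : φ (a : K) = ε₂) (hb : φ (b : K) = εm)
    (hd : φ (d : K) = εd) :
    (classNumber K).factorization 2 =
      1 + (classNumber ℚ⟮s⟯).factorization 2 + (classNumber ℚ⟮i * s⟯).factorization 2 := by
  have hlog : 0 < Real.log ε₂ * Real.log εm * Real.log εd :=
    mul_pos (mul_pos (Real.log_pos hε₂.1) (Real.log_pos hεm.1)) (Real.log_pos hεd.1)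
  have hnorm {ε : ℝ} {D : ℕ} (hε : IsFundUnit D ε) : |ε| = ε :=
    abs_of_pos (one_pos.trans hε.1)
  have hJ := hS.regulator_mul_index hr hs
  rw [ha, hb, hd, Complex.norm_real, Complex.norm_real, Complex.norm_real, Real.norm_eq_abs,
    Real.norm_eq_abs, Real.norm_eq_abs, hnorm hε₂, hnorm hεm, hnorm hεd,
    abs_of_pos (by positivity)] at hJ
  have hJ0 : (Subgroup.closure (Set.range ![a, b, e]) ⊔ Units.torsion K).index ≠ 0 := by
    intro h0
    rw [h0, Nat.cast_zero, zero_mul] at hJ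
    linarith
  obtain ⟨hn', hodd⟩ := hS.norms_and_odd_index hJ0
  have hrel := h.classNumber_mul_prod_torsionOrder hε₂ hεm (by rwa [← mul_assoc]) hJ
  generalize (Subgroup.closure (Set.range ![a, b, e]) ⊔ Units.torsion K).index = J at *
  have hw (j : Fin 7) (hj : radicands (p₁ * p₂) j ≠ -1) :=
    factorization_two_torsionOrder_quadratic (h.squarefree_radicands j).1
      (h.squarefree_radicands j).2 hj (h.gen_sq j) (h.finrank_adjoin_roots j)
  have h1 := h.one_lt
  have w0 := hw 0 (by simp [radicands])
  have w1 := hw 1 (by simp only [radicands]; simp; omega)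
  have w2 := hw 2 (by simp only [radicands]; simp; omega)
  have w3 := factorization_two_torsionOrder_sqrt_neg_one (h.gen_sq 3) (h.finrank_adjoin_roots 3)
  have w4 := hw 4 (by simp [radicands])
  have w5 := hw 5 (by simp only [radicands]; simp; omega)
  have w6 := hw 6 (by simp only [radicands]; simp; omega)
  have c0 : classNumber ℚ⟮roots r s i 0⟯ = 1 :=
    classNumber_eq_one_of_real (h.squarefree_radicands 0).1 (h.squarefree_radicands 0).2
      (h.gen_sq 0) (h.finrank_adjoin_roots 0) (by simp [radicands])
      (by rw [h.discr_adjoin_roots]; simp)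
  have c3 : classNumber ℚ⟮roots r s i 3⟯ = 1 :=
    classNumber_eq_one_of_imaginary (h.gen_sq 3) (h.finrank_adjoin_roots 3) (by simp [radicands])
      (by rw [h.discr_adjoin_roots]; simp)
  have c4 : classNumber ℚ⟮roots r s i 4⟯ = 1 :=
    classNumber_eq_one_of_imaginary (h.gen_sq 4) (h.finrank_adjoin_roots 4) (by simp [radicands])
      (by rw [h.discr_adjoin_roots]; simp)
  have hgenus {δ : ℤ} (j : Fin 7) (hδ : δ = 1 ∨ δ = -1)
      (hj : radicands (p₁ * p₂) j = δ * (2 * p₁ * p₂))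
      (hu : (∃ u : (𝓞 ℚ⟮roots r s i j⟯)ˣ, Algebra.norm ℤ (u : 𝓞 ℚ⟮roots r s i j⟯) = -1) ∨
        ∀ x : 𝓞 ℚ⟮roots r s i j⟯, 0 ≤ Algebra.norm ℤ x) :
      (classNumber ℚ⟮roots r s i j⟯).factorization 2 = 2 := by
    have hgen := h.gen_sq j
    have hr_int : IsIntegral ℤ (AdjoinSimple.gen ℚ (roots r s i j)) :=
      IsIntegral.of_pow (n := 2) (by norm_num) (hgen ▸ isIntegral_algebraMap (R := ℤ))
    obtain ⟨ω, hω⟩ : ∃ ω : 𝓞 ℚ⟮roots r s i j⟯,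
        (ω : ℚ⟮roots r s i j⟯) = AdjoinSimple.gen ℚ (roots r s i j) := ⟨⟨_, hr_int⟩, rfl⟩
    refine _root_.factorization_two_classNumber (r := ω) hp₁ hp₂ hne hm₁ hm₂ hδ
      (hj ▸ (h.squarefree_radicands j).1) ?_ (h.finrank_adjoin_roots j) hu
    apply RingOfIntegers.coe_injective
    rw [map_pow, map_intCast, ← RingOfIntegers.coe_eq_algebraMap, hω, hgen, hj]
  obtain ⟨x, y, -, hxy⟩ := hS.coe_d
  have c2 := hgenus (δ := 1) 2 (Or.inl rfl) (by simp [radicands]; ring)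
    (Or.inl (exists_unit_norm_eq_neg_one (h.squarefree_radicands 2).1
      (h.squarefree_radicands 2).2 (h.gen_sq 2) (h.finrank_adjoin_roots 2) (x := x) (y := y)
      (by rw [hn'] at hxy; simpa [radicands] using hxy)))
  have c6 := hgenus (δ := -1) 6 (Or.inr rfl) (by simp [radicands]; ring)
    (Or.inr (norm_nonneg_of_neg (h.squarefree_radicands 6).1
      (by simp only [radicands]; simp; omega) (h.gen_sq 6) (h.finrank_adjoin_roots 6)))
  have hJ2 : J.factorization 2 = 0 :=
    Nat.factorization_eq_zero_of_not_dvd hodd.not_two_dvd_nat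
  have hJ0' : J ≠ 0 := hJ0
  have hc0 {k : Type _} [Field k] [NumberField k] : classNumber k ≠ 0 := classNumber_ne_zero k
  have ht0 {k : Type _} [Field k] [NumberField k] : Units.torsionOrder k ≠ 0 :=
    Units.torsionOrder_ne_zero k
  have hf := congrArg (fun N : ℕ => N.factorization 2) hrel
  have hfour : (4 : ℕ).factorization 2 = 2 := factorization_two_eq (by norm_num) (by norm_num)
  rw [Nat.factorization_mul hc0 (Finset.prod_ne_zero_iff.mpr fun _ _ => ht0),
    Nat.factorization_mul (mul_ne_zero (mul_ne_zero four_ne_zero hJ0')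
      (Finset.prod_ne_zero_iff.mpr fun _ _ => hc0)) ht0,
    Nat.factorization_mul (mul_ne_zero four_ne_zero hJ0')
      (Finset.prod_ne_zero_iff.mpr fun _ _ => hc0), Nat.factorization_mul four_ne_zero hJ0',
    Nat.factorization_prod fun _ _ => ht0, Nat.factorization_prod fun _ _ => hc0] at hf
  simp only [Finsupp.add_apply, Fin.sum_univ_seven, w0, w1, w2, w3, w4,
    w5, w6, c0, c3, c4, c2, c6, hJ2, hfour, h.factorization_two_torsionOrder,
    Nat.factorization_one, Finsupp.zero_apply] at hf
  change (classNumber K).factorization 2 = 1 + (classNumber ℚ⟮roots r s i 1⟯).factorization 2 +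
    (classNumber ℚ⟮roots r s i 5⟯).factorization 2
  omega

end IsTriquadratic

theorem card_sylow_two_classGroup {k : Type*} [Field k] [NumberField k]
    (P : Sylow 2 (ClassGroup (𝓞 k))) : Nat.card P = 2 ^ (classNumber k).factorization 2 := by
  rw [Sylow.card_eq_multiplicity, Nat.card_eq_fintype_card, classNumber]

theorem classNumber_congr {k l : Type*} [Field k] [NumberField k] [Field l] [NumberField l]
    (f : k ≃+* l) : classNumber k = classNumber l :=
  Fintype.card_congr (ClassGroup.mulEquiv (RingOfIntegers.mapRingEquiv f)).toEquiv

theorem adjoin_eq_top_of_eq {K : IntermediateField ℚ ℂ} {S : Set K}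
    (h : K = adjoin ℚ ((fun x : K => (x : ℂ)) '' S)) :
    @adjoin ℚ _ K _ DivisionRing.toRatAlgebra S = ⊤ := by
  let f : K →ₐ[ℚ] ℂ := (algebraMap K ℂ).toRatAlgHom
  apply IntermediateField.map_injective f
  rw [adjoin_map, ← AlgHom.fieldRange_eq_map]
  refine h.symm.trans (SetLike.ext fun x => ?_)
  exact ⟨fun hx => ⟨⟨x, hx⟩, rfl⟩, fun ⟨y, hy⟩ => hy ▸ y.2⟩

theorem classNumber_adjoin_of_eq {k : Type*} [Field k] [NumberField k] (φ : k →+* ℂ)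
    {F : IntermediateField ℚ ℂ} [NumberField F] {s : k} (hF : F = ℚ⟮φ s⟯) :
    classNumber F = classNumber ℚ⟮s⟯ := by
  have hmap : ℚ⟮s⟯.map φ.toRatAlgHom = F := by
    rw [adjoin_map, Set.image_singleton, hF]
    rfl
  exact (classNumber_congr ((equivMap ℚ⟮s⟯ φ.toRatAlgHom).trans
    (equivOfEq hmap)).toRingEquiv).symm

theorem exists_mem_adjoin_pair {k : Type*} [Field k] [NumberField k] {φ : k →+* ℂ} {r s : k}
    {x y t : ℝ} (hr : φ r = x) (hs : φ s = y) (ht : t ∈ ℚ⟮x, y⟯) :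
    ∃ z ∈ ℚ⟮r, s⟯, φ z = t := by
  have h1 : Complex.ofRealHom.toRatAlgHom t ∈ ℚ⟮x, y⟯.map Complex.ofRealHom.toRatAlgHom :=
    ⟨t, ht, rfl⟩
  have h2 : ℚ⟮x, y⟯.map Complex.ofRealHom.toRatAlgHom = ℚ⟮r, s⟯.map φ.toRatAlgHom := by
    rw [adjoin_map, adjoin_map, Set.image_pair, Set.image_pair]
    exact congrArg₂ (fun u v : ℂ => ℚ⟮u, v⟯) hr.symm hs.symm
  rw [h2] at h1
  obtain ⟨z, hz, hzt⟩ := h1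
  exact ⟨z, hz, hzt⟩

theorem IsFundUnit.exists_norm_neg_one {ε : ℝ} (h : IsFundUnit 2 ε) :
    ∃ x y : ℤ, ε = ((x : ℝ) + (y : ℝ) * Real.sqrt (2 : ℕ)) / 2 ∧ x ^ 2 - 2 * y ^ 2 = 4 * (-1) := by
  obtain ⟨h1, ⟨x, y, hε, hn | hn⟩, hmin⟩ := h
  · exfalso
    have hs := Real.sq_sqrt (Nat.cast_nonneg (α := ℝ) 2)
    have hs0 := Real.sqrt_nonneg (2 : ℕ)
    have hs1 : Real.sqrt (2 : ℕ) < 3 / 2 := by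
      rw [Real.sqrt_lt' (by norm_num)]
      norm_num
    have hs2 : 1 < Real.sqrt (2 : ℕ) := by
      rw [Real.lt_sqrt (by norm_num)]
      norm_num
    have hle := hmin 2 2 (Or.inr (by norm_num)) (by push_cast at *; linarith)
    have hn' : (x : ℝ) ^ 2 - (2 : ℕ) * y ^ 2 = 4 := by exact_mod_cast hn
    have hmul : ε ^ 2 - x * ε + 1 = 0 := by
      rw [hε]
      linear_combination (y : ℝ) ^ 2 / 4 * hs - hn' / 4
    push_cast at hle
    have h2 : (2 : ℝ) < x := by nlinarith [sq_nonneg (ε - 1), sq_pos_of_pos (sub_pos.mpr h1)]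
    have h3 : (x : ℝ) < 3 := by nlinarith
    have h2' : (2 : ℤ) < x := by exact_mod_cast h2
    have h3' : x < (3 : ℤ) := by exact_mod_cast h3
    omega
  · exact ⟨x, y, hε, by simpa using hn⟩

theorem exists_unit_of_eq {k : Type*} [Field k] [NumberField k] {D : ℕ} {t : k} {φ : k →+* ℂ}
    (ht : t ^ 2 = (D : ℤ)) (hφ : φ t = (Real.sqrt D : ℝ)) {ε : ℝ} {x y n : ℤ}
    (hε : ε = ((x : ℝ) + (y : ℝ) * Real.sqrt D) / 2) (hn : n = 1 ∨ n = -1)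
    (hxy : x ^ 2 - (D : ℤ) * y ^ 2 = 4 * n) :
    ∃ u : (𝓞 k)ˣ, 2 * (u : k) = x + y * t ∧ φ (u : k) = ε := by
  obtain ⟨u, hu⟩ := exists_unit_of_pell ht (x := x) (y := y)
    (by rcases hn with rfl | rfl <;> simp [hxy])
  refine ⟨u, hu, mul_left_cancel₀ two_ne_zero ?_⟩
  have := congrArg φ hu
  simp only [map_mul, map_add, map_ofNat, map_intCast, hφ] at this
  rw [this, hε]
  push_cast
  ring

theorem IsFundUnit.exists_unit {k : Type*} [Field k] [NumberField k] {D : ℕ} {t : k} {φ : k →+* ℂ}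
    (ht : t ^ 2 = (D : ℤ)) (hφ : φ t = (Real.sqrt D : ℝ)) {ε : ℝ} (h : IsFundUnit D ε) :
    ∃ (u : (𝓞 k)ˣ) (n : ℤ), (n = 1 ∨ n = -1) ∧ φ (u : k) = ε ∧
      ∃ x y : ℤ, 2 * (u : k) = x + y * t ∧ x ^ 2 - (D : ℤ) * y ^ 2 = 4 * n := by
  obtain ⟨-, ⟨x, y, hε, hn⟩, -⟩ := h
  obtain ⟨n, hn, hxy⟩ : ∃ n : ℤ, (n = 1 ∨ n = -1) ∧ x ^ 2 - (D : ℤ) * y ^ 2 = 4 * n := by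
    rcases hn with hn | hn
    · exact ⟨1, Or.inl rfl, by simp [hn]⟩
    · exact ⟨-1, Or.inr rfl, by simp [hn]⟩
  obtain ⟨u, hu, hφu⟩ := exists_unit_of_eq ht hφ hε hn hxy
  exact ⟨u, n, hn, hφu, x, y, hu, hxy⟩

theorem exists_unit_sq_eq {k : Type*} [Field k] {x : k} {u : (𝓞 k)ˣ} (h : x ^ 2 = (u : k)) :
    ∃ e : (𝓞 k)ˣ, (e : k) = x ∧ e ^ 2 = u := by
  obtain ⟨y, hy⟩ : ∃ y : 𝓞 k, (y : k) = x :=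
    ⟨⟨x, IsIntegral.of_pow (n := 2) (by norm_num) (h ▸ (u : 𝓞 k).isIntegral_coe)⟩, rfl⟩
  have hyu : y ^ 2 = u := by
    apply RingOfIntegers.coe_injective
    rw [map_pow, ← RingOfIntegers.coe_eq_algebraMap, hy, h]
  obtain ⟨e, he⟩ := (isUnit_pow_iff two_ne_zero).mp (hyu ▸ u.isUnit)
  exact ⟨e, he ▸ hy, Units.ext (by rw [Units.val_pow_eq_pow_val, he, hyu])⟩

/-- If `x² - p₁p₂·y² = -1` is solvable in integers and
`ε₂·ε_{p₁p₂}·ε_{2p₁p₂}` is a square in `K₃⁺ = ℚ(√2, √(p₁p₂))`, then the order of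
`Cl₂(K₃)` equals `2·h₂(p₁p₂)·h₂(-p₁p₂)`, where `K₃ = ℚ(√2, √(p₁p₂), i)`. -/
theorem stmt_11 (p₁ p₂ : ℕ) (hp₁ : p₁.Prime) (hp₂ : p₂.Prime) (hne : p₁ ≠ p₂)
    (hm₁ : p₁ % 8 = 5) (hm₂ : p₂ % 8 = 5)
    (hpell : ∃ x y : ℤ, x ^ 2 - (p₁ : ℤ) * p₂ * y ^ 2 = -1)
    (Fp Fm K₃ : IntermediateField ℚ ℂ)
    (hFp : Fp = ℚ⟮((Real.sqrt ((p₁ : ℝ) * p₂) : ℝ) : ℂ)⟯)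
    (hFm : Fm = ℚ⟮((Real.sqrt ((p₁ : ℝ) * p₂) : ℝ) : ℂ) * Complex.I⟯)
    (hK₃ : K₃ = ℚ⟮((Real.sqrt 2 : ℝ) : ℂ), ((Real.sqrt ((p₁ : ℝ) * p₂) : ℝ) : ℂ), Complex.I⟯)
    [NumberField Fp] [NumberField Fm] [NumberField K₃]
    (ε₂ εp εd : ℝ)
    (hε₂ : IsFundUnit 2 ε₂) (hεp : IsFundUnit (p₁ * p₂) εp) (hεd : IsFundUnit (2 * p₁ * p₂) εd)
    (hsq : ∃ t : ℝ, t ∈ ℚ⟮Real.sqrt 2, Real.sqrt ((p₁ : ℝ) * p₂)⟯ ∧ t ^ 2 = ε₂ * εp * εd) :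
    ∀ (P : Sylow 2 (ClassGroup (RingOfIntegers K₃)))
      (Q : Sylow 2 (ClassGroup (RingOfIntegers Fp)))
      (R : Sylow 2 (ClassGroup (RingOfIntegers Fm))),
      Nat.card P = 2 * (Nat.card Q * Nat.card R) := by
  intro P Q R
  rw [card_sylow_two_classGroup, card_sylow_two_classGroup, card_sylow_two_classGroup]
  obtain ⟨t, ht, htε⟩ := hsq
  have hcast : (p₁ : ℝ) * p₂ = (p₁ * p₂ : ℕ) := by push_cast; rfl
  rw [hcast] at hFp hFm hK₃ ht
  have hmem {x : ℂ} (hx : x ∈ ({((Real.sqrt 2 : ℝ) : ℂ), ((Real.sqrt (p₁ * p₂ : ℕ) : ℝ) : ℂ),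
      Complex.I} : Set ℂ)) : x ∈ K₃ := hK₃ ▸ subset_adjoin ℚ _ hx
  obtain ⟨φ, hφ⟩ : ∃ φ : K₃ →+* ℂ, ∀ x, φ x = (x : ℂ) := ⟨algebraMap K₃ ℂ, fun _ => rfl⟩
  obtain ⟨r, hr⟩ : ∃ r : K₃, φ r = (Real.sqrt 2 : ℝ) := ⟨⟨_, hmem (Or.inl rfl)⟩, hφ _⟩
  obtain ⟨s, hs⟩ : ∃ s : K₃, φ s = (Real.sqrt (p₁ * p₂ : ℕ) : ℝ) := ⟨⟨_, hmem (Or.inr (Or.inl rfl))⟩, hφ _⟩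
  obtain ⟨i, hi⟩ : ∃ i : K₃, φ i = Complex.I := ⟨⟨_, hmem (Or.inr (Or.inr rfl))⟩, hφ _⟩
  have hsqrt (D : ℕ) : ((Real.sqrt D : ℝ) : ℂ) ^ 2 = D := by
    rw [← Complex.ofReal_pow, Real.sq_sqrt (Nat.cast_nonneg D), Complex.ofReal_natCast]
  have hsf : Squarefree ((p₁ * p₂ : ℕ) : ℤ) := by
    rw [Int.squarefree_natCast, Nat.squarefree_mul ((Nat.coprime_primes hp₁ hp₂).mpr hne)]
    exact ⟨hp₁.prime.squarefree, hp₂.prime.squarefree⟩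
  have h : IsTriquadratic (p₁ * p₂) r s i :=
    { squarefree := hsf
      one_lt := Nat.one_lt_mul_iff.mpr ⟨hp₁.pos, hp₂.pos, Or.inl hp₁.one_lt⟩
      mod_four := by rw [Nat.mul_mod, show p₁ % 4 = 1 by omega, show p₂ % 4 = 1 by omega]
      sq_two := φ.injective (by rw [map_pow, hr, map_intCast]; simpa using hsqrt 2)
      sq_m := φ.injective (by simpa [hs] using hsqrt (p₁ * p₂))
      sq_i := φ.injective (by simp [hi])
      adjoin_eq_top := adjoin_eq_top_of_eq (hK₃.trans (congrArg (adjoin ℚ) (by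
        rw [Set.image_insert_eq, Set.image_pair, ← hφ, ← hφ, ← hφ, hr, hs, hi]))) }
  have hrs : φ (r * s) = (Real.sqrt (2 * p₁ * p₂ : ℕ) : ℝ) := by
    rw [map_mul, hr, hs, mul_assoc, Nat.cast_mul 2, Real.sqrt_mul (by norm_num)]
    simp
  have hrs2 : (r * s) ^ 2 = ((2 * p₁ * p₂ : ℕ) : ℤ) := by
    rw [mul_pow, h.sq_two, h.sq_m]
    push_cast
    ring
  obtain ⟨xa, ya, hεa, hna⟩ := hε₂.exists_norm_neg_one
  obtain ⟨a, ha, hφa⟩ := exists_unit_of_eq (D := 2) h.sq_two hr hεa (Or.inr rfl) hna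
  obtain ⟨b, n, hn, hφb, xb, yb, hb, hnb⟩ := hεp.exists_unit h.sq_m hs
  obtain ⟨d, n', hn', hφd, xd, yd, hd, hnd⟩ := hεd.exists_unit hrs2 hrs
  obtain ⟨z, hz, hφz⟩ := exists_mem_adjoin_pair hr hs ht
  obtain ⟨e, hez, he⟩ := exists_unit_sq_eq (x := z) (u := a * b * d) (φ.injective (by
    rw [map_pow, hφz, Units.coe_mul, Units.coe_mul, map_mul, map_mul, hφa, hφb, hφd,
      ← Complex.ofReal_pow, htε]
    push_cast
    rfl))
  have hS : h.IsUnitSystem a b d e n n' :=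
    { coe_a := ⟨xa, ya, ha, hna⟩
      coe_b := ⟨xb, yb, hb, hnb⟩
      coe_d := ⟨xd, yd, hd, by push_cast at hnd ⊢; rwa [← mul_assoc]⟩
      hn := hn
      hn' := hn'
      sq_e := he
      mem_e := hez ▸ hz }
  rw [h.factorization_two_classNumber hp₁ hp₂ hne hm₁ hm₂ hε₂ hεp hεd hS hr hs hφa hφb hφd,
    classNumber_adjoin_of_eq φ (s := s) (hs ▸ hFp),
    classNumber_adjoin_of_eq φ (s := i * s) (by rw [hFm, map_mul, hi, hs, mul_comm])]
  ring
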